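/- (Narrow region principle, parabolic.) Let n ≥ 1, s ∈ (0,1), 0 < α ≤ 1. There exists a constant C > 0, depending only on n and s, with the following property. Let Ω ⊂ ℝⁿ be a bounded domain. Suppose U(x,t) is such that U(·,t) ∈ C²(Ω) ∩ L̃_{2s} for each t, U(x,·) ∈ C¹(ℝ) ∩ L⁻_α(ℝ) for each x, U is bounded from below on (closure of Ω) × ℝ, and for each t ∈ ℝ the function U(·,t) is lower semicontinuous on the closure of Ω. Assume ∂_t^α U(x,t) + (−Δ)^s U(x,t) − ΔU(x,t) + C(x,t)·U(x,t) ≥ 0 for all (x,t) ∈ Ω × ℝ and U(x,t) ≥ 0 for all (x,t) ∈ (ℝⁿ∖Ω) × ℝ, where C(x,t) is bounded from below on Ω × ℝ. If the width l_n(Ω) of Ω in the x_n-direction satisfies l_n(Ω)·|inf_{Ω×ℝ} C(x,t)|^{1/(2s)} ≤ C, then U(x,t) ≥ 0 for all (x,t) ∈ Ω × ℝ. -/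

import Mathlib

open MeasureTheory Filter Set

noncomputable section

/-- `ℝⁿ` as a Euclidean space. -/
abbrev En (n : ℕ) : Type := EuclideanSpace ℝ (Fin n)

/-- `HasFracLap n s Cns u x L` says that the principal value defining the fractional
Laplacian `(-Δ)ˢ u (x) = Cns · P.V. ∫ (u x - u y)/|x-y|^{n+2s} dy` exists and equals `L`. -/
def HasFracLap (n : ℕ) (s Cns : ℝ) (u : En n → ℝ) (x : En n) (L : ℝ) : Prop :=
  Tendsto
    (fun ε : ℝ =>
      Cns * ∫ y in {y : En n | ε ≤ ‖x - y‖}, (u x - u y) / ‖x - y‖ ^ ((n : ℝ) + 2 * s))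
    (nhdsWithin 0 (Set.Ioi 0)) (nhds L)

/-- The classical Laplacian `Δu(x) = ∑ ∂²u/∂xᵢ²`. -/
def lap {n : ℕ} (u : En n → ℝ) (x : En n) : ℝ :=
  ∑ i : Fin n, iteratedFDeriv ℝ 2 u x fun _ => EuclideanSpace.single i (1 : ℝ)

/-- Membership in the tail space `L_{2s}`. -/
def MemL2s (n : ℕ) (s : ℝ) (u : En n → ℝ) : Prop :=
  LocallyIntegrable u volume ∧
    Integrable (fun x : En n => u x / (1 + ‖x‖ ^ ((n : ℝ) + 2 * s))) volume

/-- The Marchaud fractional time derivative of order `α ∈ (0,1)`; for `α = 1` it is the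
classical derivative. -/
def marchaud (α : ℝ) (v : ℝ → ℝ) (t : ℝ) : ℝ :=
  if α = 1 then deriv v t
  else (α / Real.Gamma (1 - α)) * ∫ τ in Set.Iio t, (v t - v τ) / (t - τ) ^ (1 + α)

/-- Membership in the space `𝓛⁻_α(ℝ)`. -/
def MemLminus (α : ℝ) (v : ℝ → ℝ) : Prop :=
  LocallyIntegrable v volume ∧
    ∀ t : ℝ, IntegrableOn (fun τ : ℝ => v τ / (1 + |τ| ^ (1 + α))) (Set.Iio t) volume

/-- Width of a set in the direction of the coordinate `i₀`. -/
def widthLast {n : ℕ} (i₀ : Fin n) (Ω : Set (En n)) : ℝ :=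
  sSup ((fun x : En n => x i₀) '' Ω) - sInf ((fun x : En n => x i₀) '' Ω)

/-- The unit vector in the direction of the coordinate `i₀`. -/
def eDir {n : ℕ} (i₀ : Fin n) : En n := EuclideanSpace.single i₀ (1 : ℝ)

set_option linter.unusedSectionVars false

section Averages

/-- Bounded measurable real functions. -/
structure BM {V : Type*} [MeasurableSpace V] (f : V → ℝ) : Prop where
  meas : Measurable f
  bdd : ∃ C, ∀ z, |f z| ≤ C

/-- Average of the translates of `f` against a measure of jumps. -/
def avg {V : Type*} [Add V] [MeasurableSpace V] (N : Measure V) (f : V → ℝ) (z : V) : ℝ :=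
  ∫ ζ, f (z + ζ) ∂N

/-- Generator of the pure jump process with jump measure `N`. -/
def gen {V : Type*} [Add V] [MeasurableSpace V] (N : Measure V) (f : V → ℝ) (z : V) : ℝ :=
  ∫ ζ, (f (z + ζ) - f z) ∂N

namespace BM

variable {V : Type*} [MeasurableSpace V] {f g : V → ℝ}

theorem const (c : ℝ) : BM (fun _ : V => c) := ⟨measurable_const, |c|, fun _ => le_rfl⟩

theorem add (hf : BM f) (hg : BM g) : BM (fun z => f z + g z) := by
  obtain ⟨C, hC⟩ := hf.bdd
  obtain ⟨D, hD⟩ := hg.bdd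
  exact ⟨hf.meas.add hg.meas, C + D, fun z => (abs_add_le _ _).trans (add_le_add (hC z) (hD z))⟩

theorem const_mul (c : ℝ) (hf : BM f) : BM (fun z => c * f z) := by
  obtain ⟨C, hC⟩ := hf.bdd
  refine ⟨hf.meas.const_mul c, |c| * C, fun z => ?_⟩
  rw [abs_mul]
  exact mul_le_mul_of_nonneg_left (hC z) (abs_nonneg _)

theorem sub (hf : BM f) (hg : BM g) : BM (fun z => f z - g z) := by
  simpa [sub_eq_add_neg] using hf.add (hg.const_mul (-1))

theorem indicator_one {A : Set V} (hA : MeasurableSet A) : BM (A.indicator fun _ => (1 : ℝ)) := by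
  refine ⟨measurable_const.indicator hA, 1, fun z => ?_⟩
  by_cases h : z ∈ A <;> simp [h]

theorem comp {V' : Type*} [MeasurableSpace V'] {φ : V' → V} (hf : BM f) (hφ : Measurable φ) :
    BM (fun z => f (φ z)) :=
  ⟨hf.meas.comp hφ, hf.bdd.imp fun _ h z => h (φ z)⟩

theorem integrable (hf : BM f) (N : Measure V) [IsFiniteMeasure N] : Integrable f N := by
  obtain ⟨C, hC⟩ := hf.bdd
  exact Integrable.of_bound hf.meas.aestronglyMeasurable C (Eventually.of_forall hC)

end BM

variable {V : Type*} [AddCommGroup V] [MeasurableSpace V] [MeasurableAdd₂ V]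
  {f g : V → ℝ} {N M : Measure V}

theorem BM.translate (hf : BM f) (z : V) : BM (fun ζ => f (z + ζ)) :=
  hf.comp (measurable_const_add z)

theorem abs_avg_le [IsFiniteMeasure N] {C : ℝ} (hC : ∀ z, |f z| ≤ C) (z : V) :
    |avg N f z| ≤ C * N.real univ := by
  have := norm_integral_le_of_norm_le_const (μ := N) (f := fun ζ => f (z + ζ)) (C := C)
    (Eventually.of_forall fun ζ => hC _)
  simpa [avg] using this

theorem BM.avg [IsFiniteMeasure N] (hf : BM f) : BM (avg N f) := by
  obtain ⟨C, hC⟩ := hf.bdd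
  refine ⟨?_, C * N.real univ, abs_avg_le hC⟩
  have h : StronglyMeasurable (fun p : V × V => f (p.1 + p.2)) :=
    (hf.meas.comp measurable_add).stronglyMeasurable
  exact h.integral_prod_right.measurable

theorem gen_eq [IsFiniteMeasure N] (hf : BM f) (z : V) :
    gen N f z = avg N f z - N.real univ * f z := by
  rw [gen, integral_sub ((hf.translate z).integrable N) (integrable_const _)]
  simp [_root_.avg]

theorem BM.gen [IsFiniteMeasure N] (hf : BM f) : BM (gen N f) := by
  rw [show _root_.gen N f = fun z => _root_.avg N f z - N.real univ * f z from
    funext fun z => gen_eq hf z]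
  exact hf.avg.sub (hf.const_mul _)

theorem avg_add [IsFiniteMeasure N] (hf : BM f) (hg : BM g) (z : V) :
    avg N (fun z => f z + g z) z = avg N f z + avg N g z :=
  integral_add ((hf.translate z).integrable N) ((hg.translate z).integrable N)

theorem avg_sub [IsFiniteMeasure N] (hf : BM f) (hg : BM g) (z : V) :
    avg N (fun z => f z - g z) z = avg N f z - avg N g z :=
  integral_sub ((hf.translate z).integrable N) ((hg.translate z).integrable N)

theorem avg_const_mul (c : ℝ) (z : V) :
    avg N (fun z => c * f z) z = c * avg N f z :=
  integral_const_mul _ _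

theorem avg_const (c : ℝ) (z : V) : avg N (fun _ => c) z = N.real univ * c := by
  simp [avg]

theorem avg_const_prob [IsProbabilityMeasure N] (c : ℝ) (z : V) : avg N (fun _ => c) z = c := by
  simp [avg]

theorem avg_mono [IsFiniteMeasure N] (hf : BM f) (hg : BM g) {z : V}
    (h : ∀ᵐ ζ ∂N, f (z + ζ) ≤ g (z + ζ)) : avg N f z ≤ avg N g z :=
  integral_mono_ae ((hf.translate z).integrable N) ((hg.translate z).integrable N) h

theorem avg_nonneg (h : ∀ z, 0 ≤ f z) (z : V) : 0 ≤ avg N f z :=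
  integral_nonneg fun _ => h _

theorem gen_add [IsFiniteMeasure N] (hf : BM f) (hg : BM g) (z : V) :
    gen N (fun z => f z + g z) z = gen N f z + gen N g z := by
  rw [gen_eq (hf.add hg), gen_eq hf, gen_eq hg, avg_add hf hg]; ring

theorem gen_sub [IsFiniteMeasure N] (hf : BM f) (hg : BM g) (z : V) :
    gen N (fun z => f z - g z) z = gen N f z - gen N g z := by
  rw [gen_eq (hf.sub hg), gen_eq hf, gen_eq hg, avg_sub hf hg]; ring

theorem gen_const_mul (c : ℝ) (z : V) :
    gen N (fun z => c * f z) z = c * gen N f z := by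
  simp only [gen, ← mul_sub]
  exact integral_const_mul _ _

theorem gen_const (c : ℝ) (z : V) : gen N (fun _ => c) z = 0 := by
  simp [gen]

theorem gen_nonpos {z : V} (h : ∀ᵐ ζ ∂N, f (z + ζ) ≤ f z) : gen N f z ≤ 0 :=
  integral_nonpos_of_ae (h.mono fun _ h => sub_nonpos.2 h)

theorem gen_measure_add [IsFiniteMeasure N] [IsFiniteMeasure M] (hf : BM f) (z : V) :
    gen (N + M) f z = gen N f z + gen M f z :=
  integral_add_measure (((hf.translate z).sub (.const _)).integrable N)
    (((hf.translate z).sub (.const _)).integrable M)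

theorem avg_comm [IsFiniteMeasure N] [IsFiniteMeasure M] (hf : BM f) (z : V) :
    avg N (avg M f) z = avg M (avg N f) z := by
  simp only [avg]
  rw [integral_integral_swap]
  · simp only [add_right_comm z, add_assoc]
  · exact (hf.comp (φ := fun p : V × V => z + p.1 + p.2) (by fun_prop)).integrable _

theorem gen_avg [IsFiniteMeasure N] [IsFiniteMeasure M] (hf : BM f) (z : V) :
    gen N (avg M f) z = avg M (gen N f) z := by
  rw [gen_eq hf.avg, avg_comm hf, show gen N f = fun z => avg N f z - N.real univ * f z from
    funext fun z => gen_eq hf z, avg_sub hf.avg (hf.const_mul _), avg_const_mul]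

theorem abs_gen_le [IsFiniteMeasure N] (hf : BM f) {C : ℝ} (hC : ∀ z, |f z| ≤ C) (z : V) :
    |gen N f z| ≤ 2 * C * N.real univ := by
  rw [gen_eq hf]
  have h1 := abs_avg_le (N := N) hC z
  have h2 : |N.real univ * f z| ≤ C * N.real univ := by
    rw [abs_mul, abs_of_nonneg measureReal_nonneg, mul_comm]
    exact mul_le_mul_of_nonneg_right (hC z) measureReal_nonneg
  exact (abs_sub _ _).trans (by linarith)

/-- The convolution powers of a measure. -/
def convPow (N : Measure V) : ℕ → Measure V
  | 0 => Measure.dirac 0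
  | k + 1 => (convPow N k).conv N

instance [IsFiniteMeasure N] (k : ℕ) : IsFiniteMeasure (convPow N k) := by
  induction k with
  | zero => exact inferInstanceAs (IsFiniteMeasure (Measure.dirac (0 : V)))
  | succ k ih => exact inferInstanceAs (IsFiniteMeasure ((convPow N k).conv N))

theorem avg_convPow_succ [IsFiniteMeasure N] (hf : BM f) (k : ℕ) (z : V) :
    avg (convPow N (k + 1)) f z = avg (convPow N k) (avg N f) z := by
  simp only [avg, convPow]
  rw [integral_conv]
  · simp only [add_assoc]
  · exact (hf.translate z).integrable _

theorem measureReal_convPow [IsFiniteMeasure N] (k : ℕ) :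
    (convPow N k).real univ = N.real univ ^ k := by
  induction k with
  | zero => simp [convPow]
  | succ k ih =>
    have h := avg_convPow_succ (N := N) (BM.const (V := V) 1) k 0
    rw [show avg N (fun _ : V => (1 : ℝ)) = fun _ => N.real univ by
      ext z; rw [avg_const, mul_one], avg_const, avg_const, mul_one, ih] at h
    rw [h, pow_succ]

/-- The resolvent of a bounded jump operator is the average against a finite measure. -/
theorem exists_resolvent (N : Measure V) [IsFiniteMeasure N] {lam : ℝ} (hlam : 0 < lam) :
    ∃ ρ : Measure V, IsFiniteMeasure ρ ∧ lam * ρ.real univ = 1 ∧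
      ∀ f : V → ℝ, BM f → ∀ z, lam * avg ρ f z - avg ρ (gen N f) z = f z := by
  set b := N.real univ with hb
  have hb0 : 0 ≤ b := measureReal_nonneg
  set q : ℝ := (lam + b)⁻¹ with hq
  have hq0 : 0 < q := by positivity
  have hqb : q * b < 1 := by
    rw [hq, inv_mul_lt_iff₀ (by positivity)]; linarith
  set ρ : Measure V := Measure.sum fun k => ENNReal.ofReal (q ^ (k + 1)) • convPow N k with hρ
  have hmass : ∀ k, (ENNReal.ofReal (q ^ (k + 1)) • convPow N k) univ =
      ENNReal.ofReal (q * (q * b) ^ k) := by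
    intro k
    rw [Measure.smul_apply, smul_eq_mul, ← ofReal_measureReal (μ := convPow N k),
      measureReal_convPow, ← ENNReal.ofReal_mul (by positivity)]
    congr 1
    rw [← hb]; ring
  have hsum : Summable fun k => q * (q * b) ^ k :=
    (summable_geometric_of_lt_one (by positivity) hqb).mul_left q
  have hfin : IsFiniteMeasure ρ := by
    refine ⟨?_⟩
    rw [hρ, Measure.sum_apply _ MeasurableSet.univ]
    simp only [hmass]
    rw [← ENNReal.ofReal_tsum_of_nonneg (fun k => by positivity) hsum]
    exact ENNReal.ofReal_lt_top
  have hser : ∀ f : V → ℝ, BM f → ∀ z,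
      HasSum (fun k => q ^ (k + 1) * avg (convPow N k) f z) (avg ρ f z) := by
    intro f hf z
    have h := hasSum_integral_measure (μ := fun k => ENNReal.ofReal (q ^ (k + 1)) • convPow N k)
      (f := fun ζ => f (z + ζ)) ((hf.translate z).integrable ρ)
    simp only [integral_smul_measure, ENNReal.toReal_ofReal (pow_pos hq0 _).le] at h
    exact h
  have heq : ∀ f : V → ℝ, BM f → ∀ z, lam * avg ρ f z - avg ρ (gen N f) z = f z := by
    intro f hf z
    have e1 : avg ρ (gen N f) z = avg ρ (avg N f) z - b * avg ρ f z := by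
      rw [show gen N f = fun z => avg N f z - b * f z from funext fun z => gen_eq hf z,
        avg_sub hf.avg (hf.const_mul _), avg_const_mul]
    have h1 := (hser f hf z).mul_left (lam + b)
    have h2 := hser _ (hf.avg (N := N)) z
    have h3 : ∀ k, (lam + b) * (q ^ (k + 1) * avg (convPow N k) f z) =
        q ^ k * avg (convPow N k) f z := by
      intro k
      rw [pow_succ, hq]
      field_simp
    simp only [h3] at h1
    simp only [← avg_convPow_succ hf] at h2
    have h4 := (hasSum_nat_add_iff' (f := fun k => q ^ k * avg (convPow N k) f z) 1).2 h1
    have h5 := h2.unique h4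
    have h6 : avg (convPow N 0) f z = f z := by
      rw [avg, convPow, integral_dirac' _ _ (hf.translate z).meas.stronglyMeasurable, add_zero]
    simp [h6] at h5
    rw [e1, h5]; ring
  refine ⟨ρ, hfin, ?_, heq⟩
  have h := heq (fun _ => 1) (BM.const 1) 0
  rw [show gen N (fun _ : V => (1 : ℝ)) = fun _ => 0 from funext fun z => gen_const 1 z] at h
  simpa [avg_const] using h

end Averages

section Mollifiers

/-- The probability measure with density a normalized bump function. -/
def moll {V : Type*} [NormedAddCommGroup V] [NormedSpace ℝ V] [HasContDiffBump V]
    [MeasureSpace V] (φ : ContDiffBump (0 : V)) : Measure V :=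
  volume.withDensity fun x => ENNReal.ofReal (φ.normed volume x)

variable {V : Type*} [NormedAddCommGroup V] [NormedSpace ℝ V] [HasContDiffBump V]
  [FiniteDimensional ℝ V] [MeasureSpace V] [BorelSpace V]
  [Measure.IsAddHaarMeasure (volume : Measure V)] (φ : ContDiffBump (0 : V))

theorem measurable_normed : Measurable (φ.normed volume) := φ.continuous_normed.measurable

instance isProbabilityMeasure_moll : IsProbabilityMeasure (moll φ) := by
  refine ⟨?_⟩
  rw [moll, withDensity_apply _ MeasurableSet.univ, Measure.restrict_univ,
    ← ofReal_integral_eq_lintegral_ofReal φ.integrable_normed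
      (Eventually.of_forall φ.nonneg_normed), φ.integral_normed, ENNReal.ofReal_one]

theorem ae_moll_norm_lt : ∀ᵐ y ∂moll φ, ‖y‖ < φ.rOut := by
  rw [moll, ae_withDensity_iff (measurable_normed φ).ennreal_ofReal]
  refine Eventually.of_forall fun y hy => ?_
  have h : y ∈ Function.support (φ.normed volume) := by
    intro h; apply hy; rw [h, ENNReal.ofReal_zero]
  rw [φ.support_normed_eq] at h
  simpa using h

theorem avg_moll (f : V → ℝ) (x : V) :
    avg (moll φ) f x = ∫ y, φ.normed volume y * f (x + y) := by
  rw [avg, moll, integral_withDensity_eq_integral_toReal_smul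
    (measurable_normed φ).ennreal_ofReal (Eventually.of_forall fun _ => ENNReal.ofReal_lt_top)]
  simp [ENNReal.toReal_ofReal (φ.nonneg_normed _)]

theorem avg_moll' (f : V → ℝ) (x : V) :
    avg (moll φ) f x = ∫ w, φ.normed volume (w - x) * f w := by
  rw [avg_moll, ← integral_add_left_eq_self (fun w => φ.normed volume (w - x) * f w) x]
  simp only [add_sub_cancel_left]

theorem integrable_normed_sub (x : V) :
    Integrable (fun w => φ.normed volume (w - x)) (volume : Measure V) :=
  φ.integrable_normed.comp_sub_right x

theorem integrable_mul_of_abs_le_one {χ f : V → ℝ} (hχ : Integrable χ) (hf : Measurable f)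
    (h1 : ∀ z, |f z| ≤ 1) : Integrable fun w => χ w * f w :=
  hχ.mul_bdd (c := 1) hf.aestronglyMeasurable (Eventually.of_forall h1)

theorem exists_lipschitz_normed : ∃ L : ℝ, 0 ≤ L ∧
    ∀ x y, |φ.normed volume x - φ.normed volume y| ≤ L * ‖x - y‖ := by
  obtain ⟨C, hC⟩ := (φ.contDiff_normed (μ := volume) (n := 1)).lipschitzWith_of_hasCompactSupport
    φ.hasCompactSupport_normed (by simp)
  refine ⟨C, C.2, fun x y => ?_⟩
  simpa [Real.dist_eq, dist_eq_norm] using hC.dist_le_mul x y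

/-- Mollification turns functions bounded by one into uniformly Lipschitz functions. -/
theorem exists_lipschitz_avg_moll : ∃ L : ℝ, 0 ≤ L ∧ ∀ f : V → ℝ, Measurable f →
    (∀ z, |f z| ≤ 1) → ∀ x y, |avg (moll φ) f x - avg (moll φ) f y| ≤ L * ‖x - y‖ := by
  obtain ⟨L, hL0, hL⟩ := exists_lipschitz_normed φ
  set v : ℝ := volume.real (Metric.ball (0 : V) φ.rOut) with hv
  refine ⟨L * (2 * v), by positivity, fun f hf h1 x y => ?_⟩
  have hball : ∀ x : V, volume.real (Metric.ball x φ.rOut) = v := fun x => by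
    rw [hv, measureReal_def, measureReal_def, Measure.addHaar_ball_center]
  rw [avg_moll', avg_moll', ← integral_sub
    (integrable_mul_of_abs_le_one (integrable_normed_sub φ x) hf h1)
    (integrable_mul_of_abs_le_one (integrable_normed_sub φ y) hf h1)]
  simp only [← sub_mul]
  set S : Set V := Metric.ball x φ.rOut ∪ Metric.ball y φ.rOut with hS
  have hz : ∀ w, w ∉ S → (φ.normed volume (w - x) - φ.normed volume (w - y)) * f w = 0 := by
    intro w hw
    have hout : ∀ x, w ∉ Metric.ball x φ.rOut → φ.normed volume (w - x) = 0 := by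
      intro x hx
      by_contra h
      have h' : w - x ∈ Function.support (φ.normed (volume : Measure V)) := h
      rw [φ.support_normed_eq] at h'
      exact hx (by simpa [dist_eq_norm] using h')
    rw [hout x fun h => hw (Or.inl h), hout y fun h => hw (Or.inr h)]; simp
  rw [← setIntegral_eq_integral_of_forall_compl_eq_zero hz]
  have hfin : volume S < ⊤ :=
    (measure_union_le _ _).trans_lt (ENNReal.add_lt_top.2 ⟨measure_ball_lt_top, measure_ball_lt_top⟩)
  rw [← Real.norm_eq_abs]
  refine (norm_setIntegral_le_of_norm_le_const (C := L * ‖x - y‖) hfin fun w _ => ?_).trans ?_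
  · rw [norm_mul]
    have := hL (w - x) (w - y)
    rw [sub_sub_sub_cancel_left, norm_sub_rev] at this
    exact (mul_le_of_le_one_right (norm_nonneg _) (h1 w)).trans this
  · have h2 : volume.real S ≤ 2 * v := by
      refine (measureReal_union_le _ _).trans ?_
      rw [hball, hball]; linarith
    calc L * ‖x - y‖ * volume.real S ≤ L * ‖x - y‖ * (2 * v) := by gcongr
      _ = L * (2 * v) * ‖x - y‖ := by ring

end Mollifiers

section SpaceTime

variable {n : ℕ}

/-- A measure of spatial jumps as a measure of space-time jumps. -/
def inX (m : Measure (En n)) : Measure (En n × ℝ) := m.map fun y => (y, (0 : ℝ))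

/-- A measure of temporal jumps as a measure of space-time jumps. -/
def inT (m : Measure ℝ) : Measure (En n × ℝ) := m.map fun s => ((0 : En n), s)

/-- Product mollifier in space-time. -/
def mol (φ : ContDiffBump (0 : En n)) (θ : ContDiffBump (0 : ℝ)) : Measure (En n × ℝ) :=
  (moll φ).prod (moll θ)

instance (m : Measure (En n)) [IsFiniteMeasure m] : IsFiniteMeasure (inX m) :=
  inferInstanceAs (IsFiniteMeasure (m.map _))

instance (m : Measure ℝ) [IsFiniteMeasure m] : IsFiniteMeasure (inT (n := n) m) :=
  inferInstanceAs (IsFiniteMeasure (m.map _))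

instance (m : Measure (En n)) [IsProbabilityMeasure m] : IsProbabilityMeasure (inX m) :=
  Measure.isProbabilityMeasure_map (by fun_prop)

instance (m : Measure ℝ) [IsProbabilityMeasure m] : IsProbabilityMeasure (inT (n := n) m) :=
  Measure.isProbabilityMeasure_map (by fun_prop)

instance (φ : ContDiffBump (0 : En n)) (θ : ContDiffBump (0 : ℝ)) :
    IsProbabilityMeasure (mol φ θ) :=
  inferInstanceAs (IsProbabilityMeasure ((moll φ).prod (moll θ)))

variable {f : En n × ℝ → ℝ} {m : Measure (En n)} {m' : Measure ℝ}
  {φ : ContDiffBump (0 : En n)} {θ : ContDiffBump (0 : ℝ)}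

theorem BM.slice (hf : BM f) (t : ℝ) : BM fun x => f (x, t) := hf.comp (by fun_prop)

theorem BM.slice' (hf : BM f) (x : En n) : BM fun t => f (x, t) := hf.comp (by fun_prop)

theorem avg_inX (hf : Measurable f) (z : En n × ℝ) :
    avg (inX m) f z = avg m (fun x => f (x, z.2)) z.1 := by
  rw [avg, inX, integral_map (by fun_prop)
    (show Measurable fun ζ => f (z + ζ) by fun_prop).aestronglyMeasurable]
  obtain ⟨x, t⟩ := z
  simp [avg]

theorem avg_inT (hf : Measurable f) (z : En n × ℝ) :
    avg (inT m') f z = avg m' (fun t => f (z.1, t)) z.2 := by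
  rw [avg, inT, integral_map (by fun_prop)
    (show Measurable fun ζ => f (z + ζ) by fun_prop).aestronglyMeasurable]
  obtain ⟨x, t⟩ := z
  simp [avg]

theorem gen_inX (hf : Measurable f) (z : En n × ℝ) :
    gen (inX m) f z = gen m (fun x => f (x, z.2)) z.1 := by
  rw [gen, inX, integral_map (by fun_prop)
    (show Measurable fun ζ => f (z + ζ) - f z by fun_prop).aestronglyMeasurable]
  obtain ⟨x, t⟩ := z
  simp [gen]

theorem gen_inT (hf : Measurable f) (z : En n × ℝ) :
    gen (inT m') f z = gen m' (fun t => f (z.1, t)) z.2 := by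
  rw [gen, inT, integral_map (by fun_prop)
    (show Measurable fun ζ => f (z + ζ) - f z by fun_prop).aestronglyMeasurable]
  obtain ⟨x, t⟩ := z
  simp [gen]

theorem avg_mol (hf : BM f) (z : En n × ℝ) :
    avg (mol φ θ) f z = avg (inX (moll φ)) (avg (inT (moll θ)) f) z := by
  rw [avg_inX hf.avg.meas, avg, mol, integral_prod _ ((hf.translate z).integrable _)]
  obtain ⟨x, t⟩ := z
  simp only [avg_inT hf.meas]
  simp [avg]

theorem avg_mol' (hf : BM f) (z : En n × ℝ) :
    avg (mol φ θ) f z = avg (inT (moll θ)) (avg (inX (moll φ)) f) z := by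
  rw [avg_mol hf, avg_comm hf]

theorem ae_inX_snd : ∀ᵐ ζ ∂inX m, ζ.2 = 0 := by
  rw [inX, ae_map_iff (by fun_prop) (measurableSet_eq_fun (by fun_prop) (by fun_prop))]
  simp

theorem ae_inT_fst : ∀ᵐ ζ ∂inT (n := n) m', ζ.1 = 0 := by
  rw [inT, ae_map_iff (by fun_prop) (measurableSet_eq_fun (by fun_prop) (by fun_prop))]
  simp

theorem ae_inX_moll (φ : ContDiffBump (0 : En n)) :
    ∀ᵐ ζ ∂inX (moll φ), ‖ζ.1‖ < φ.rOut ∧ ζ.2 = 0 := by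
  refine Eventually.and ?_ ae_inX_snd
  rw [inX, ae_map_iff (by fun_prop) (measurableSet_lt (by fun_prop) (by fun_prop))]
  exact ae_moll_norm_lt φ

theorem ae_inT_moll (θ : ContDiffBump (0 : ℝ)) :
    ∀ᵐ ζ ∂inT (n := n) (moll θ), ζ.1 = 0 ∧ |ζ.2| < θ.rOut := by
  refine Eventually.and ae_inT_fst ?_
  rw [inT, ae_map_iff (by fun_prop) (measurableSet_lt (by fun_prop) (by fun_prop))]
  exact ae_moll_norm_lt θ

theorem ae_mol (φ : ContDiffBump (0 : En n)) (θ : ContDiffBump (0 : ℝ)) :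
    ∀ᵐ ζ ∂mol φ θ, ‖ζ.1‖ < φ.rOut ∧ |ζ.2| < θ.rOut := by
  have h1 : ∀ᵐ ζ ∂mol φ θ, ‖ζ.1‖ < φ.rOut :=
    Measure.quasiMeasurePreserving_fst.ae (ae_moll_norm_lt φ)
  have h2 : ∀ᵐ ζ ∂mol φ θ, |ζ.2| < θ.rOut :=
    Measure.quasiMeasurePreserving_snd.ae (ae_moll_norm_lt θ)
  exact h1.and h2

theorem avg_le_of_ae {N : Measure (En n × ℝ)} [IsProbabilityMeasure N] (hf : BM f) {c : ℝ}
    {z : En n × ℝ} (h : ∀ᵐ ζ ∂N, f (z + ζ) ≤ c) : avg N f z ≤ c := by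
  have := avg_mono (N := N) hf (BM.const c) h
  rwa [avg_const_prob] at this

theorem le_avg_of_ae {N : Measure (En n × ℝ)} [IsProbabilityMeasure N] (hf : BM f) {c : ℝ}
    {z : En n × ℝ} (h : ∀ᵐ ζ ∂N, c ≤ f (z + ζ)) : c ≤ avg N f z := by
  have := avg_mono (N := N) (BM.const c) hf h
  rwa [avg_const_prob] at this

theorem abs_avg_sub_le_of_ae {N : Measure (En n × ℝ)} [IsProbabilityMeasure N] (hf : BM f) {c d : ℝ}
    {z : En n × ℝ} (h : ∀ᵐ ζ ∂N, |f (z + ζ) - d| ≤ c) : |avg N f z - d| ≤ c := by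
  rw [abs_le]
  constructor
  · have := le_avg_of_ae (N := N) hf (c := d - c) (z := z)
      (h.mono fun ζ h => by have := abs_le.1 h; linarith)
    linarith
  · have := avg_le_of_ae (N := N) hf (c := d + c) (z := z)
      (h.mono fun ζ h => by have := abs_le.1 h; linarith)
    linarith

/-- Mollified bounded functions are Lipschitz, uniformly over functions bounded by one. -/
theorem exists_lipschitz_avg_mol (φ : ContDiffBump (0 : En n)) (θ : ContDiffBump (0 : ℝ)) :
    ∃ L : ℝ, 0 ≤ L ∧ ∀ f : En n × ℝ → ℝ, Measurable f → (∀ z, |f z| ≤ 1) →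
      ∀ z z', |avg (mol φ θ) f z - avg (mol φ θ) f z'| ≤ L * ‖z - z'‖ := by
  obtain ⟨L1, hL1, h1⟩ := exists_lipschitz_avg_moll φ
  obtain ⟨L2, hL2, h2⟩ := exists_lipschitz_avg_moll θ
  refine ⟨L1 + L2, by positivity, fun f hf hb z z' => ?_⟩
  have hB : BM f := ⟨hf, 1, hb⟩
  obtain ⟨x, t⟩ := z
  obtain ⟨x', t'⟩ := z'
  have hbT : ∀ z, |avg (inT (moll θ)) f z| ≤ 1 := fun z => by
    simpa using abs_avg_le (N := inT (n := n) (moll θ)) hb z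
  have hbX : ∀ z, |avg (inX (moll φ)) f z| ≤ 1 := fun z => by
    simpa using abs_avg_le (N := inX (moll φ)) hb z
  have e1 : |avg (mol φ θ) f (x, t) - avg (mol φ θ) f (x', t)| ≤ L1 * ‖x - x'‖ := by
    rw [avg_mol hB, avg_mol hB, avg_inX hB.avg.meas, avg_inX hB.avg.meas]
    exact h1 _ (hB.avg.slice t).meas (fun x => hbT _) x x'
  have e2 : |avg (mol φ θ) f (x', t) - avg (mol φ θ) f (x', t')| ≤ L2 * ‖t - t'‖ := by
    rw [avg_mol' hB, avg_mol' hB, avg_inT hB.avg.meas, avg_inT hB.avg.meas]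
    exact h2 _ (hB.avg.slice' x').meas (fun x => hbX _) t t'
  have e3 : ‖x - x'‖ ≤ ‖((x, t) : En n × ℝ) - (x', t')‖ := le_max_left _ _
  have e4 : ‖t - t'‖ ≤ ‖((x, t) : En n × ℝ) - (x', t')‖ := le_max_right _ _
  calc _ ≤ _ := abs_sub_le _ (avg (mol φ θ) f (x', t)) _
    _ ≤ L1 * ‖x - x'‖ + L2 * ‖t - t'‖ := add_le_add e1 e2
    _ ≤ _ := by rw [add_mul]; gcongr

theorem exists_lipschitz_of_BM (φ : ContDiffBump (0 : En n)) (θ : ContDiffBump (0 : ℝ))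
    (hf : BM f) : ∃ L : ℝ, 0 ≤ L ∧
      ∀ z z', |avg (mol φ θ) f z - avg (mol φ θ) f z'| ≤ L * ‖z - z'‖ := by
  obtain ⟨L, hL, h⟩ := exists_lipschitz_avg_mol φ θ
  obtain ⟨C, hC⟩ := hf.bdd
  have hC0 : 0 < |C| + 1 := by positivity
  refine ⟨(|C| + 1) * L, by positivity, fun z z' => ?_⟩
  have h' := h (fun z => (|C| + 1)⁻¹ * f z) (hf.const_mul _).meas (fun z => by
    rw [abs_mul, abs_of_pos (inv_pos.2 hC0), inv_mul_le_iff₀ hC0]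
    linarith [hC z, le_abs_self C]) z z'
  rw [avg_const_mul, avg_const_mul, ← mul_sub, abs_mul, abs_of_pos (inv_pos.2 hC0),
    inv_mul_le_iff₀ hC0] at h'
  linarith

theorem continuous_avg_mol (hf : BM f) : Continuous (avg (mol φ θ) f) := by
  obtain ⟨L, hL, h⟩ := exists_lipschitz_of_BM φ θ hf
  exact (LipschitzWith.of_dist_le' fun z z' => by
    rw [Real.dist_eq, dist_eq_norm]; exact h z z').continuous

/-- Mollification in space only of a function continuous in time is jointly continuous. -/
theorem continuous_avg_inX_moll (hf : BM f) (hc : ∀ x, Continuous fun t => f (x, t)) :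
    Continuous (avg (inX (moll φ)) f) := by
  obtain ⟨L, hL, h⟩ := exists_lipschitz_avg_moll φ
  obtain ⟨C, hC⟩ := hf.bdd
  have hC0 : 0 < |C| + 1 := by positivity
  have key : ∀ x x' t, |avg (inX (moll φ)) f (x, t) - avg (inX (moll φ)) f (x', t)| ≤
      (|C| + 1) * L * ‖x - x'‖ := by
    intro x x' t
    have h' := h (fun x => (|C| + 1)⁻¹ * f (x, t)) ((hf.slice t).const_mul _).meas (fun z => by
      rw [abs_mul, abs_of_pos (inv_pos.2 hC0), inv_mul_le_iff₀ hC0]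
      linarith [hC (z, t), le_abs_self C]) x x'
    rw [avg_const_mul, avg_const_mul, ← mul_sub, abs_mul, abs_of_pos (inv_pos.2 hC0),
      inv_mul_le_iff₀ hC0] at h'
    rw [avg_inX hf.meas, avg_inX hf.meas]
    linarith
  have ht : ∀ x, Continuous fun t => avg (inX (moll φ)) f (x, t) := by
    intro x
    rw [show (fun t => avg (inX (moll φ)) f (x, t)) = fun t => ∫ y, f (x + y, t) ∂moll φ from
      funext fun t => avg_inX hf.meas _]
    refine continuous_of_dominated (bound := fun _ => C) (fun t => ?_) (fun t => ?_)
      (integrable_const _) (Eventually.of_forall fun y => hc _)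
    · exact ((hf.slice t).translate x).meas.aestronglyMeasurable
    · exact Eventually.of_forall fun y => hC _
  rw [continuous_iff_continuousAt]
  rintro ⟨x, t⟩
  rw [ContinuousAt, tendsto_iff_dist_tendsto_zero]
  have lim : Tendsto (fun z : En n × ℝ => (|C| + 1) * L * ‖z.1 - x‖ +
      |avg (inX (moll φ)) f (x, z.2) - avg (inX (moll φ)) f (x, t)|) (nhds (x, t)) (nhds 0) := by
    have hc : Continuous (fun z : En n × ℝ => (|C| + 1) * L * ‖z.1 - x‖ +
      |avg (inX (moll φ)) f (x, z.2) - avg (inX (moll φ)) f (x, t)|) := by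
      have := (ht x).comp (continuous_snd (X := En n))
      simp only [Function.comp_def] at this
      fun_prop
    simpa using hc.tendsto (x, t)
  refine squeeze_zero (fun _ => dist_nonneg) (fun z => ?_) lim
  rw [Real.dist_eq]
  exact (abs_sub_le _ (avg (inX (moll φ)) f (x, z.2)) _).trans
    (add_le_add (key z.1 x z.2) le_rfl)

end SpaceTime

section Comparison

theorem exists_bump {V : Type*} [NormedAddCommGroup V] [NormedSpace ℝ V] [HasContDiffBump V]
    {r : ℝ} (hr : 0 < r) : ∃ φ : ContDiffBump (0 : V), φ.rOut = r :=
  ⟨⟨r / 2, r, by positivity, by linarith⟩, rfl⟩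

variable {n : ℕ}

/-- Near the time `t`, all mollifications of `W` are subsolutions with right-hand side `-b`. -/
def MolSub (N : ℝ → Measure (En n × ℝ)) (W b : En n × ℝ → ℝ) (t ρ : ℝ) : Prop :=
  ∀ (φ : ContDiffBump (0 : En n)) (θ : ContDiffBump (0 : ℝ)), θ.rOut < ρ →
    ∀ x t', |t' - t| < ρ → ∀ η > 0, ∀ᶠ h in nhdsWithin 0 (Ioi 0),
      -avg (mol φ θ) b (x, t') - η ≤ gen (N h) (avg (mol φ θ) W) (x, t')

theorem MolSub.mono {N : ℝ → Measure (En n × ℝ)} {W b : En n × ℝ → ℝ} {t ρ t' ρ' : ℝ}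
    (h : MolSub N W b t ρ) (hρ : ρ' + |t' - t| ≤ ρ) : MolSub N W b t' ρ' := by
  intro φ θ hθ x s hs
  have h0 := abs_nonneg (t' - t)
  refine h φ θ (by linarith) x s ?_
  have := abs_sub_le s t' t
  linarith

/-- Mollification in time is uniformly close on compact sets. -/
theorem exists_mol_close {f : En n × ℝ → ℝ} (hf : BM f) (hfc : Continuous f) {ε : ℝ} (hε : 0 < ε)
    (R a b : ℝ) : ∃ δ > 0, ∀ θ : ContDiffBump (0 : ℝ), θ.rOut < δ → ∀ x t, ‖x‖ ≤ R → a ≤ t → t ≤ b →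
      |avg (inT (moll θ)) f (x, t) - f (x, t)| ≤ ε := by
  have hK : IsCompact (Metric.closedBall (0 : En n) R ×ˢ Icc (a - 1) (b + 1)) :=
    (isCompact_closedBall _ _).prod isCompact_Icc
  have hu := hK.uniformContinuousOn_of_continuous hfc.continuousOn
  rw [Metric.uniformContinuousOn_iff] at hu
  obtain ⟨δ, hδ, h⟩ := hu ε hε
  refine ⟨min δ 1, by positivity, fun θ hθ x t hx ha hb => ?_⟩
  refine abs_avg_sub_le_of_ae hf ((ae_inT_moll θ).mono fun ζ hζ => ?_)
  obtain ⟨y, s⟩ := ζ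
  obtain ⟨rfl, hs⟩ : y = 0 ∧ |s| < θ.rOut := hζ
  have hs1 := hs.trans (hθ.trans_le (min_le_left _ _))
  have hs2 := abs_lt.1 (hs.trans (hθ.trans_le (min_le_right _ _)))
  have := h ((x, t) + (0, s)) (by simp only [Prod.mk_add_mk, mem_prod, mem_closedBall_zero_iff, add_zero, mem_Icc]; exact ⟨hx, by linarith, by linarith⟩) (x, t) (by simp only [mem_prod, mem_closedBall_zero_iff, mem_Icc]; exact ⟨hx, by linarith, by linarith⟩) (by
      simp [Prod.dist_eq, hs1])
  rw [Real.dist_eq] at this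
  exact this.le

variable {N : ℝ → Measure (En n × ℝ)} [∀ h, IsFiniteMeasure (N h)] {W b ψ : En n × ℝ → ℝ}
  {T : Set ℝ} {R t₀ t₁ k m lam : ℝ}

/-- If `W ≤ ψ + c` on the exceptional times then `W ≤ ψ + c` up to the final time. -/
theorem comparison_off_exceptional (hc : ∀ h, ∀ᵐ ζ ∂N h, ζ.2 ≤ 0) (hW : BM W) (hb : BM b)
    (hR : ∀ z, R < ‖z.1‖ → W z = 0)
    (hWt : ∀ x, Continuous fun t => W (x, t)) (hWx : ∀ t, Continuous fun x => W (x, t))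
    (G : ∀ t ∉ T, ∃ ρ > 0, MolSub N W b t ρ)
    (hψ : BM ψ) (hψc : Continuous ψ) (hψ0 : ∀ z, 0 ≤ ψ z) (hWm : ∀ z, W z ≤ m)
    (hψm : ∀ z, z.2 ≤ t₀ → m ≤ ψ z) (hlam : 0 < lam)
    (S2 : ∀ (φ : ContDiffBump (0 : En n)) (θ : ContDiffBump (0 : ℝ)), θ.rOut < 1 →
      ∀ z, t₀ + θ.rOut < z.2 → z.2 ≤ t₁ → ∀ η > 0, ∀ᶠ h in nhdsWithin 0 (Ioi 0),
        gen (N h) (avg (mol φ θ) ψ) z ≤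
          avg (mol φ θ) (fun z => lam * (ψ z - W z) - b z) z + η)
    {c : ℝ} (hc0 : 0 ≤ c) (hcT : ∀ z, z.2 ∈ T → t₀ ≤ z.2 → z.2 ≤ t₁ → W z ≤ ψ z + c) :
    ∀ z, z.2 ≤ t₁ → W z ≤ ψ z + c := by
  by_contra! hcon
  obtain ⟨⟨x₀, s₀⟩, hs₀, hz₀⟩ := hcon
  set D : En n × ℝ → ℝ := fun z => W z - ψ z with hD
  have hDB : BM D := hW.sub hψ
  have hDearly : ∀ z, z.2 ≤ t₀ → D z ≤ 0 := fun z hz => by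
    have := hWm z; have := hψm z hz; simp only [hD]; linarith
  have hDout : ∀ z, R < ‖z.1‖ → D z ≤ 0 := fun z hz => by
    have := hR z hz; have := hψ0 z; simp only [hD]; linarith
  -- spatial mollification
  obtain ⟨r, hr, hr'⟩ : ∃ r > 0, ∀ x, ‖x - x₀‖ < r → (c + D (x₀, s₀)) / 2 < D (x, s₀) := by
    have hcx : Continuous fun x => D (x, s₀) := (hWx s₀).sub (by fun_prop)
    have : ∀ᶠ x in nhds x₀, (c + D (x₀, s₀)) / 2 < D (x, s₀) :=
      (hcx.tendsto x₀).eventually_const_lt (by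
        show _ < D (x₀, s₀)
        simp only [hD] at hz₀ ⊢; linarith)
    obtain ⟨r, hr, h⟩ := Metric.eventually_nhds_iff.1 this
    exact ⟨r, hr, fun x hx => h (by rwa [dist_eq_norm])⟩
  obtain ⟨φ, hφ⟩ := exists_bump (V := En n) hr
  set D₁ := avg (inX (moll φ)) D with hD₁
  have hD₁B : BM D₁ := hDB.avg
  have hD₁c : Continuous D₁ := continuous_avg_inX_moll hDB fun x => (hWt x).sub (by fun_prop)
  have hpos : c < D₁ (x₀, s₀) := by
    have : (c + D (x₀, s₀)) / 2 ≤ D₁ (x₀, s₀) := by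
      refine le_avg_of_ae hDB ((ae_inX_moll φ).mono fun ζ hζ => ?_)
      obtain ⟨y, s⟩ := ζ
      obtain ⟨hy, rfl⟩ : ‖y‖ < φ.rOut ∧ s = 0 := hζ
      simpa using (hr' (x₀ + y) (by simpa [← hφ] using hy)).le
    simp only [hD] at hz₀ this; linarith
  have hD₁early : ∀ z, z.2 ≤ t₀ → D₁ z ≤ 0 := fun z hz =>
    avg_le_of_ae hDB (ae_inX_snd.mono fun ζ hζ => hDearly _ (by simpa [hζ] using hz))
  have hD₁out : ∀ z, R + r < ‖z.1‖ → D₁ z ≤ 0 := fun z hz =>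
    avg_le_of_ae hDB ((ae_inX_moll φ).mono fun ζ hζ => hDout _ (by
      have := norm_sub_norm_le z.1 (-ζ.1)
      rw [sub_neg_eq_add, norm_neg] at this
      show R < ‖z.1 + ζ.1‖
      linarith [hζ.1]))
  have hD₁T : ∀ z, z.2 ∈ T → t₀ ≤ z.2 → z.2 ≤ t₁ → D₁ z ≤ c := fun z h1 h2 h3 =>
    avg_le_of_ae hDB (ae_inX_snd.mono fun ζ hζ => by
      have := hcT (z + ζ) (by simpa [hζ] using h1) (by simpa [hζ] using h2)
        (by simpa [hζ] using h3)
      simp only [hD]; linarith)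
  set K : Set (En n × ℝ) := Metric.closedBall 0 (R + r) ×ˢ Icc t₀ t₁ with hK
  have hKc : IsCompact K := (isCompact_closedBall _ _).prod isCompact_Icc
  have hKmem : ∀ z, z.2 ≤ t₁ → 0 < D₁ z → z ∈ K := by
    intro z hz h
    refine ⟨?_, ?_, hz⟩
    · rw [mem_closedBall_zero_iff]; by_contra! h'; exact absurd (hD₁out z h') (by linarith)
    · by_contra! h'; exact absurd (hD₁early z h'.le) (by linarith)
  set M := D₁ (x₀, s₀) - c with hM
  have hMpos : 0 < M := by linarith
  set Θ : Set (En n × ℝ) := K ∩ {z | c + M / 4 ≤ D₁ z} with hΘ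
  have hΘc : IsCompact (Prod.snd '' Θ) :=
    (hKc.inter_right (isClosed_le continuous_const hD₁c)).image continuous_snd
  obtain ⟨δ, hδ, hδG⟩ : ∃ δ > 0, ∀ t ∈ Prod.snd '' Θ, t₀ + δ < t ∧ MolSub N W b t δ := by
    refine hΘc.induction_on (p := fun S => ∃ δ > 0, ∀ t ∈ S, t₀ + δ < t ∧ MolSub N W b t δ)
      ⟨1, one_pos, by simp⟩ ?_ ?_ ?_
    · rintro S S' hSS ⟨δ, hδ, h⟩
      exact ⟨δ, hδ, fun t ht => h t (hSS ht)⟩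
    · rintro S S' ⟨δ, hδ, h⟩ ⟨δ', hδ', h'⟩
      refine ⟨min δ δ', lt_min hδ hδ', fun t ht => ?_⟩
      rcases ht with ht | ht
      · exact ⟨by linarith [(h t ht).1, min_le_left δ δ'], (h t ht).2.mono (by simp)⟩
      · exact ⟨by linarith [(h' t ht).1, min_le_right δ δ'], (h' t ht).2.mono (by simp)⟩
    · rintro t ⟨z, ⟨hzK, hz⟩, rfl⟩
      have hz' : c + M / 4 ≤ D₁ z := hz
      have hzT : z.2 ∉ T := fun h => by
        have := hD₁T z h hzK.2.1 hzK.2.2; linarith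
      have hz2 : t₀ < z.2 := by
        by_contra! h'; have := hD₁early z h'; linarith
      obtain ⟨ρ, hρ, hG⟩ := G z.2 hzT
      set δ := min (ρ / 2) ((z.2 - t₀) / 2) with hδ
      have hδ0 : 0 < δ := lt_min (by positivity) (by linarith)
      have hδ1 : δ ≤ ρ / 2 := min_le_left _ _
      have hδ2 : δ ≤ (z.2 - t₀) / 2 := min_le_right _ _
      refine ⟨Metric.ball z.2 (δ / 2), mem_nhdsWithin_of_mem_nhds (Metric.ball_mem_nhds _ (by positivity)),
        δ / 2, by positivity, fun t ht => ?_⟩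
      rw [Metric.mem_ball, Real.dist_eq] at ht
      exact ⟨by linarith [(abs_lt.1 ht).1], hG.mono (by linarith)⟩
  obtain ⟨δ', hδ', hclose⟩ := exists_mol_close hD₁B hD₁c (ε := M / 4) (by positivity)
    (R + r) (t₀ - 1) t₁
  obtain ⟨θ, hθ⟩ := exists_bump (V := ℝ) (r := min (min δ δ') 1 / 2) (by positivity)
  have hθ0 : 0 < min (min δ δ') 1 := by positivity
  have hθδ : θ.rOut < δ := by
    linarith [min_le_left (min δ δ') 1, min_le_left δ δ']
  have hθδ' : θ.rOut < δ' := by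
    linarith [min_le_left (min δ δ') 1, min_le_right δ δ']
  have hθ1 : θ.rOut < 1 := by linarith [min_le_right (min δ δ') 1]
  set D₂ := avg (mol φ θ) D with hD₂
  have hD₂eq : ∀ z, D₂ z = avg (inT (moll θ)) D₁ z := fun z => avg_mol' hDB z
  have hD₂c : Continuous D₂ := continuous_avg_mol hDB
  set K' : Set (En n × ℝ) := Metric.closedBall 0 (R + r) ×ˢ Icc (t₀ - 1) t₁ with hK'
  have hK'c : IsCompact K' := (isCompact_closedBall _ _).prod isCompact_Icc
  have hKK' : K ⊆ K' := prod_mono_right (Icc_subset_Icc_left (by linarith))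
  have hz₀K : (x₀, s₀) ∈ K := hKmem _ hs₀ (by linarith)
  obtain ⟨z₂, hz₂K, hz₂max⟩ := hK'c.exists_isMaxOn ⟨_, hKK' hz₀K⟩ hD₂c.continuousOn
  have hcl : ∀ z ∈ K', |D₂ z - D₁ z| ≤ M / 4 := fun z hz => by
    rw [hD₂eq]
    exact hclose θ hθδ' z.1 z.2 (by simpa using hz.1) hz.2.1 hz.2.2
  have hz₂big : c + 3 * M / 4 ≤ D₂ z₂ := by
    have h1 : D₂ _ ≤ D₂ z₂ := hz₂max (hKK' hz₀K)
    have h2 := abs_le.1 (hcl _ (hKK' hz₀K))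
    linarith [h2.1]
  have hz₂D₁ : c + M / 4 ≤ D₁ z₂ := by
    have h2 := abs_le.1 (hcl _ hz₂K)
    linarith [h2.2]
  have hz₂Θ : z₂ ∈ Θ := ⟨hKmem _ hz₂K.2.2 (by linarith), hz₂D₁⟩
  have hglob : ∀ z, z.2 ≤ t₁ → D₂ z ≤ D₂ z₂ := by
    intro z hz
    by_cases hzK : z ∈ K'
    · exact hz₂max hzK
    · have hle : D₂ z ≤ 0 := by
        rw [hD₂eq]
        refine avg_le_of_ae hD₁B ((ae_inT_moll θ).mono fun ζ hζ => ?_)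
        by_cases hx : ‖z.1‖ ≤ R + r
        · refine hD₁early _ ?_
          have : z.2 < t₀ - 1 := by
            by_contra! h'
            exact hzK ⟨by simpa using hx, h', hz⟩
          show z.2 + ζ.2 ≤ t₀
          linarith [(abs_lt.1 hζ.2).2]
        · refine hD₁out _ ?_
          show R + r < ‖z.1 + ζ.1‖
          rw [hζ.1, add_zero]; linarith
      linarith
  obtain ⟨hδt, hGz⟩ := hδG z₂.2 ⟨z₂, hz₂Θ, rfl⟩
  set η := lam * (3 * M / 4) / 4 with hη
  have hη0 : 0 < η := by positivity
  have E1 := hGz φ θ hθδ z₂.1 z₂.2 (by simpa using hδ) η hη0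
  have E2 := S2 φ θ hθ1 z₂ (by linarith) hz₂K.2.2 η hη0
  obtain ⟨h, e1, e2⟩ := (E1.and E2).exists
  have e3 : gen (N h) D₂ z₂ ≤ 0 := gen_nonpos ((hc h).mono fun ζ hζ => hglob _ (by
    show z₂.2 + ζ.2 ≤ t₁
    linarith [hz₂K.2.2]))
  have e4 : D₂ = fun z => avg (mol φ θ) W z - avg (mol φ θ) ψ z :=
    funext fun z => avg_sub hW hψ z
  rw [e4, gen_sub hW.avg hψ.avg] at e3
  have e5 : avg (mol φ θ) (fun z => lam * (ψ z - W z) - b z) z₂ =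
      - lam * D₂ z₂ - avg (mol φ θ) b z₂ := by
    rw [avg_sub ((hψ.sub hW).const_mul _) hb, avg_const_mul, avg_sub hψ hW, e4]; ring
  rw [e5] at e2
  have e6 : lam * (3 * M / 4) ≤ lam * D₂ z₂ := by gcongr; linarith
  have e7 : (z₂.1, z₂.2) = z₂ := rfl
  rw [e7] at e1
  linarith

theorem continuousOn_of_lipschitz_slices (hWt : ∀ x, Continuous fun t => W (x, t)) {S : Set ℝ}
    (hk : ∀ t ∈ S, ∀ x y, |W (x, t) - W (y, t)| ≤ k * ‖x - y‖) :
    ContinuousOn W (univ ×ˢ S) := by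
  rintro ⟨x, t⟩ hz
  rw [ContinuousWithinAt, tendsto_iff_dist_tendsto_zero]
  have lim : Tendsto (fun z : En n × ℝ => k * ‖z.1 - x‖ + |W (x, z.2) - W (x, t)|)
      (nhdsWithin (x, t) (univ ×ˢ S)) (nhds 0) := by
    have h1 : Continuous fun z : En n × ℝ => W (x, z.2) := (hWt x).comp continuous_snd
    have hc : Continuous (fun z : En n × ℝ => k * ‖z.1 - x‖ + |W (x, z.2) - W (x, t)|) :=
      (continuous_const.mul (continuous_fst.sub continuous_const).norm).add
        (h1.sub continuous_const).abs
    have h0 := hc.tendsto (x, t)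
    simp only [sub_self, norm_zero, mul_zero, abs_zero, add_zero] at h0
    exact h0.mono_left nhdsWithin_le_nhds
  refine squeeze_zero' (Eventually.of_forall fun _ => dist_nonneg) ?_ lim
  filter_upwards [self_mem_nhdsWithin] with z hzS
  rw [Real.dist_eq]
  exact (abs_sub_le _ (W (x, z.2)) _).trans (add_le_add (hk z.2 hzS.2 z.1 x) le_rfl)

/-- Comparison principle allowing a closed set of exceptional times at which only a pointwise
inequality is known. -/
theorem comparison (hc : ∀ h, ∀ᵐ ζ ∂N h, ζ.2 ≤ 0) (hW : BM W) (hb : BM b)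
    (hR : ∀ z, R < ‖z.1‖ → W z = 0)
    (hWt : ∀ x, Continuous fun t => W (x, t)) (hWx : ∀ t, Continuous fun x => W (x, t))
    (hT : IsClosed T)
    (hk : ∀ t ∈ T, t₀ ≤ t → t ≤ t₁ → ∀ x y, |W (x, t) - W (y, t)| ≤ k * ‖x - y‖)
    (H : ∀ z, z.2 ∈ T → t₀ < z.2 → z.2 ≤ t₁ → ∀ η > 0, ∀ᶠ h in nhdsWithin 0 (Ioi 0),
      -b z - η ≤ gen (N h) W z)
    (G : ∀ t ∉ T, ∃ ρ > 0, MolSub N W b t ρ)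
    (hψ : BM ψ) (hψc : Continuous ψ) (hψ0 : ∀ z, 0 ≤ ψ z) (hWm : ∀ z, W z ≤ m)
    (hψm : ∀ z, z.2 ≤ t₀ → m ≤ ψ z) (hlam : 0 < lam)
    (S1 : ∀ z, z.2 ∈ T → t₀ < z.2 → z.2 ≤ t₁ → ∀ᶠ h in nhdsWithin 0 (Ioi 0),
      gen (N h) ψ z ≤ lam * (ψ z - W z) - b z)
    (S2 : ∀ (φ : ContDiffBump (0 : En n)) (θ : ContDiffBump (0 : ℝ)), θ.rOut < 1 →
      ∀ z, t₀ + θ.rOut < z.2 → z.2 ≤ t₁ → ∀ η > 0, ∀ᶠ h in nhdsWithin 0 (Ioi 0),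
        gen (N h) (avg (mol φ θ) ψ) z ≤
          avg (mol φ θ) (fun z => lam * (ψ z - W z) - b z) z + η) :
    ∀ z, z.2 ≤ t₁ → W z ≤ ψ z := by
  have gap : ∀ c : ℝ, 0 ≤ c → (∀ z, z.2 ∈ T → t₀ ≤ z.2 → z.2 ≤ t₁ → W z ≤ ψ z + c) →
      ∀ z, z.2 ≤ t₁ → W z ≤ ψ z + c := fun c hc0 hcT =>
    comparison_off_exceptional hc hW hb hR hWt hWx G hψ hψc hψ0 hWm hψm hlam S2 hc0 hcT
  by_contra! hcon
  obtain ⟨z₀, hz₀, hz₀'⟩ := hcon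
  have hex : ∃ z, z.2 ∈ T ∧ t₀ ≤ z.2 ∧ z.2 ≤ t₁ ∧ ψ z < W z := by
    by_contra! h
    have := gap 0 le_rfl (fun z h1 h2 h3 => by simpa using h z h1 h2 h3) z₀ hz₀
    linarith
  obtain ⟨z₁, h1, h2, h3, h4⟩ := hex
  have hball : ∀ z, ψ z < W z → ‖z.1‖ ≤ R := fun z hz => by
    by_contra! h
    have := hR z h; have := hψ0 z; linarith
  set K : Set (En n × ℝ) := Metric.closedBall 0 R ×ˢ (T ∩ Icc t₀ t₁) with hK
  have hKc : IsCompact K := (isCompact_closedBall _ _).prod (isCompact_Icc.inter_left hT)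
  have hWK : ContinuousOn (fun z => W z - ψ z) K := by
    refine ContinuousOn.sub ?_ hψc.continuousOn
    refine (continuousOn_of_lipschitz_slices hWt (S := T ∩ Icc t₀ t₁) (k := k)
      fun t ht => hk t ht.1 ht.2.1 ht.2.2).mono (prod_mono_left (subset_univ _))
  obtain ⟨z, hzK, hzmax⟩ := hKc.exists_isMaxOn
    ⟨z₁, by simpa using hball z₁ h4, h1, h2, h3⟩ hWK
  set c := W z - ψ z with hc'
  have hcpos : 0 < c := by
    have : W z₁ - ψ z₁ ≤ c := hzmax ⟨by simpa using hball z₁ h4, h1, h2, h3⟩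
    linarith
  have hglob := gap c hcpos.le fun y hy1 hy2 hy3 => by
    by_cases hy : ψ y < W y
    · have : W y - ψ y ≤ c := hzmax ⟨by simpa using hball y hy, hy1, hy2, hy3⟩
      linarith
    · push Not at hy; linarith
  have hzt : t₀ < z.2 := by
    by_contra! h
    have := hWm z; have := hψm z h; linarith
  obtain ⟨h, e1, e2⟩ := ((H z hzK.2.1 hzt hzK.2.2.2 (lam * c / 2) (by positivity)).and
    (S1 z hzK.2.1 hzt hzK.2.2.2)).exists
  have e3 : gen (N h) (fun z => W z - ψ z) z ≤ 0 := gen_nonpos ((hc h).mono fun ζ hζ => by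
    have := hglob (z + ζ) (by show z.2 + ζ.2 ≤ t₁; linarith [hzK.2.2.2])
    show W (z + ζ) - ψ (z + ζ) ≤ c
    linarith)
  rw [gen_sub hW hψ] at e3
  have e4 : lam * (ψ z - W z) = - (lam * c) := by rw [hc']; ring
  have e5 : 0 < lam * c := by positivity
  rw [e4] at e2
  linarith

end Comparison

section JumpFamily

/-- The generators `gen (N h)` converge uniformly, as `h → 0⁺`, on mollifications by `M` of
functions bounded by one. -/
def Nice {V : Type*} [Add V] [MeasurableSpace V] (N : ℝ → Measure V) (M : Measure V) : Prop :=
  ∀ ε > 0, ∃ h₁ > 0, ∀ h h', 0 < h → h < h₁ → 0 < h' → h' < h₁ → ∀ f : V → ℝ, Measurable f →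
    (∀ z, |f z| ≤ 1) → ∀ z, |gen (N h) (avg M f) z - gen (N h') (avg M f) z| ≤ ε

/-- Approximations, as `h → 0⁺`, of a translation-invariant operator in space and a causal
translation-invariant operator in time by jump operators. -/
structure JumpFamily (n : ℕ) where
  /-- spatial jumps -/
  σ : ℝ → Measure (En n)
  /-- temporal jumps -/
  ν : ℝ → Measure ℝ
  /-- large temporal jumps -/
  far : ℝ → Measure ℝ
  finσ : ∀ h, IsFiniteMeasure (σ h)
  finν : ∀ h, IsFiniteMeasure (ν h)
  finfar : ∀ r, IsFiniteMeasure (far r)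
  causal : ∀ h, ∀ᵐ τ ∂ν h, τ < 0
  moment : ∃ C, 0 ≤ C ∧ ∀ h, 0 < h → h < 1 → ∫ τ, min 1 |τ| ∂ν h ≤ C
  niceX : ∀ φ : ContDiffBump (0 : En n), Nice σ (moll φ)
  niceT : ∀ θ : ContDiffBump (0 : ℝ), Nice ν (moll θ)
  far_eq : ∀ h r, 0 < h → h < r → (ν h).restrict (Iic (-r)) = far r
  far_lip : ∀ r, 0 < r → ∃ L, 0 ≤ L ∧ ∀ f : ℝ → ℝ, Measurable f → (∀ t, |f t| ≤ 1) →
    ∀ t t', |avg (far r) f t - avg (far r) f t'| ≤ L * |t - t'|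
  pot : ∀ (M : ℝ) (θ₀ : ContDiffBump (0 : ℝ)), ∃ C, 0 ≤ C ∧ ∀ A ⊆ Icc (-M) M, MeasurableSet A →
    ∃ g : ℝ → ℝ, Continuous g ∧ BM g ∧ (∀ t, 0 ≤ g t) ∧
      (∀ t, avg (moll θ₀) g t ≤ C * volume.real A) ∧
      (∀ h, 0 < h → h < 1 → ∀ t, gen (ν h) g t ≤ 0) ∧
      ∀ θ : ContDiffBump (0 : ℝ), ∃ L, ∀ h, 0 < h → h < 1 → ∀ t,
        gen (ν h) (avg (moll θ) g) t ≤ -avg (moll θ) (A.indicator fun _ => 1) t + L * h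

section Nice

variable {V : Type*} [AddCommGroup V] [MeasurableSpace V] [MeasurableAdd₂ V] {N : ℝ → Measure V}
  {M : Measure V} {f : V → ℝ}

theorem Nice.of_bound (hN : Nice N M) {C ε : ℝ} (hC : 0 < C) (hε : 0 < ε) :
    ∃ h₁ > 0, ∀ h h', 0 < h → h < h₁ → 0 < h' → h' < h₁ → ∀ f : V → ℝ, Measurable f →
    (∀ z, |f z| ≤ C) → ∀ z, |gen (N h) (avg M f) z - gen (N h') (avg M f) z| ≤ ε := by
  obtain ⟨h₁, hh₁, H⟩ := hN (ε / C) (by positivity)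
  refine ⟨h₁, hh₁, fun h h' a1 a2 a3 a4 f hf hb z => ?_⟩
  have h1 := H h h' a1 a2 a3 a4 (fun z => C⁻¹ * f z) (hf.const_mul _) (fun z => by
    rw [abs_mul, abs_of_pos (inv_pos.2 hC), inv_mul_le_iff₀ hC]; simpa using hb z) z
  have h2 : avg M (fun z => C⁻¹ * f z) = fun z => C⁻¹ * avg M f z :=
    funext fun z => avg_const_mul _ _
  rw [h2, gen_const_mul, gen_const_mul, ← mul_sub, abs_mul, abs_of_pos (inv_pos.2 hC),
    inv_mul_le_iff₀ hC, mul_div_cancel₀ _ hC.ne'] at h1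
  exact h1

theorem Nice.of_BM (hN : Nice N M) (hf : BM f) {ε : ℝ} (hε : 0 < ε) :
    ∃ h₁ > 0, ∀ h h', 0 < h → h < h₁ → 0 < h' → h' < h₁ →
      ∀ z, |gen (N h) (avg M f) z - gen (N h') (avg M f) z| ≤ ε := by
  obtain ⟨C, hC⟩ := hf.bdd
  obtain ⟨h₁, hh₁, H⟩ := hN.of_bound (C := |C| + 1) (by positivity) hε
  exact ⟨h₁, hh₁, fun h h' a1 a2 a3 a4 => H h h' a1 a2 a3 a4 f hf.meas fun z =>
    (hC z).trans (by linarith [le_abs_self C])⟩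

theorem Nice.bounded [∀ h, IsFiniteMeasure (N h)] [IsFiniteMeasure M] (hN : Nice N M)
    (hf : BM f) : ∃ h₁ > 0, ∃ C, 0 ≤ C ∧ ∀ h, 0 < h → h < h₁ →
      ∀ z, |gen (N h) (avg M f) z| ≤ C := by
  obtain ⟨h₁, hh₁, H⟩ := hN.of_BM hf one_pos
  obtain ⟨C, hC⟩ := (hf.avg (N := M)).bdd
  have hC' : ∀ z, |avg M f z| ≤ |C| := fun z => (hC z).trans (le_abs_self C)
  refine ⟨h₁, hh₁, 1 + 2 * |C| * (N (h₁ / 2)).real univ, by positivity, fun h a b z => ?_⟩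
  have h1 := H h (h₁ / 2) a b (by positivity) (by linarith) z
  have h2 := abs_gen_le (N := N (h₁ / 2)) hf.avg hC' z
  have h3 := abs_sub_abs_le_abs_sub (gen (N h) (avg M f) z) (gen (N (h₁ / 2)) (avg M f) z)
  linarith

end Nice

namespace JumpFamily

variable {n : ℕ} (J : JumpFamily n)

instance (h : ℝ) : IsFiniteMeasure (J.σ h) := J.finσ h
instance (h : ℝ) : IsFiniteMeasure (J.ν h) := J.finν h
instance (h : ℝ) : IsFiniteMeasure (J.far h) := J.finfar h

/-- All jumps. -/
def full (h : ℝ) : Measure (En n × ℝ) := inX (J.σ h) + inT (J.ν h)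

/-- All spatial jumps and the temporal jumps shorter than `r`. -/
def near (r h : ℝ) : Measure (En n × ℝ) := inX (J.σ h) + inT ((J.ν h).restrict (Ioi (-r)))

instance (h : ℝ) : IsFiniteMeasure (J.full h) :=
  inferInstanceAs (IsFiniteMeasure (inX (J.σ h) + inT (J.ν h)))
instance (r h : ℝ) : IsFiniteMeasure (J.near r h) :=
  inferInstanceAs (IsFiniteMeasure (inX (J.σ h) + inT ((J.ν h).restrict (Ioi (-r)))))

variable {J} {f : En n × ℝ → ℝ} {r h : ℝ}

theorem gen_near_time {g : ℝ → ℝ} (hg : BM g) (h0 : 0 < h) (hr : h < r) (t : ℝ) :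
    gen ((J.ν h).restrict (Ioi (-r))) g t = gen (J.ν h) g t - gen (J.far r) g t := by
  rw [← J.far_eq h r h0 hr, eq_sub_iff_add_eq, ← gen_measure_add hg, ← compl_Iic,
    Measure.restrict_compl_add_restrict measurableSet_Iic]

theorem gen_full (hf : BM f) (z : En n × ℝ) : gen (J.full h) f z =
    gen (J.σ h) (fun x => f (x, z.2)) z.1 + gen (J.ν h) (fun t => f (z.1, t)) z.2 := by
  rw [full, gen_measure_add hf, gen_inX hf.meas, gen_inT hf.meas]

theorem gen_near (hf : BM f) (h0 : 0 < h) (hr : h < r) (z : En n × ℝ) :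
    gen (J.near r h) f z = gen (J.full h) f z - gen (inT (J.far r)) f z := by
  rw [gen_full hf, near, gen_measure_add hf, gen_inX hf.meas, gen_inT hf.meas, gen_inT hf.meas,
    gen_near_time (hf.slice' _) h0 hr, add_sub_assoc]

theorem ae_near (r h : ℝ) : ∀ᵐ ζ ∂J.near r h, ζ.2 ≤ 0 := by
  rw [near, ae_add_measure_iff]
  refine ⟨ae_inX_snd.mono fun ζ h => h.le, ?_⟩
  rw [inT, ae_map_iff (by fun_prop) (measurableSet_le (by fun_prop) (by fun_prop))]
  exact ae_restrict_of_ae ((J.causal h).mono fun τ h => h.le)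

theorem nice_full (φ : ContDiffBump (0 : En n)) (θ : ContDiffBump (0 : ℝ)) :
    Nice J.full (mol φ θ) := by
  intro ε hε
  obtain ⟨h₁, hh₁, H₁⟩ := J.niceX φ (ε / 2) (by positivity)
  obtain ⟨h₂, hh₂, H₂⟩ := J.niceT θ (ε / 2) (by positivity)
  refine ⟨min h₁ h₂, lt_min hh₁ hh₂, fun h h' a1 a2 a3 a4 f hf hb z => ?_⟩
  have hB : BM f := ⟨hf, 1, hb⟩
  rw [lt_min_iff] at a2 a4
  have bd : ∀ M : Measure (En n × ℝ), IsProbabilityMeasure M → ∀ z, |avg M f z| ≤ 1 := fun M _ z => by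
    simpa using abs_avg_le (N := M) hb z
  have e1 : (fun x => avg (mol φ θ) f (x, z.2)) =
      avg (moll φ) (fun x => avg (inT (moll θ)) f (x, z.2)) := by
    ext x; rw [avg_mol hB, avg_inX hB.avg.meas]
  have e2 : (fun t => avg (mol φ θ) f (z.1, t)) =
      avg (moll θ) (fun t => avg (inX (moll φ)) f (z.1, t)) := by
    ext x; rw [avg_mol' hB, avg_inT hB.avg.meas]
  have k1 := H₁ h h' a1 a2.1 a3 a4.1 (fun x => avg (inT (moll θ)) f (x, z.2))
    (hB.avg.slice _).meas (fun x => bd _ inferInstance _) z.1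
  have k2 := H₂ h h' a1 a2.2 a3 a4.2 (fun t => avg (inX (moll φ)) f (z.1, t))
    (hB.avg.slice' _).meas (fun x => bd _ inferInstance _) z.2
  rw [gen_full hB.avg, gen_full hB.avg, e1, e2]
  rw [abs_le] at *
  constructor <;> linarith [k1.1, k1.2, k2.1, k2.2]

theorem nice_near (hr : 0 < r) (φ : ContDiffBump (0 : En n)) (θ : ContDiffBump (0 : ℝ)) :
    Nice (J.near r) (mol φ θ) := by
  intro ε hε
  obtain ⟨h₁, hh₁, H⟩ := nice_full (J := J) φ θ ε hε
  refine ⟨min h₁ r, lt_min hh₁ hr, fun h h' a1 a2 a3 a4 f hf hb z => ?_⟩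
  have hB : BM f := ⟨hf, 1, hb⟩
  rw [lt_min_iff] at a2 a4
  rw [gen_near hB.avg a1 a2.2, gen_near hB.avg a3 a4.2, sub_sub_sub_cancel_right]
  exact H h h' a1 a2.1 a3 a4.1 f hf hb z

/-- The exponential barrier is a supersolution at late times. -/
theorem gen_near_exp_le : ∃ C, 0 ≤ C ∧ ∀ r κ m a : ℝ, r ≤ 1 → 0 < κ → 0 ≤ m →
    ∀ h, 0 < h → h < 1 → ∀ z : En n × ℝ, a < z.2 →
      gen (J.near r h) (fun z => m * min 1 (Real.exp (κ * (a - z.2)))) z ≤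
        C * κ * Real.exp (κ * r) * (m * min 1 (Real.exp (κ * (a - z.2)))) := by
  obtain ⟨C, hC0, hC⟩ := J.moment
  refine ⟨C, hC0, fun r κ m a hr hκ hm h h0 h1 z hz => ?_⟩
  have hB : BM (fun z : En n × ℝ => m * min 1 (Real.exp (κ * (a - z.2)))) := by
    refine BM.const_mul m ⟨by fun_prop, 1, fun z => ?_⟩
    rw [abs_of_nonneg (by positivity)]
    exact min_le_left _ _
  have hBt : BM (fun t : ℝ => m * min 1 (Real.exp (κ * (a - t)))) := hB.slice' 0
  rw [near, gen_measure_add hB, gen_inX hB.meas, gen_inT hB.meas]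
  simp only [gen_const, zero_add]
  have hE : min 1 (Real.exp (κ * (a - z.2))) = Real.exp (κ * (a - z.2)) :=
    min_eq_right (Real.exp_le_one_iff.2 (mul_nonpos_of_nonneg_of_nonpos hκ.le (by linarith)))
  rw [hE]
  set e := Real.exp (κ * (a - z.2)) with he
  have he0 : 0 < e := Real.exp_pos _
  have hmin : BM (fun τ : ℝ => min 1 |τ|) := ⟨by fun_prop, 1, fun τ => by
    rw [abs_of_nonneg (by positivity)]; exact min_le_left _ _⟩
  have step : gen ((J.ν h).restrict (Ioi (-r))) (fun t => m * min 1 (Real.exp (κ * (a - t)))) z.2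
      ≤ ∫ τ in Ioi (-r), (m * e * κ * Real.exp (κ * r)) * min 1 |τ| ∂J.ν h := by
    refine integral_mono_ae (((hBt.translate z.2).sub (.const _)).integrable _)
      ((hmin.const_mul _).integrable _) ?_
    filter_upwards [ae_restrict_of_ae (J.causal h), ae_restrict_mem measurableSet_Ioi] with τ h1 h2
    rw [hE]
    have h2' : -τ < r := by have : -r < τ := h2; linarith
    have h3 : min 1 |τ| = -τ := by rw [abs_of_neg h1]; exact min_eq_right (by linarith)
    rw [h3]
    have h4 : Real.exp (κ * (a - (z.2 + τ))) = e * Real.exp (κ * -τ) := by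
      rw [he, ← Real.exp_add]; ring_nf
    have h5 : min 1 (Real.exp (κ * (a - (z.2 + τ)))) ≤ e * Real.exp (κ * -τ) :=
      (min_le_right _ _).trans h4.le
    have h6 : Real.exp (κ * -τ) - 1 ≤ κ * -τ * Real.exp (κ * r) := by
      have h7 := Real.add_one_le_exp (-(κ * -τ))
      have h8 : Real.exp (κ * -τ) ≤ Real.exp (κ * r) := by gcongr
      have h9 : Real.exp (κ * -τ) * Real.exp (-(κ * -τ)) = 1 := by
        rw [← Real.exp_add]; simp
      have h10 : 0 < Real.exp (κ * -τ) := Real.exp_pos _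
      have h11 : 0 ≤ κ * -τ := by nlinarith
      nlinarith
    calc m * min 1 (Real.exp (κ * (a - (z.2 + τ)))) - m * e
        ≤ m * (e * Real.exp (κ * -τ)) - m * e := by gcongr
      _ = m * e * (Real.exp (κ * -τ) - 1) := by ring
      _ ≤ m * e * (κ * -τ * Real.exp (κ * r)) := by gcongr
      _ = _ := by ring
  refine step.trans ?_
  rw [integral_const_mul]
  have h3 : ∫ τ in Ioi (-r), min 1 |τ| ∂J.ν h ≤ C :=
    (setIntegral_le_integral (hmin.integrable _) (Eventually.of_forall fun τ => by
      show (0:ℝ) ≤ min 1 |τ|; positivity)).trans (hC h h0 h1)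
  calc _ ≤ (m * e * κ * Real.exp (κ * r)) * C := by gcongr
    _ = _ := by ring

theorem avg_mol_snd {g : ℝ → ℝ} (hg : BM g) (φ : ContDiffBump (0 : En n))
    (θ : ContDiffBump (0 : ℝ)) (z : En n × ℝ) :
    avg (mol φ θ) (fun z => g z.2) z = avg (moll θ) g z.2 := by
  have hB : BM (fun z : En n × ℝ => g z.2) := hg.comp measurable_snd
  rw [avg_mol' hB, avg_inT hB.avg.meas]
  congr 1
  ext t
  rw [avg_inX hB.meas]
  exact avg_const_prob (N := moll φ) (g t) z.1

theorem gen_near_snd {g : ℝ → ℝ} (hg : BM g) (h0 : 0 < h) (hr : h < r) (z : En n × ℝ) :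
    gen (J.near r h) (fun z => g z.2) z = gen (J.ν h) g z.2 - gen (J.far r) g z.2 := by
  have hB : BM (fun z : En n × ℝ => g z.2) := hg.comp measurable_snd
  rw [gen_near hB h0 hr, gen_full hB, gen_inT hB.meas]
  simp only [gen_const, zero_add]

theorem near_pot (M : ℝ) (θ₀ : ContDiffBump (0 : ℝ)) {lam : ℝ}
    (hlam : (J.far r).real univ ≤ lam) : ∃ C, 0 ≤ C ∧
    ∀ A ⊆ Icc (-M) M, MeasurableSet A → ∃ g : En n × ℝ → ℝ, Continuous g ∧ BM g ∧ (∀ z, 0 ≤ g z) ∧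
      (∀ φ₀ z, avg (mol φ₀ θ₀) g z ≤ C * volume.real A) ∧
      (∀ h, 0 < h → h < min 1 r → ∀ z, gen (J.near r h) g z ≤ lam * g z) ∧
      ∀ φ θ, ∃ L, ∀ h, 0 < h → h < min 1 r → ∀ z,
        gen (J.near r h) (avg (mol φ θ) g) z ≤ lam * avg (mol φ θ) g z -
          avg (mol φ θ) (fun z => A.indicator (fun _ => 1) z.2) z + L * h := by
  obtain ⟨C, hC0, hC⟩ := J.pot M θ₀
  refine ⟨C, hC0, fun A hA hAm => ?_⟩
  obtain ⟨g, hgc, hgB, hg0, hgC, hg1, hg2⟩ := hC A hA hAm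
  have far_le : ∀ {f : ℝ → ℝ}, BM f → (∀ t, 0 ≤ f t) → ∀ t, -gen (J.far r) f t ≤ lam * f t :=
    fun {f} hf h0 t => by
      rw [gen_eq hf]
      have := avg_nonneg (N := J.far r) h0 t
      have := mul_le_mul_of_nonneg_right hlam (h0 t)
      linarith
  refine ⟨fun z => g z.2, hgc.comp continuous_snd, hgB.comp measurable_snd, fun z => hg0 _,
    fun φ z => ?_, fun h h0 h1 z => ?_, fun φ θ => ?_⟩
  · rw [avg_mol_snd hgB]; exact hgC _
  · rw [lt_min_iff] at h1
    rw [gen_near_snd hgB h0 h1.2]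
    linarith [hg1 h h0 h1.1 z.2, far_le hgB hg0 z.2]
  · obtain ⟨L, hL⟩ := hg2 θ
    refine ⟨L, fun h h0 h1 z => ?_⟩
    rw [lt_min_iff] at h1
    have e : avg (mol φ θ) (fun z => g z.2) = fun z : En n × ℝ => avg (moll θ) g z.2 :=
      funext fun z => avg_mol_snd hgB φ θ z
    rw [e, gen_near_snd hgB.avg h0 h1.2, avg_mol_snd (BM.indicator_one hAm)]
    linarith [hL h h0 h1.1 z.2, far_le (f := avg (moll θ) g) hgB.avg (fun t => avg_nonneg hg0 t) z.2]

/-- The contribution of large jumps to a slice-wise continuous function is jointly continuous. -/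
theorem continuous_avg_far (hr : 0 < r) {W : En n × ℝ → ℝ} (hW : BM W)
    (hWx : ∀ t, Continuous fun x => W (x, t)) : Continuous (avg (inT (J.far r)) W) := by
  obtain ⟨L, hL0, hL⟩ := J.far_lip r hr
  obtain ⟨C, hC⟩ := hW.bdd
  have hC0 : 0 < |C| + 1 := by positivity
  have hlip : ∀ x t t', |avg (inT (J.far r)) W (x, t) - avg (inT (J.far r)) W (x, t')| ≤
      (|C| + 1) * L * |t - t'| := by
    intro x t t'
    have h' := hL (fun s => (|C| + 1)⁻¹ * W (x, s)) ((hW.slice' x).const_mul _).meas (fun s => by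
      rw [abs_mul, abs_of_pos (inv_pos.2 hC0), inv_mul_le_iff₀ hC0]
      exact (hC _).trans (by linarith [le_abs_self C])) t t'
    rw [avg_const_mul, avg_const_mul, ← mul_sub, abs_mul, abs_of_pos (inv_pos.2 hC0),
      inv_mul_le_iff₀ hC0] at h'
    rw [avg_inT hW.meas, avg_inT hW.meas, mul_assoc]
    exact h'
  have hx : ∀ t, Continuous fun x => avg (inT (J.far r)) W (x, t) := by
    intro t
    have e : (fun x => avg (inT (J.far r)) W (x, t)) =
        fun x => ∫ s, W (x, t + s) ∂J.far r := funext fun x => avg_inT hW.meas _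
    rw [e]
    refine continuous_of_dominated (bound := fun _ => C) (fun x =>
      ((hW.slice' x).translate t).meas.aestronglyMeasurable)
      (fun x => Eventually.of_forall fun s => hC _) (integrable_const _)
      (Eventually.of_forall fun s => hWx _)
  rw [continuous_iff_continuousAt]
  rintro ⟨x, t⟩
  rw [ContinuousAt, tendsto_iff_dist_tendsto_zero]
  set S := avg (inT (J.far r)) W
  have h1 : Continuous fun z : En n × ℝ => S (z.1, t) := (hx t).comp continuous_fst
  have hc : Continuous fun z : En n × ℝ => (|C| + 1) * L * |z.2 - t| + |S (z.1, t) - S (x, t)| :=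
    (continuous_const.mul (continuous_snd.sub continuous_const).abs).add
      (h1.sub continuous_const).abs
  have h0 := hc.tendsto (x, t)
  simp only [sub_self, mul_zero, abs_zero, add_zero] at h0
  refine squeeze_zero (fun _ => dist_nonneg) (fun z => ?_) h0
  rw [Real.dist_eq]
  exact (abs_sub_le _ (S (z.1, t)) _).trans (add_le_add (hlip z.1 z.2 t) le_rfl)

end JumpFamily

end JumpFamily

section TimeStep

variable {n : ℕ} {W S b : En n × ℝ → ℝ} {R : ℝ}

theorem exists_rate {r r' A B C m ε : ℝ} (hr : r' < r) (hr0 : 0 < r) (hA : 1 ≤ A) (hr'0 : 0 ≤ r')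
    (hB : 0 ≤ B) (hε : 0 < ε) : ∃ κ, 0 < κ ∧
      C / (A * κ * Real.exp (κ * r') + B) ≤ ε ∧
      (A * κ * Real.exp (κ * r') + B) * (m * Real.exp (-(κ * r))) ≤ ε := by
  have l1 : Tendsto (fun κ : ℝ => A * κ * Real.exp (κ * r') + B) atTop atTop := by
    refine tendsto_atTop_mono' _ ?_ tendsto_id
    filter_upwards [eventually_ge_atTop 0] with κ hκ
    have : 1 ≤ Real.exp (κ * r') := Real.one_le_exp (by positivity)
    have h2 : κ ≤ A * κ := by nlinarith
    have h3 : A * κ ≤ A * κ * Real.exp (κ * r') := le_mul_of_one_le_right (by linarith) this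
    show κ ≤ _
    linarith
  have l2 : Tendsto (fun κ : ℝ => C / (A * κ * Real.exp (κ * r') + B)) atTop (nhds 0) :=
    l1.const_div_atTop C
  have l3 : Tendsto (fun κ : ℝ => (A * m / (r - r')) * ((κ * (r - r')) * Real.exp (-(κ * (r - r'))))
      + B * m * Real.exp (-(κ * r))) atTop (nhds 0) := by
    have h1 : Tendsto (fun κ : ℝ => κ * (r - r')) atTop atTop :=
      tendsto_id.atTop_mul_const (by linarith)
    have h2 := (Real.tendsto_pow_mul_exp_neg_atTop_nhds_zero 1).comp h1
    have h3 : Tendsto (fun κ : ℝ => κ * r) atTop atTop := tendsto_id.atTop_mul_const hr0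
    have h4 := (Real.tendsto_exp_neg_atTop_nhds_zero).comp h3
    have := (h2.const_mul (A * m / (r - r'))).add (h4.const_mul (B * m))
    simpa [Function.comp_def] using this
  have ev := ((eventually_gt_atTop (0 : ℝ)).and (l2.eventually_lt_const hε)).and
    (l3.eventually_lt_const hε)
  obtain ⟨κ, ⟨h0, h1⟩, h2⟩ := ev.exists
  refine ⟨κ, h0, h1.le, le_trans (le_of_eq ?_) h2.le⟩
  have e : Real.exp (-(κ * (r - r'))) = Real.exp (κ * r') * Real.exp (-(κ * r)) := by
    rw [← Real.exp_add]; ring_nf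
  have hne : r - r' ≠ 0 := by linarith
  rw [e]
  field_simp

/-- Times at which `W` is `k`-Lipschitz in space. -/
def lipTimes (W : En n × ℝ → ℝ) (k : ℝ) : Set ℝ :=
  {t | ∀ x y, |W (x, t) - W (y, t)| ≤ k * ‖x - y‖}

theorem isClosed_lipTimes (hWt : ∀ x, Continuous fun t => W (x, t)) (k : ℝ) :
    IsClosed (lipTimes W k) := by
  have : lipTimes W k = ⋂ x, ⋂ y, {t | |W (x, t) - W (y, t)| ≤ k * ‖x - y‖} := by
    ext t; simp [lipTimes]
  rw [this]
  exact isClosed_iInter fun x => isClosed_iInter fun y =>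
    isClosed_le ((hWt x).sub (hWt y)).abs continuous_const

theorem lipTimes_mono {k k' : ℝ} (h : k ≤ k') : lipTimes W k ⊆ lipTimes W k' := fun _ ht x y =>
  (ht x y).trans (mul_le_mul_of_nonneg_right h (norm_nonneg _))

theorem iUnion_lipTimes (hWx : ∀ t, ∃ k, t ∈ lipTimes W k) : ⋃ j : ℕ, lipTimes W j = univ := by
  refine eq_univ_of_forall fun t => ?_
  obtain ⟨k, hk⟩ := hWx t
  obtain ⟨j, hj⟩ := exists_nat_ge k
  exact mem_iUnion.2 ⟨j, lipTimes_mono hj hk⟩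

theorem exists_measure_diff_lipTimes (hWt : ∀ x, Continuous fun t => W (x, t))
    (hWx : ∀ t, ∃ k, t ∈ lipTimes W k) (a b k : ℝ) {δ : ℝ} (hδ : 0 < δ) :
    ∃ k' ≥ k, volume.real (Icc a b \ lipTimes W k') ≤ δ := by
  have hm : ∀ j : ℕ, MeasurableSet (Icc a b \ lipTimes W j) := fun j =>
    measurableSet_Icc.diff (isClosed_lipTimes hWt j).measurableSet
  have lim := tendsto_measure_iInter_atTop (μ := (volume : Measure ℝ))
    (s := fun j : ℕ => Icc a b \ lipTimes W j) (fun j => (hm j).nullMeasurableSet)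
    (fun i j hij => sdiff_subset_sdiff_right (lipTimes_mono (by exact_mod_cast hij)))
    ⟨0, ((measure_mono sdiff_subset).trans_lt measure_Icc_lt_top).ne⟩
  rw [← sdiff_iUnion, iUnion_lipTimes hWx, sdiff_univ, measure_empty] at lim
  have ev := lim.eventually_lt_const (ENNReal.ofReal_pos.2 hδ)
  obtain ⟨j, h1, h2⟩ := (ev.and (eventually_ge_atTop ⌈k⌉₊)).exists
  refine ⟨j, (Nat.le_ceil k).trans (by exact_mod_cast h2), ?_⟩
  exact ENNReal.toReal_le_of_le_ofReal hδ.le h1.le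

theorem exists_close_lip (hW : BM W) (hR : ∀ z, R < ‖z.1‖ → W z = 0)
    (hWt : ∀ x, Continuous fun t => W (x, t)) (k a b : ℝ) {ε : ℝ} (hε : 0 < ε) :
    ∃ δ > 0, ∀ φ : ContDiffBump (0 : En n), φ.rOut < δ → ∃ δ' > 0,
      ∀ θ : ContDiffBump (0 : ℝ), θ.rOut < δ' → ∀ z, z.2 ∈ lipTimes W k → a ≤ z.2 → z.2 ≤ b →
        |avg (mol φ θ) W z - W z| ≤ ε := by
  refine ⟨min 1 (ε / 2 / (|k| + 1)), by positivity, fun φ hφ => ?_⟩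
  rw [lt_min_iff] at hφ
  obtain ⟨δ', hδ', H⟩ := exists_mol_close (hW.avg (N := inX (moll φ)))
    (continuous_avg_inX_moll hW hWt) (ε := ε / 2) (by positivity) (R + 1) a b
  refine ⟨δ', hδ', fun θ hθ z hz h1 h2 => ?_⟩
  have hx : |avg (inX (moll φ)) W z - W z| ≤ ε / 2 := by
    refine abs_avg_sub_le_of_ae hW ((ae_inX_moll φ).mono fun ζ hζ => ?_)
    obtain ⟨x, t⟩ := z
    obtain ⟨y, s⟩ := ζ
    obtain ⟨hy, rfl⟩ : ‖y‖ < φ.rOut ∧ s = 0 := hζ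
    have := hz (x + y) x
    rw [add_sub_cancel_left] at this
    simp only [Prod.mk_add_mk, add_zero]
    refine this.trans ?_
    have h3 : ‖y‖ ≤ ε / 2 / (|k| + 1) := (hy.trans hφ.2).le
    calc k * ‖y‖ ≤ (|k| + 1) * ‖y‖ := by gcongr; linarith [le_abs_self k]
      _ ≤ (|k| + 1) * (ε / 2 / (|k| + 1)) := by gcongr
      _ = ε / 2 := by field_simp
  have hy : |avg (mol φ θ) W z - avg (inX (moll φ)) W z| ≤ ε / 2 := by
    rw [avg_mol' hW]
    by_cases hz1 : ‖z.1‖ ≤ R + 1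
    · exact H θ hθ z.1 z.2 hz1 h1 h2
    · have h0 : ∀ t, avg (inX (moll φ)) W (z.1, t) = 0 := fun t => by
        refine integral_eq_zero_of_ae ((ae_inX_moll φ).mono fun ζ hζ => hR _ ?_)
        show R < ‖z.1 + ζ.1‖
        have := norm_sub_norm_le z.1 (-ζ.1)
        rw [sub_neg_eq_add, norm_neg] at this
        linarith [hζ.1]
      refine abs_avg_sub_le_of_ae hW.avg ((ae_inT_moll θ).mono fun ζ hζ => ?_)
      rw [show z + ζ = (z.1, z.2 + ζ.2) by ext1 <;> simp [hζ.1], h0,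
        show z = (z.1, z.2) from rfl, h0]
      simpa using by positivity
  exact (abs_sub_le _ _ _).trans (by linarith)

theorem exists_close_cont (hS : BM S) (hSc : Continuous S) {s₀ : ℝ}
    (hSR : ∀ z, R < ‖z.1‖ → S z = s₀) (a b : ℝ) {ε : ℝ} (hε : 0 < ε) :
    ∃ δ > 0, ∀ (φ : ContDiffBump (0 : En n)) (θ : ContDiffBump (0 : ℝ)), φ.rOut < δ → θ.rOut < δ →
      ∀ z, a ≤ z.2 → z.2 ≤ b → |avg (mol φ θ) S z - S z| ≤ ε := by
  have hK : IsCompact (Metric.closedBall (0 : En n) (R + 2) ×ˢ Icc (a - 1) (b + 1)) :=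
    (isCompact_closedBall _ _).prod isCompact_Icc
  have hu := hK.uniformContinuousOn_of_continuous hSc.continuousOn
  rw [Metric.uniformContinuousOn_iff] at hu
  obtain ⟨δ, hδ, h⟩ := hu ε hε
  refine ⟨min δ 1, by positivity, fun φ θ hφ hθ z ha hb => ?_⟩
  rw [lt_min_iff] at hφ hθ
  refine abs_avg_sub_le_of_ae hS ((ae_mol φ θ).mono fun ζ hζ => ?_)
  obtain ⟨x, t⟩ := z
  obtain ⟨y, s⟩ := ζ
  obtain ⟨hy, hs⟩ : ‖y‖ < φ.rOut ∧ |s| < θ.rOut := hζ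
  have hs2 := abs_lt.1 (hs.trans hθ.2)
  simp only at ha hb
  by_cases hx : ‖x‖ ≤ R + 1
  · have := h ((x, t) + (y, s)) (by
        simp only [Prod.mk_add_mk, mem_prod, mem_closedBall_zero_iff, mem_Icc]
        exact ⟨(norm_add_le _ _).trans (by linarith), by linarith, by linarith⟩) (x, t) (by
        simp only [mem_prod, mem_closedBall_zero_iff, mem_Icc]
        exact ⟨by linarith, by linarith, by linarith⟩) (by
        simp only [Prod.mk_add_mk, Prod.dist_eq, dist_self_add_left, Real.norm_eq_abs]
        exact max_lt (hy.trans hφ.1) (hs.trans hθ.1))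
    rw [Real.dist_eq] at this
    exact this.le
  · have h1 : S (x, t) = s₀ := hSR _ (by show R < ‖x‖; linarith)
    have h2 : S ((x, t) + (y, s)) = s₀ := hSR _ (by
      show R < ‖x + y‖
      have := norm_sub_norm_le x (-y)
      rw [sub_neg_eq_add, norm_neg] at this
      linarith)
    rw [h1, h2, sub_self, abs_zero]; exact hε.le

theorem exists_close_avg_mol {f : En n × ℝ → ℝ} (hf : BM f) (φ₀ : ContDiffBump (0 : En n))
    (θ₀ : ContDiffBump (0 : ℝ)) {ε : ℝ} (hε : 0 < ε) :
    ∃ δ > 0, ∀ (φ : ContDiffBump (0 : En n)) (θ : ContDiffBump (0 : ℝ)), φ.rOut < δ → θ.rOut < δ →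
      ∀ z, |avg (mol φ θ) (avg (mol φ₀ θ₀) f) z - avg (mol φ₀ θ₀) f z| ≤ ε := by
  obtain ⟨L, hL, h⟩ := exists_lipschitz_of_BM φ₀ θ₀ hf
  refine ⟨ε / (L + 1), by positivity, fun φ θ hφ hθ z => ?_⟩
  refine abs_avg_sub_le_of_ae hf.avg ((ae_mol φ θ).mono fun ζ hζ => ?_)
  refine (h _ _).trans ?_
  rw [add_sub_cancel_left]
  have : ‖ζ‖ ≤ ε / (L + 1) := by
    rw [Prod.norm_def]; exact max_le (hζ.1.trans hφ).le (hζ.2.trans hθ).le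
  calc L * ‖ζ‖ ≤ (L + 1) * (ε / (L + 1)) := by gcongr; linarith
    _ = ε := by field_simp

end TimeStep

section TimeStep

variable {n : ℕ} {W S b : En n × ℝ → ℝ} {R : ℝ}

theorem continuous_avg_avg_mol {ρ : Measure (En n × ℝ)} [IsFiniteMeasure ρ] {f : En n × ℝ → ℝ}
    (hf : BM f) (φ : ContDiffBump (0 : En n)) (θ : ContDiffBump (0 : ℝ)) :
    Continuous (avg ρ (avg (mol φ θ) f)) := by
  rw [show avg ρ (avg (mol φ θ) f) = avg (mol φ θ) (avg ρ f) from
    funext fun z => avg_comm hf z]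
  exact continuous_avg_mol hf.avg

set_option maxHeartbeats 4000000 in
/-- If at exceptional times only a pointwise inequality is known, the mollified inequality
nevertheless holds near a time around which the exceptional times are uniformly Lipschitz. -/
theorem MolSub.of_exceptional {N : ℝ → Measure (En n × ℝ)} [∀ h, IsFiniteMeasure (N h)]
    {c₁ m s₀ r r' A₁ lam₀ k t₀ : ℝ} {T : Set ℝ}
    (hc : ∀ h, ∀ᵐ ζ ∂N h, ζ.2 ≤ 0)
    (hnice : ∀ φ θ, Nice N (mol φ θ)) (hW : BM W) (hW0 : ∀ z, 0 ≤ W z) (hWm : ∀ z, W z ≤ m)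
    (hR : ∀ z, R < ‖z.1‖ → W z = 0) (hWt : ∀ x, Continuous fun t => W (x, t))
    (hWx : ∀ t, Continuous fun x => W (x, t)) (hWlip : ∀ t, ∃ k, t ∈ lipTimes W k)
    (hS : BM S) (hSc : Continuous S) (hSR : ∀ z, R < ‖z.1‖ → S z = s₀) (hS0 : ∀ z, 0 ≤ S z)
    (hb : ∀ z, b z = c₁ * W z + S z) (hT : IsClosed T) (G : ∀ t ∉ T, ∃ ρ > 0, MolSub N W b t ρ)
    (H : ∀ z, ∀ η > 0, ∀ᶠ h in nhdsWithin 0 (Ioi 0), -b z - η ≤ gen (N h) W z)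
    (hk : ∀ t ∈ T, |t - t₀| ≤ 3 * r → t ∈ lipTimes W k)
    (hr'0 : 0 ≤ r') (hr : r' < r) (hA₁ : 1 ≤ A₁) (hlam₀ : 0 ≤ lam₀) (hc₁ : -c₁ ≤ lam₀)
    (hE : ∀ κ a : ℝ, 0 < κ → ∀ᶠ h in nhdsWithin 0 (Ioi 0), ∀ z : En n × ℝ, a < z.2 →
      gen (N h) (fun z => m * min 1 (Real.exp (κ * (a - z.2)))) z ≤
        A₁ * κ * Real.exp (κ * r') * (m * min 1 (Real.exp (κ * (a - z.2)))))
    (hP : ∀ (M : ℝ) (θ₀ : ContDiffBump (0 : ℝ)) (lam : ℝ), lam₀ ≤ lam → ∃ C, 0 ≤ C ∧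
      ∀ A ⊆ Icc (-M) M, MeasurableSet A → ∃ g : En n × ℝ → ℝ, Continuous g ∧ BM g ∧
        (∀ z, 0 ≤ g z) ∧ (∀ φ₀ z, avg (mol φ₀ θ₀) g z ≤ C * volume.real A) ∧
        (∀ᶠ h in nhdsWithin 0 (Ioi 0), ∀ z, gen (N h) g z ≤ lam * g z) ∧
        ∀ φ θ, ∃ L, ∀ᶠ h in nhdsWithin 0 (Ioi 0), ∀ z,
          gen (N h) (avg (mol φ θ) g) z ≤ lam * avg (mol φ θ) g z -
            avg (mol φ θ) (fun z => A.indicator (fun _ => 1) z.2) z + L * h) :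
    MolSub N W b t₀ r := by
  have hm : 0 ≤ m := (hW0 0).trans (hWm 0)
  have hr0 : 0 < r := hr'0.trans_lt hr
  have hbB : BM b := by
    rw [funext hb]; exact (hW.const_mul c₁).add hS
  intro φ₀ θ₀ hθ₀ x t ht η hη
  set z₀ : En n × ℝ := (x, t) with hz₀
  set a := t₀ - 3 * r with ha
  set e := t₀ + 3 * r with he
  set μ := mol φ₀ θ₀ with hμ
  set ε := η / 8 with hε
  have hε0 : 0 < ε := by positivity
  obtain ⟨h₁, hh₁, H₁⟩ := (hnice φ₀ θ₀).of_BM hW hε0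
  set h₂ := h₁ / 2 with hh₂
  set Ξ : En n × ℝ → ℝ := fun z => b z + gen (N h₂) W z with hΞ
  have hΞB : BM Ξ := hbB.add hW.gen
  have hΞ_eq : ∀ z, avg μ Ξ z = avg μ b z + gen (N h₂) (avg μ W) z := fun z => by
    rw [hΞ, avg_add hbB hW.gen, gen_avg hW]
  suffices hmain : -(6 * ε) ≤ avg μ Ξ z₀ by
    filter_upwards [Ioo_mem_nhdsGT hh₁] with h hh
    have h3 := abs_le.1 (H₁ h h₂ hh.1 hh.2 (by positivity) (by linarith) z₀)
    rw [hΞ_eq] at hmain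
    linarith [h3.1]
  obtain ⟨h₃, hh₃, CΞ, hCΞ0, H₃⟩ := (hnice φ₀ θ₀).bounded hΞB
  obtain ⟨κ, hκ, hκ1, hκ2⟩ := exists_rate (C := CΞ) (m := m) (B := lam₀ + 1) hr hr0 hA₁ hr'0
    (by positivity) hε0
  have hexp0 : 0 ≤ A₁ * κ * Real.exp (κ * r') := by positivity
  set lam := A₁ * κ * Real.exp (κ * r') + (lam₀ + 1) with hlam
  have hlam0 : 0 < lam := by linarith
  -- the right-hand side
  set F : En n × ℝ → ℝ := fun z => lam * W z + b z with hF
  have hFB : BM F := (hW.const_mul _).add hbB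
  have hF_eq : ∀ z, F z = (lam + c₁) * W z + S z := fun z => by simp only [hF, hb]; ring
  have hlc : 0 ≤ lam + c₁ := by linarith
  have hF0 : ∀ z, 0 ≤ F z := fun z => by
    rw [hF_eq]; exact add_nonneg (mul_nonneg hlc (hW0 z)) (hS0 z)
  obtain ⟨CF, hCF⟩ := hFB.bdd
  have hFle : ∀ z, F z ≤ CF := fun z => (le_abs_self _).trans (hCF z)
  have hCF0 : 0 ≤ CF := (abs_nonneg _).trans (hCF 0)
  -- the potential of the bad times
  set M := max |a - 1| |e + 1| with hM
  obtain ⟨Cp, hCp0, HP⟩ := hP M θ₀ lam (by linarith)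
  obtain ⟨k', hk', hvol⟩ := exists_measure_diff_lipTimes hWt hWlip (a - 1) (e + 1) k
    (δ := ε / (lam * CF * Cp + 1)) (by positivity)
  set A := Icc (a - 1) (e + 1) \ lipTimes W k' with hA
  have hAm : MeasurableSet A :=
    measurableSet_Icc.diff (isClosed_lipTimes hWt k').measurableSet
  have hAM : A ⊆ Icc (-M) M := by
    rintro s ⟨⟨h1, h2⟩, -⟩
    have h3 := neg_abs_le (a - 1)
    have h4 := le_abs_self (e + 1)
    exact ⟨by linarith [le_max_left |a - 1| |e + 1|], by linarith [le_max_right |a - 1| |e + 1|]⟩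
  obtain ⟨g, hgc, hgB, hg0, hgavg, hg1, hg2⟩ := HP A hAM hAm
  have hgsmall : lam * CF * avg μ g z₀ ≤ ε := by
    have h1 : avg μ g z₀ ≤ Cp * (ε / (lam * CF * Cp + 1)) :=
      (hgavg φ₀ z₀).trans (by gcongr)
    have h2 : 0 ≤ lam * CF * Cp := by positivity
    calc lam * CF * avg μ g z₀ ≤ lam * CF * (Cp * (ε / (lam * CF * Cp + 1))) := by gcongr
      _ = (lam * CF * Cp) * (ε / (lam * CF * Cp + 1)) := by ring
      _ ≤ (lam * CF * Cp + 1) * (ε / (lam * CF * Cp + 1)) := by gcongr; linarith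
      _ = ε := by field_simp
  -- the mollifier
  set ε' := ε / 4 / (lam + c₁ + 1) with hε'
  have hε'0 : 0 < ε' := by positivity
  obtain ⟨d₁, hd₁, D₁⟩ := exists_close_lip hW hR hWt k' (a - 1) (e + 1) hε'0
  obtain ⟨d₂, hd₂, D₂⟩ := exists_close_cont hS hSc hSR (a - 1) (e + 1) (ε := ε / 4) (by positivity)
  obtain ⟨d₃, hd₃, D₃⟩ := exists_close_avg_mol hFB φ₀ θ₀ hε0
  obtain ⟨φ₁, hφ₁⟩ := exists_bump (V := En n) (r := min d₁ (min d₂ d₃) / 2) (by positivity)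
  have hφ₁' : φ₁.rOut < min d₁ (min d₂ d₃) := by
    rw [hφ₁]; exact half_lt_self (by positivity)
  rw [lt_min_iff, lt_min_iff] at hφ₁'
  obtain ⟨d₄, hd₄, D₄⟩ := D₁ φ₁ hφ₁'.1
  obtain ⟨θ₁, hθ₁⟩ := exists_bump (V := ℝ) (r := min d₄ (min d₂ d₃) / 2) (by positivity)
  have hθ₁' : θ₁.rOut < min d₄ (min d₂ d₃) := by
    rw [hθ₁]; exact half_lt_self (by positivity)
  rw [lt_min_iff, lt_min_iff] at hθ₁'
  set μ₁ := mol φ₁ θ₁ with hμ₁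
  have hFclose : ∀ z, z.2 ∈ lipTimes W k' → a - 1 ≤ z.2 → z.2 ≤ e + 1 →
      |avg μ₁ F z - F z| ≤ ε / 2 := by
    intro z h1 h2 h3
    have k1 := D₄ θ₁ hθ₁'.1 z h1 h2 h3
    have k2 := D₂ φ₁ θ₁ hφ₁'.2.1 hθ₁'.2.1 z h2 h3
    have k3 : avg μ₁ F z = (lam + c₁) * avg μ₁ W z + avg μ₁ S z := by
      rw [funext hF_eq, avg_add (hW.const_mul _) hS, avg_const_mul]
    have k4 : (lam + c₁) * |avg μ₁ W z - W z| ≤ ε / 4 :=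
      calc _ ≤ (lam + c₁ + 1) * ε' := mul_le_mul (by linarith) k1 (abs_nonneg _) (by linarith)
        _ = ε / 4 := by rw [hε']; field_simp
    rw [k3, hF_eq, show (lam + c₁) * avg μ₁ W z + avg μ₁ S z - ((lam + c₁) * W z + S z) =
      (lam + c₁) * (avg μ₁ W z - W z) + (avg μ₁ S z - S z) by ring]
    refine (abs_add_le _ _).trans ?_
    rw [abs_mul, abs_of_nonneg hlc]
    linarith
  -- the resolvent
  obtain ⟨h₄, hh₄, H₄⟩ := (hnice φ₁ θ₁).of_BM (hFB.add (.const ε)) (ε := lam * (ε / 2))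
    (by positivity)
  set h₀ := min h₁ (min h₃ h₄) / 2 with hh₀
  have hh₀0 : 0 < h₀ := by positivity
  have hh₀' : h₀ < min h₁ (min h₃ h₄) := half_lt_self (by positivity)
  rw [lt_min_iff, lt_min_iff] at hh₀'
  obtain ⟨ρ, hρfin, hρ1, hρ⟩ := exists_resolvent (N h₀) hlam0
  have avgρ_const : ∀ c z, lam * avg ρ (fun _ => c) z = c := fun c z => by
    rw [avg_const, ← mul_assoc, hρ1, one_mul]
  set f : En n × ℝ → ℝ := avg μ₁ (fun z => F z + ε) with hf
  have hfB : BM f := (hFB.add (.const ε)).avg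
  have hf_eq : ∀ z, f z = avg μ₁ F z + ε := fun z => by
    rw [hf, avg_add hFB (.const _), avg_const_prob]
  have hf0 : ∀ z, ε ≤ f z := fun z => by
    rw [hf_eq]; linarith [avg_nonneg (N := μ₁) hF0 z]
  set u := avg ρ f with hu
  have huB : BM u := hfB.avg
  have hu0 : ∀ z, 0 ≤ u z := avg_nonneg fun z => hε0.le.trans (hf0 z)
  have huc : Continuous u := continuous_avg_avg_mol (hFB.add (.const ε)) φ₁ θ₁
  have hgen_u : ∀ h, 0 < h → h < h₄ → ∀ z, gen (N h) u z ≤ lam * u z - f z + ε / 2 := by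
    intro h h0 h1 z
    rw [hu, gen_avg hfB]
    have k1 : avg ρ (gen (N h) f) z ≤ avg ρ (fun z => gen (N h₀) f z + lam * (ε / 2)) z :=
      avg_mono hfB.gen (hfB.gen.add (.const _)) (Eventually.of_forall fun ζ => by
        have := (abs_le.1 (H₄ h h₀ h0 h1 hh₀0 hh₀'.2.2 (z + ζ))).2
        show gen (N h) f (z + ζ) ≤ gen (N h₀) f (z + ζ) + lam * (ε / 2)
        linarith)
    rw [avg_add hfB.gen (.const _), avg_const_mul] at k1
    have k2 := hρ f hfB z
    have k3 := avgρ_const (ε / 2) z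
    linarith
  -- the barrier
  set E : En n × ℝ → ℝ := fun z => m * min 1 (Real.exp (κ * (a - z.2))) with hEdef
  have hEB : BM E := by
    refine BM.const_mul m ⟨by fun_prop, 1, fun z => ?_⟩
    rw [abs_of_nonneg (by positivity)]
    exact min_le_left _ _
  have hE0 : ∀ z, 0 ≤ E z := fun z => by simp only [hEdef]; positivity
  have hEgen : ∀ᶠ h in nhdsWithin 0 (Ioi 0), ∀ z : En n × ℝ, a < z.2 →
      gen (N h) E z ≤ lam * E z := by
    filter_upwards [hE κ a hκ] with h hh z hz
    refine (hh z hz).trans ?_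
    show _ ≤ lam * E z
    have := mul_nonneg (by positivity : 0 ≤ lam₀ + 1) (hE0 z)
    rw [hlam, add_mul]
    linarith
  set ψ : En n × ℝ → ℝ := fun z => u z + CF * g z + E z with hψ
  have hψB : BM ψ := (huB.add (hgB.const_mul _)).add hEB
  have hψc : Continuous ψ := (huc.add (continuous_const.mul hgc)).add (by fun_prop)
  have hψ0 : ∀ z, 0 ≤ ψ z := fun z =>
    add_nonneg (add_nonneg (hu0 z) (mul_nonneg hCF0 (hg0 z))) (hE0 z)
  have hgenψ : ∀ h z, gen (N h) ψ z = gen (N h) u z + CF * gen (N h) g z + gen (N h) E z := by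
    intro h z
    rw [hψ, gen_add (huB.add (hgB.const_mul _)) hEB, gen_add huB (hgB.const_mul _), gen_const_mul]
  have hsmall : ∀ᶠ h in nhdsWithin (0 : ℝ) (Ioi 0), 0 < h ∧ h < h₄ := Ioo_mem_nhdsGT hh₄
  have hcomp : ∀ z, z.2 ≤ e → W z ≤ ψ z := by
    refine comparison (N := N) (W := W) (b := b) (ψ := ψ) (T := T) (R := R) (t₀ := a) (t₁ := e)
      (k := k) (m := m) (lam := lam) hc hW hbB hR hWt hWx hT ?_ ?_ G hψB hψc hψ0 hWm ?_ hlam0 ?_ ?_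
    · intro s hs h1 h2
      exact hk s hs (abs_le.2 ⟨by linarith, by linarith⟩)
    · intro z _ _ _; exact H z
    · intro z hz
      have h1 : E z = m := by
        have : 1 ≤ Real.exp (κ * (a - z.2)) := Real.one_le_exp (by
          have : 0 ≤ a - z.2 := by linarith
          positivity)
        simp only [hEdef]
        rw [min_eq_left this, mul_one]
      have h2 := hu0 z
      have h3 := mul_nonneg hCF0 (hg0 z)
      simp only [hψ]; linarith
    · intro z hzT h1 h2
      filter_upwards [hsmall, hEgen, hg1] with h k1 k2 k3
      have k4 := hgen_u h k1.1 k1.2 z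
      have k5 := k2 z h1
      have k6 := mul_le_mul_of_nonneg_left (k3 z) hCF0
      have k7 := hFclose z (lipTimes_mono hk' (hk _ hzT (abs_le.2 ⟨by linarith, by linarith⟩)))
        (by linarith) (by linarith)
      have k8 := (abs_le.1 k7).1
      have k9 : F z = lam * W z + b z := rfl
      rw [hgenψ]
      have k10 := hf_eq z
      simp only [hψ]
      linarith
    · intro φ θ hθ z h1 h2 η' hη'
      obtain ⟨L, hL⟩ := hg2 φ θ
      have hLh : ∀ᶠ h in nhdsWithin (0 : ℝ) (Ioi 0), CF * (L * h) < η' := by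
        have : Tendsto (fun h : ℝ => CF * (L * h)) (nhds 0) (nhds 0) := by
          have : Continuous fun h : ℝ => CF * (L * h) := by fun_prop
          simpa using this.tendsto 0
        exact (this.mono_left nhdsWithin_le_nhds).eventually_lt_const hη'
      filter_upwards [hsmall, hEgen, hL, hLh] with h k1 k2 k3 k4
      have i1 : BM (fun z : En n × ℝ => A.indicator (fun _ => (1:ℝ)) z.2) :=
        (BM.indicator_one hAm).comp measurable_snd
      have e1 : gen (N h) (avg (mol φ θ) ψ) z = avg (mol φ θ) (fun z => gen (N h) u z +
          gen (N h) E z) z + CF * gen (N h) (avg (mol φ θ) g) z := by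
        rw [gen_avg hψB, funext (hgenψ h), avg_add (huB.gen.add (hgB.gen.const_mul _)) hEB.gen,
          avg_add huB.gen (hgB.gen.const_mul _), avg_add huB.gen hEB.gen, avg_const_mul,
          gen_avg hgB]
        ring
      have e2 : avg (mol φ θ) (fun z => gen (N h) u z + gen (N h) E z) z ≤
          avg (mol φ θ) (fun z => (lam * (u z + E z) - F z) +
            CF * A.indicator (fun _ => (1:ℝ)) z.2) z := by
        refine avg_mono (huB.gen.add hEB.gen)
          ((((huB.add hEB).const_mul _).sub hFB).add (i1.const_mul _))
          ((ae_mol φ θ).mono fun ζ hζ => ?_)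
        have s1 := abs_lt.1 hζ.2
        have s2 : (z + ζ).2 = z.2 + ζ.2 := rfl
        have j1 := hgen_u h k1.1 k1.2 (z + ζ)
        have j2 := k2 (z + ζ) (by rw [s2]; linarith)
        have j3 := hf_eq (z + ζ)
        have s3 : a - 1 ≤ (z + ζ).2 := by rw [s2]; linarith
        have s4 : (z + ζ).2 ≤ e + 1 := by rw [s2]; linarith
        by_cases hlip : (z + ζ).2 ∈ lipTimes W k'
        · have j4 := (abs_le.1 (hFclose _ hlip s3 s4)).1
          rw [indicator_of_notMem (fun h => h.2 hlip)]
          linarith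
        · rw [indicator_of_mem (show (z + ζ).2 ∈ A from ⟨⟨s3, s4⟩, hlip⟩)]
          have j4 := avg_nonneg (N := μ₁) hF0 (z + ζ)
          have j5 := hFle (z + ζ)
          linarith
      rw [avg_add (((huB.add hEB).const_mul _).sub hFB) (i1.const_mul _), avg_const_mul,
        avg_sub ((huB.add hEB).const_mul _) hFB, avg_const_mul, avg_add huB hEB] at e2
      have e3 : avg (mol φ θ) (fun z => lam * (ψ z - W z) - b z) z =
          lam * (avg (mol φ θ) u z + CF * avg (mol φ θ) g z + avg (mol φ θ) E z)
            - avg (mol φ θ) F z := by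
        rw [show (fun z => lam * (ψ z - W z) - b z) = fun z => lam * ψ z - F z by
          funext z; simp only [hF]; ring, avg_sub (hψB.const_mul _) hFB, avg_const_mul, hψ,
          avg_add (huB.add (hgB.const_mul _)) hEB, avg_add huB (hgB.const_mul _), avg_const_mul]
      rw [e1, e3]
      have e4 := mul_le_mul_of_nonneg_left (k3 z) hCF0
      linarith
  -- conclusion
  have c1 : avg μ W z₀ ≤ avg μ u z₀ + CF * avg μ g z₀ + m * Real.exp (-(κ * r)) := by
    have : avg μ W z₀ ≤ avg μ (fun z => u z + CF * g z + m * Real.exp (-(κ * r))) z₀ := by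
      refine avg_mono hW ((huB.add (hgB.const_mul _)).add (.const _))
        ((ae_mol φ₀ θ₀).mono fun ζ hζ => ?_)
      have s1 := abs_lt.1 hζ.2
      have s0 := abs_lt.1 ht
      have s2 : (z₀ + ζ).2 = t + ζ.2 := rfl
      refine (hcomp (z₀ + ζ) (by rw [s2]; linarith)).trans ?_
      simp only [hψ, hEdef, s2]
      have : min 1 (Real.exp (κ * (a - (t + ζ.2)))) ≤ Real.exp (-(κ * r)) := by
        refine (min_le_right _ _).trans (Real.exp_le_exp.2 ?_)
        nlinarith
      gcongr
    rwa [avg_add (huB.add (hgB.const_mul _)) (.const _), avg_add huB (hgB.const_mul _),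
      avg_const_mul, avg_const_prob] at this
  have c2 : lam * avg μ u z₀ ≤ lam * avg ρ (fun z => lam * avg μ W z + avg μ b z) z₀ + 2 * ε := by
    have k1 : avg μ u z₀ = avg ρ (avg μ f) z₀ := avg_comm hfB z₀
    have k2 : avg ρ (avg μ f) z₀ ≤
        avg ρ (fun z => (lam * avg μ W z + avg μ b z) + 2 * ε) z₀ := by
      refine avg_mono hfB.avg (((hW.avg.const_mul _).add hbB.avg).add (.const _))
        (Eventually.of_forall fun ζ => ?_)
      have j1 : avg μ f (z₀ + ζ) = avg μ₁ (avg μ F) (z₀ + ζ) + ε := by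
        rw [funext hf_eq, avg_add hFB.avg (.const _), avg_const_prob, avg_comm hFB]
      have j2 := (abs_le.1 (D₃ φ₁ θ₁ hφ₁'.2.2 hθ₁'.2.2 (z₀ + ζ))).2
      have j3 : avg μ F (z₀ + ζ) = lam * avg μ W (z₀ + ζ) + avg μ b (z₀ + ζ) := by
        rw [hF, avg_add (hW.const_mul _) hbB, avg_const_mul]
      linarith
    rw [avg_add ((hW.avg.const_mul _).add hbB.avg) (.const _)] at k2
    have k3 := avgρ_const (2 * ε) z₀
    rw [k1]
    have := mul_le_mul_of_nonneg_left k2 hlam0.le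
    linarith
  have c3 : lam * avg ρ (fun z => lam * avg μ W z + avg μ b z) z₀ ≤
      lam * avg μ W z₀ + lam * avg ρ (avg μ Ξ) z₀ + ε := by
    rw [avg_add (hW.avg.const_mul _) hbB.avg, avg_const_mul]
    have k1 := hρ (avg μ W) hW.avg z₀
    have k2 : avg ρ (gen (N h₀) (avg μ W)) z₀ + avg ρ (avg μ b) z₀ ≤
        avg ρ (fun z => avg μ Ξ z + ε) z₀ := by
      rw [← avg_add hW.avg.gen hbB.avg]
      refine avg_mono (hW.avg.gen.add hbB.avg) (hΞB.avg.add (.const _))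
        (Eventually.of_forall fun ζ => ?_)
      have := (abs_le.1 (H₁ h₀ h₂ hh₀0 hh₀'.1 (by positivity) (by linarith) (z₀ + ζ))).2
      have := hΞ_eq (z₀ + ζ)
      show gen (N h₀) (avg μ W) (z₀ + ζ) + avg μ b (z₀ + ζ) ≤ avg μ Ξ (z₀ + ζ) + ε
      linarith
    rw [avg_add hΞB.avg (.const _)] at k2
    have k3 := avgρ_const ε z₀
    have k4 := mul_le_mul_of_nonneg_left k2 hlam0.le
    have k5 : lam * (lam * avg ρ (avg μ W) z₀) = lam * (avg μ W z₀ +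
      avg ρ (gen (N h₀) (avg μ W)) z₀) := by rw [← k1]; ring
    linarith
  have c4 : lam * avg ρ (avg μ Ξ) z₀ ≤ avg μ Ξ z₀ + ε := by
    have k1 := hρ (avg μ Ξ) hΞB.avg z₀
    have k2 : avg ρ (gen (N h₀) (avg μ Ξ)) z₀ ≤ avg ρ (fun _ => CΞ) z₀ :=
      avg_mono hΞB.avg.gen (.const _) (Eventually.of_forall fun ζ =>
        (le_abs_self _).trans (H₃ h₀ hh₀0 hh₀'.2.1 _))
    have k3 := avgρ_const CΞ z₀
    have k4 : avg ρ (fun _ => CΞ) z₀ = CΞ / lam := by rw [eq_div_iff hlam0.ne', mul_comm, k3]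
    linarith
  have c5 := mul_le_mul_of_nonneg_left c1 hlam0.le
  linarith

end TimeStep

section MaximumPrinciple

namespace JumpFamily

variable {n : ℕ} {J : JumpFamily n} {W : En n × ℝ → ℝ} {R m K ε₀ : ℝ}

theorem molSub_near_iff {b : En n × ℝ → ℝ} (hW : BM W) (hb : BM b) {r : ℝ} (hr : 0 < r)
    (t ρ : ℝ) : MolSub (J.near r) W (fun z => b z + gen (inT (J.far r)) W z) t ρ ↔
      MolSub J.full W b t ρ := by
  refine forall₅_congr fun φ θ hθ x t' => forall₃_congr fun ht' η hη => ?_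
  refine eventually_congr ?_
  filter_upwards [Ioo_mem_nhdsGT hr] with h hh
  rw [gen_near hW.avg hh.1 hh.2, avg_add hb hW.gen, gen_avg hW (N := inT (J.far r))]
  constructor <;> intro <;> linarith

theorem isOpen_setOf_molSub {N : ℝ → Measure (En n × ℝ)} {b : En n × ℝ → ℝ} :
    IsOpen {t | ∃ ρ > 0, MolSub N W b t ρ} := by
  rw [Metric.isOpen_iff]
  rintro t ⟨ρ, hρ, h⟩
  refine ⟨ρ / 2, by positivity, fun t' ht' => ⟨ρ / 2, by positivity, h.mono ?_⟩⟩
  rw [Metric.mem_ball, Real.dist_eq] at ht'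
  linarith

theorem exists_molSub (hW : BM W) (hW0 : ∀ z, 0 ≤ W z) (hWm : ∀ z, W z ≤ m)
    (hR : ∀ z, R < ‖z.1‖ → W z = 0) (hWt : ∀ x, Continuous fun t => W (x, t))
    (hWx : ∀ t, Continuous fun x => W (x, t)) (hWlip : ∀ t, ∃ k, t ∈ lipTimes W k)
    (hK : 0 ≤ K) (hε₀ : 0 ≤ ε₀)
    (H : ∀ z, ∀ η > 0, ∀ᶠ h in nhdsWithin 0 (Ioi 0),
      -(K * (W z + ε₀)) - η ≤ gen (J.full h) W z) (t : ℝ) :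
    ∃ ρ > 0, MolSub J.full W (fun z => K * (W z + ε₀)) t ρ := by
  set b : En n × ℝ → ℝ := fun z => K * (W z + ε₀) with hb
  have hbB : BM b := (hW.add (.const _)).const_mul _
  have hm : 0 ≤ m := (hW0 0).trans (hWm 0)
  set T : Set ℝ := {t | ∃ ρ > 0, MolSub J.full W b t ρ}ᶜ with hT
  have hTc : IsClosed T := isOpen_setOf_molSub.isClosed_compl
  by_contra hcon
  have hne : Nonempty T := ⟨⟨t, hcon⟩⟩
  have : CompleteSpace T := hTc.completeSpace_coe
  obtain ⟨j, ⟨t₀, ht₀T⟩, ht₀⟩ := nonempty_interior_of_iUnion_of_closed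
    (f := fun j : ℕ => (Subtype.val ⁻¹' lipTimes W j : Set T))
    (fun j => (isClosed_lipTimes hWt j).preimage continuous_subtype_val)
    (by rw [← preimage_iUnion, iUnion_lipTimes hWlip, preimage_univ])
  rw [mem_interior_iff_mem_nhds, Metric.mem_nhds_iff] at ht₀
  obtain ⟨d, hd, hball⟩ := ht₀
  set r := min 1 (d / 4) with hr
  have hr0 : 0 < r := by positivity
  have hr1 : r ≤ 1 := min_le_left _ _
  have hrd : r ≤ d / 4 := min_le_right _ _
  set r' := r / 2 with hr'
  have hr'0 : 0 < r' := by positivity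
  set c := (J.far r').real univ with hc
  obtain ⟨C, hC0, hC⟩ := J.gen_near_exp_le
  refine ht₀T ⟨r, hr0, (molSub_near_iff hW hbB hr'0 _ _).1 ?_⟩
  have hS := hW.avg (N := inT (J.far r'))
  have hS0 : ∀ z, 0 ≤ avg (inT (J.far r')) W z := avg_nonneg hW0
  refine MolSub.of_exceptional (S := fun z => K * ε₀ + avg (inT (J.far r')) W z)
    (c₁ := K - c) (m := m) (s₀ := K * ε₀) (r' := r') (A₁ := C + 1) (lam₀ := c) (k := j) (T := T)
    (R := R) (ae_near r') (nice_near hr'0) hW hW0 hWm hR hWt hWx hWlip ((BM.const _).add hS)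
    (continuous_const.add (continuous_avg_far hr'0 hW hWx)) ?_ (fun z => ?_) ?_ hTc ?_ ?_ ?_
    hr'0.le (by linarith) (by linarith) measureReal_nonneg (by linarith) ?_ ?_
  · intro z hz
    have : avg (inT (J.far r')) W z = 0 := by
      refine integral_eq_zero_of_ae (ae_inT_fst.mono fun ζ hζ => hR _ ?_)
      show R < ‖z.1 + ζ.1‖
      rwa [hζ, add_zero]
    rw [this, add_zero]
  · exact add_nonneg (mul_nonneg hK hε₀) (hS0 z)
  · intro z
    have e : (inT (n := n) (J.far r')).real univ = c := by
      have := avg_inT (n := n) (m' := J.far r') (BM.const (1 : ℝ)).meas 0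
      rwa [avg_const, avg_const, mul_one, mul_one] at this
    rw [gen_eq hW, e, hb]; ring
  · intro s hs
    rw [hT, notMem_compl_iff] at hs
    obtain ⟨ρ, hρ, h⟩ := hs
    exact ⟨ρ, hρ, (molSub_near_iff hW hbB hr'0 _ _).2 h⟩
  · intro z η hη
    filter_upwards [H z η hη, Ioo_mem_nhdsGT hr'0] with h h1 h2
    rw [gen_near hW h2.1 h2.2]
    simp only [hb]; linarith
  · intro s hs hst
    have : (⟨s, hs⟩ : T) ∈ Metric.ball (⟨t₀, ht₀T⟩ : T) d := by
      rw [Metric.mem_ball, Subtype.dist_eq, Real.dist_eq]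
      show |s - t₀| < d
      linarith
    exact hball this
  · intro κ a hκ
    filter_upwards [Ioo_mem_nhdsGT (zero_lt_one' ℝ)] with h hh z hz
    refine (hC r' κ m a (by linarith) hκ hm h hh.1 hh.2 z hz).trans ?_
    gcongr
    linarith
  · intro M θ₀ lam hlam
    obtain ⟨C, hC0, hC⟩ := near_pot (J := J) M θ₀ hlam
    refine ⟨C, hC0, fun A hA hAm => ?_⟩
    obtain ⟨g, g1, g2, g3, g4, g5, g6⟩ := hC A hA hAm
    have ev : ∀ᶠ h in nhdsWithin (0 : ℝ) (Ioi 0), 0 < h ∧ h < min 1 r' :=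
      Ioo_mem_nhdsGT (by positivity)
    exact ⟨g, g1, g2, g3, g4, ev.mono fun h hh => g5 h hh.1 hh.2, fun φ θ =>
      (g6 φ θ).imp fun L hL => ev.mono fun h hh => hL h hh.1 hh.2⟩

theorem gen_full_le_of_jumps {D : En n × ℝ → ℝ} (hD : BM D) {z : En n × ℝ}
    (hmax : ∀ z', D z' ≤ D z) {B : Set (En n)} (hB : MeasurableSet B) {v Λ h : ℝ} (hv : 0 ≤ v)
    (hBv : ∀ y ∈ B, D (z.1 + y, z.2) ≤ D z - v) (hΛ : Λ ≤ (J.σ h).real B) :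
    gen (J.full h) D z ≤ -(Λ * v) := by
  rw [gen_full hD]
  have h1 : gen (J.ν h) (fun t => D (z.1, t)) z.2 ≤ 0 :=
    gen_nonpos (Eventually.of_forall fun τ => hmax _)
  have h2 : gen (J.σ h) (fun x => D (x, z.2)) z.1 ≤ ∫ y, B.indicator (fun _ => -v) y ∂J.σ h := by
    refine integral_mono_ae ((((hD.slice z.2).translate z.1).sub (.const _)).integrable _)
      ((integrable_const _).indicator hB) (Eventually.of_forall fun y => ?_)
    by_cases hy : y ∈ B
    · simp only [indicator_of_mem hy]; linarith [hBv y hy]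
    · simp only [indicator_of_notMem hy]; linarith [hmax (z.1 + y, z.2)]
  rw [integral_indicator_const _ hB, smul_eq_mul] at h2
  have := mul_le_mul_of_nonneg_right hΛ hv
  linarith

/-- A subsolution compactly supported in space cannot be large if the spatial jumps leave its
support at a large enough rate. -/
theorem le_of_subsolution (hW : BM W) (hW0 : ∀ z, 0 ≤ W z)
    (hR : ∀ z, R < ‖z.1‖ → W z = 0) (hWt : ∀ x, Continuous fun t => W (x, t))
    (hWlip : ∀ t, ∃ k, t ∈ lipTimes W k) (hK : 0 ≤ K) (hε₀ : 0 ≤ ε₀)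
    (H : ∀ z, ∀ η > 0, ∀ᶠ h in nhdsWithin 0 (Ioi 0),
      -(K * (W z + ε₀)) - η ≤ gen (J.full h) W z)
    {B : Set (En n)} (hB : MeasurableSet B) {Λ δ : ℝ} (hΛK : K < Λ) (hδ : 0 < δ)
    (hΛ : ∀ᶠ h in nhdsWithin 0 (Ioi 0), Λ ≤ (J.σ h).real B)
    (hsep : ∀ x t x' t' y, y ∈ B → W (x, t) ≠ 0 → ‖x' - x - y‖ < δ → W (x', t') = 0) (z : En n × ℝ) :
    W z ≤ K * ε₀ / (Λ - K) := by
  have hWx : ∀ t, Continuous fun x => W (x, t) := fun t => by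
    obtain ⟨k, hk⟩ := hWlip t
    exact (LipschitzWith.of_dist_le' (K := k) fun x y => by
      rw [Real.dist_eq, dist_eq_norm]; exact hk x y).continuous
  obtain ⟨C₀, hC₀⟩ := hW.bdd
  have hbdd : BddAbove (range W) := ⟨C₀, by
    rintro _ ⟨z, rfl⟩; exact (le_abs_self _).trans (hC₀ z)⟩
  set M := sSup (range W) with hM
  have hWM : ∀ z, W z ≤ M := fun z => le_csSup hbdd ⟨z, rfl⟩
  have hgood := exists_molSub hW hW0 hWM hR hWt hWx hWlip hK hε₀ H
  refine (hWM z).trans ?_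
  rw [le_div_iff₀ (by linarith)]
  by_contra! hcon
  have hM0 : 0 < M := by
    by_contra! h
    have h1 : 0 ≤ K * ε₀ := mul_nonneg hK hε₀
    have h2 : M * (Λ - K) ≤ 0 := mul_nonpos_of_nonpos_of_nonneg h (by linarith)
    linarith
  obtain ⟨C, hC0, hC⟩ := J.moment
  have hΛ0 : 0 < Λ := by linarith
  obtain ⟨μ, hμ0, hμ1, hμ2⟩ : ∃ μ > 0, μ * (1 + 2 * Λ + 4 * C) < M * (Λ - K) - K * ε₀ ∧
      4 * μ < M := by
    have hpos : 0 < M * (Λ - K) - K * ε₀ := by linarith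
    refine ⟨min ((M * (Λ - K) - K * ε₀) / (2 * (1 + 2 * Λ + 4 * C))) (M / 8), by positivity, ?_, ?_⟩
    · calc _ ≤ (M * (Λ - K) - K * ε₀) / (2 * (1 + 2 * Λ + 4 * C)) * (1 + 2 * Λ + 4 * C) := by
            gcongr; exact min_le_left _ _
        _ = (M * (Λ - K) - K * ε₀) / 2 := by field_simp
        _ < _ := by linarith
    · linarith [min_le_right ((M * (Λ - K) - K * ε₀) / (2 * (1 + 2 * Λ + 4 * C))) (M / 8)]
  obtain ⟨_, ⟨⟨x₁, t₁⟩, rfl⟩, hz₁⟩ := exists_lt_of_lt_csSup (range_nonempty W)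
    (show M - μ < sSup (range W) by linarith)
  -- uniform size of good neighbourhoods
  obtain ⟨d, hd, hdG⟩ : ∃ d > 0, ∀ t ∈ Icc (t₁ - 1) (t₁ + 1),
      MolSub J.full W (fun z => K * (W z + ε₀)) t d := by
    refine (isCompact_Icc (a := t₁ - 1) (b := t₁ + 1)).induction_on
      (p := fun S => ∃ d > 0, ∀ t ∈ S, MolSub J.full W (fun z => K * (W z + ε₀)) t d)
      ⟨1, one_pos, by simp⟩ ?_ ?_ ?_
    · rintro S S' hSS ⟨δ, hδ, h⟩
      exact ⟨δ, hδ, fun t ht => h t (hSS ht)⟩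
    · rintro S S' ⟨δ, hδ, h⟩ ⟨δ', hδ', h'⟩
      refine ⟨min δ δ', lt_min hδ hδ', fun t ht => ?_⟩
      rcases ht with ht | ht
      · exact (h t ht).mono (by simp)
      · exact (h' t ht).mono (by simp)
    · intro t _
      obtain ⟨ρ, hρ, hG⟩ := hgood t
      refine ⟨Metric.ball t (ρ / 2), mem_nhdsWithin_of_mem_nhds (Metric.ball_mem_nhds _ (by positivity)),
        ρ / 2, by positivity, fun s hs => hG.mono ?_⟩
      rw [Metric.mem_ball, Real.dist_eq] at hs
      linarith
  -- mollification
  obtain ⟨r, hr, hr'⟩ : ∃ r > 0, ∀ x, ‖x - x₁‖ < r → M - μ < W (x, t₁) := by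
    obtain ⟨r, hr, h⟩ := Metric.eventually_nhds_iff.1
      (((hWx t₁).tendsto x₁).eventually_const_lt hz₁)
    exact ⟨r, hr, fun x hx => h (by rwa [dist_eq_norm])⟩
  obtain ⟨φ, hφ⟩ := exists_bump (V := En n) (r := min r (min (δ / 2) 1)) (by positivity)
  have hφr : φ.rOut ≤ r := hφ ▸ min_le_left _ _
  have hφδ : φ.rOut ≤ δ / 2 := hφ ▸ (min_le_right _ _).trans (min_le_left _ _)
  have hφ1 : φ.rOut ≤ 1 := hφ ▸ (min_le_right _ _).trans (min_le_right _ _)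
  set V := avg (inX (moll φ)) W with hV
  have hVB : BM V := hW.avg
  have hV1 : M - μ ≤ V (x₁, t₁) := by
    refine le_avg_of_ae hW ((ae_inX_moll φ).mono fun ζ hζ => ?_)
    obtain ⟨y, s⟩ := ζ
    obtain ⟨hy, rfl⟩ : ‖y‖ < φ.rOut ∧ s = 0 := hζ
    simpa using (hr' (x₁ + y) (by simpa using hy.trans_le hφr)).le
  obtain ⟨d', hd', hclose⟩ := exists_mol_close hVB (continuous_avg_inX_moll hW hWt) hμ0
    ‖x₁‖ t₁ t₁
  obtain ⟨θ, hθ⟩ := exists_bump (V := ℝ) (r := min d d' / 2) (by positivity)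
  have hθ0 : θ.rOut < min d d' := by rw [hθ]; exact half_lt_self (by positivity)
  rw [lt_min_iff] at hθ0
  set w := avg (mol φ θ) W with hw
  have hwB : BM w := hW.avg
  have hwc : Continuous w := continuous_avg_mol hW
  have hwM : ∀ z, w z ≤ M := fun z => avg_le_of_ae hW (Eventually.of_forall fun ζ => hWM _)
  have hw1 : M - 2 * μ ≤ w (x₁, t₁) := by
    have h1 := abs_le.1 (hclose θ hθ0.2 x₁ t₁ le_rfl le_rfl le_rfl)
    rw [hw, avg_mol' hW]
    linarith [h1.1]
  have hwR : ∀ z, R + 1 < ‖z.1‖ → w z = 0 := fun z hz => by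
    refine integral_eq_zero_of_ae ((ae_mol φ θ).mono fun ζ hζ => hR _ ?_)
    show R < ‖z.1 + ζ.1‖
    have := norm_sub_norm_le z.1 (-ζ.1)
    rw [sub_neg_eq_add, norm_neg] at this
    linarith [hζ.1]
  have hwsep : ∀ z, w z ≠ 0 → ∀ y ∈ B, w (z.1 + y, z.2) = 0 := by
    intro z hz y hy
    obtain ⟨ζ, hζ, hζW⟩ : ∃ ζ : En n × ℝ, ‖ζ.1‖ < φ.rOut ∧ W (z + ζ) ≠ 0 := by
      by_contra! hno
      exact hz (integral_eq_zero_of_ae ((ae_mol φ θ).mono fun ζ hζ => hno ζ hζ.1))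
    refine integral_eq_zero_of_ae ((ae_mol φ θ).mono fun ζ' hζ' => ?_)
    refine hsep (z.1 + ζ.1) (z.2 + ζ.2) (z.1 + y + ζ'.1) (z.2 + ζ'.2) y hy hζW ?_
    rw [show z.1 + y + ζ'.1 - (z.1 + ζ.1) - y = ζ'.1 - ζ.1 by abel]
    exact (norm_sub_le _ _).trans_lt (by linarith [hζ'.1])
  set γ : ℝ → ℝ := fun t => min 1 |t - t₁| with hγ
  have hγB : BM γ := ⟨by fun_prop, 1, fun t => by
    rw [abs_of_nonneg (by positivity)]; exact min_le_left _ _⟩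
  have hγ0 : ∀ t, 0 ≤ γ t := fun t => by positivity
  have hγS : BM (fun z : En n × ℝ => γ z.2) := hγB.comp measurable_snd
  set D : En n × ℝ → ℝ := fun z => w z - 4 * μ * γ z.2 with hD
  have hDB : BM D := hwB.sub (hγS.const_mul _)
  have hDc : Continuous D := hwc.sub (by fun_prop)
  have hD1 : M - 2 * μ ≤ D (x₁, t₁) := by simpa [hD, hγ] using hw1
  set Kc : Set (En n × ℝ) := Metric.closedBall 0 (R + 1) ×ˢ Icc (t₁ - 1) (t₁ + 1) with hKc
  have hKout : ∀ z, z ∉ Kc → D z < M - 2 * μ := by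
    intro z hz
    have h4 : 0 ≤ 4 * μ * γ z.2 := mul_nonneg (by positivity) (hγ0 _)
    by_cases h1 : ‖z.1‖ ≤ R + 1
    · have h2 : 1 ≤ |z.2 - t₁| := by
        by_contra! h3
        rw [abs_lt] at h3
        exact hz ⟨by simpa using h1, by linarith, by linarith⟩
      have h3 : γ z.2 = 1 := min_eq_left h2
      have h5 := hwM z
      simp only [hD, h3]; linarith
    · push Not at h1
      have h2 := hwR z h1
      simp only [hD, h2]; linarith
  have hKcomp : IsCompact Kc := (isCompact_closedBall _ _).prod isCompact_Icc
  have hz₁K : (x₁, t₁) ∈ Kc := by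
    by_contra h; linarith [hKout _ h]
  obtain ⟨z₂, hz₂K, hz₂max⟩ := hKcomp.exists_isMaxOn ⟨_, hz₁K⟩ hDc.continuousOn
  have hD2 : M - 2 * μ ≤ D z₂ := hD1.trans (hz₂max hz₁K)
  have hglob : ∀ z, D z ≤ D z₂ := fun z => by
    by_cases h : z ∈ Kc
    · exact hz₂max h
    · exact (hKout z h).le.trans hD2
  have hw2 : M - 2 * μ ≤ w z₂ := by
    have h4 : 0 ≤ 4 * μ * γ z₂.2 := mul_nonneg (by positivity) (hγ0 _)
    simp only [hD] at hD2; linarith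
  have hw2' : w z₂ ≠ 0 := by intro h; linarith
  -- contradiction at the maximum
  have ev := hdG z₂.2 hz₂K.2 φ θ hθ0.1 z₂.1 z₂.2 (by simpa using hd) μ hμ0
  have ev2 : ∀ᶠ h in nhdsWithin (0 : ℝ) (Ioi 0), 0 < h ∧ h < 1 := Ioo_mem_nhdsGT one_pos
  obtain ⟨h, ⟨e1, e2⟩, e3⟩ := ((ev.and hΛ).and ev2).exists
  have f1 : gen (J.full h) D z₂ ≤ -(Λ * (M - 2 * μ)) := by
    refine gen_full_le_of_jumps hDB hglob hB (by linarith) (fun y hy => ?_) e2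
    have := hwsep z₂ hw2' y hy
    simp only [hD, this]; linarith
  have f2 : gen (J.full h) D z₂ = gen (J.full h) w z₂ - 4 * μ * gen (J.ν h) γ z₂.2 := by
    rw [hD, gen_sub hwB (hγS.const_mul _), gen_const_mul, gen_full hγS]
    simp only [gen_const, zero_add]
  have f3 : gen (J.ν h) γ z₂.2 ≤ C := by
    have hmin : BM (fun τ : ℝ => min 1 |τ|) := ⟨by fun_prop, 1, fun τ => by
      rw [abs_of_nonneg (by positivity)]; exact min_le_left _ _⟩
    refine le_trans (integral_mono_ae ((((hγB).translate z₂.2).sub (.const _)).integrable _)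
      (hmin.integrable _) (Eventually.of_forall fun τ => ?_)) (hC h e3.1 e3.2)
    show min 1 |z₂.2 + τ - t₁| - min 1 |z₂.2 - t₁| ≤ min 1 |τ|
    have h1 : |z₂.2 + τ - t₁| ≤ |z₂.2 - t₁| + |τ| := by
      rw [show z₂.2 + τ - t₁ = (z₂.2 - t₁) + τ by ring]; exact abs_add_le _ _
    have h2 := abs_nonneg (z₂.2 - t₁)
    have h3 := abs_nonneg τ
    rcases le_total 1 |z₂.2 - t₁| with h4 | h4 <;> rcases le_total 1 |τ| with h5 | h5 <;>
      simp only [min_eq_left, min_eq_right, h4, h5] <;>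
      linarith [min_le_left 1 |z₂.2 + τ - t₁|, min_le_right 1 |z₂.2 + τ - t₁|]
  have f4 : avg (mol φ θ) (fun z => K * (W z + ε₀)) z₂ ≤ K * (M + ε₀) :=
    avg_le_of_ae ((hW.add (.const _)).const_mul _) (Eventually.of_forall fun ζ => by
      have := hWM (z₂ + ζ); gcongr)
  have e1' : -avg (mol φ θ) (fun z => K * (W z + ε₀)) z₂ - μ ≤ gen (J.full h) w z₂ := e1
  have f5 : 4 * μ * gen (J.ν h) γ z₂.2 ≤ 4 * μ * C := by gcongr
  linarith

end JumpFamily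

end MaximumPrinciple

section SecondDifferences

theorem abs_second_diff_sub_le {k k' k'' : ℝ → ℝ} {h c ε : ℝ} (hh : 0 ≤ h)
    (hk : ∀ r ∈ Icc (-h) h, HasDerivAt k (k' r) r)
    (hk' : ∀ r ∈ Icc (-h) h, HasDerivAt k' (k'' r) r)
    (hc : ∀ r ∈ Icc (-h) h, |k'' r - c| ≤ ε) :
    |k h + k (-h) - 2 * k 0 - c * h ^ 2| ≤ 2 * ε * h ^ 2 := by
  have hε : 0 ≤ ε := (abs_nonneg _).trans (hc 0 ⟨by linarith, hh⟩)
  have h1 : ∀ r ∈ Icc 0 h, |k' r - k' (-r) - 2 * c * r| ≤ 2 * ε * h := by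
    intro r hr
    have := (convex_Icc (-h) h).norm_image_sub_le_of_norm_hasDerivWithin_le
      (f := fun r => k' r - c * r) (f' := fun r => k'' r - c) (C := ε) (x := -r) (y := r)
      (fun x hx => ((hk' x hx).sub
        (by simpa using (hasDerivAt_id x).const_mul c)).hasDerivWithinAt)
      hc ⟨by linarith [hr.2], by linarith [hr.1, hr.2]⟩ ⟨by linarith [hr.1], hr.2⟩
    rw [Real.norm_eq_abs, Real.norm_eq_abs, abs_of_nonneg (by linarith [hr.1] : 0 ≤ r - -r)] at this
    have e : k' r - k' (-r) - 2 * c * r = k' r - c * r - (k' (-r) - c * -r) := by ring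
    rw [e]
    nlinarith [hr.2]
  have := (convex_Icc 0 h).norm_image_sub_le_of_norm_hasDerivWithin_le
    (f := fun r => k r + k (-r) - c * r ^ 2) (f' := fun r => k' r - k' (-r) - 2 * c * r)
    (C := 2 * ε * h) (x := 0) (y := h) (fun x hx => by
      have a := hk x ⟨by linarith [hx.1], hx.2⟩
      have b := (hk (-x) ⟨by linarith [hx.2], by linarith [hx.1, hx.2]⟩).comp x
        (hasDerivAt_neg x)
      have d := (hasDerivAt_pow 2 x).const_mul c
      refine (((a.add b).sub d).congr_deriv ?_).hasDerivWithinAt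
      norm_num
      ring) h1 ⟨le_rfl, hh⟩ ⟨hh, le_rfl⟩
  rw [Real.norm_eq_abs, Real.norm_eq_abs, sub_zero, abs_of_nonneg hh] at this
  have e : k h + k (-h) - 2 * k 0 - c * h ^ 2 =
      k h + k (-h) - c * h ^ 2 - (k 0 + k (-0) - c * 0 ^ 2) := by
    rw [neg_zero]; ring
  rw [e]
  linarith

theorem abs_diff_sub_le {k k' : ℝ → ℝ} {h c ε : ℝ} (hh : 0 ≤ h)
    (hk : ∀ r ∈ Icc (-h) h, HasDerivAt k (k' r) r)
    (hc : ∀ r ∈ Icc (-h) h, |k' r - c| ≤ ε) :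
    |k (-h) - k 0 + c * h| ≤ ε * h := by
  have := (convex_Icc (-h) h).norm_image_sub_le_of_norm_hasDerivWithin_le
    (f := fun r => k r - c * r) (f' := fun r => k' r - c) (C := ε) (x := 0) (y := -h)
    (fun x hx => ((hk x hx).sub
      (by simpa using (hasDerivAt_id x).const_mul c)).hasDerivWithinAt)
    hc ⟨by linarith, hh⟩ ⟨le_rfl, by linarith⟩
  rw [Real.norm_eq_abs, Real.norm_eq_abs, sub_zero, abs_neg, abs_of_nonneg hh] at this
  have e : k (-h) - k 0 + c * h = k (-h) - c * -h - (k 0 - c * 0) := by ring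
  rw [e]
  exact this

variable {V : Type*} [NormedAddCommGroup V] [NormedSpace ℝ V]

/-- Second difference of `f` at `x` with increment `y`. -/
def sdiff2 (f : V → ℝ) (x y : V) : ℝ := f (x + y) + f (x - y) - 2 * f x

theorem hasDerivAt_line {E : Type*} [NormedAddCommGroup E] [NormedSpace ℝ E] {f : V → E}
    {f' : V →L[ℝ] E} {x y : V} {r : ℝ} (hf : HasFDerivAt f f' (x + r • y)) :
    HasDerivAt (fun r : ℝ => f (x + r • y)) (f' y) r := by
  have h1 : HasDerivAt (fun r : ℝ => x + r • y) y r := by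
    simpa using ((hasDerivAt_id r).smul_const y).const_add x
  exact hf.comp_hasDerivAt r h1

variable {D : V → V →L[ℝ] ℝ} {D2 : V → V →L[ℝ] V →L[ℝ] ℝ} {f : V → ℝ}

/-- Second order Taylor estimate for second differences. -/
theorem abs_sdiff2_sub_le {x y : V} {ε c : ℝ} {h : ℝ} (hh : 0 ≤ h)
    (hD : ∀ r ∈ Icc (-h) h, HasFDerivAt f (D (x + r • y)) (x + r • y))
    (hD2 : ∀ r ∈ Icc (-h) h, HasFDerivAt D (D2 (x + r • y)) (x + r • y))
    (hT : ∀ r ∈ Icc (-h) h, |D2 (x + r • y) y y - c| ≤ ε) :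
    |sdiff2 f x (h • y) - c * h ^ 2| ≤ 2 * ε * h ^ 2 := by
  have := abs_second_diff_sub_le (k := fun r => f (x + r • y)) (k' := fun r => D (x + r • y) y)
    (k'' := fun r => D2 (x + r • y) y y) (c := c) (ε := ε) hh
    (fun r hr => hasDerivAt_line (hD r hr))
    (fun r hr => by
      simpa using (hasDerivAt_line (hD2 r hr)).clm_apply (hasDerivAt_const r y)) hT
  simpa [sdiff2, sub_eq_add_neg] using this

end SecondDifferences

section MollifiedDifferences

theorem exists_modulus {V E : Type*} [NormedAddCommGroup V] [NormedAddCommGroup E] {D : V → E}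
    (hD : HasCompactSupport D) (hc : Continuous D) {ε : ℝ} (hε : 0 < ε) :
    ∃ d > 0, ∀ x y, ‖y‖ < d → ‖D (x + y) - D x‖ ≤ ε := by
  obtain ⟨d, hd, H⟩ := Metric.uniformContinuous_iff.1 (hD.uniformContinuous_of_continuous hc) ε hε
  refine ⟨d, hd, fun x y hy => ?_⟩
  rw [← dist_eq_norm]
  exact (H (by rwa [dist_eq_norm, add_sub_cancel_left])).le

theorem exists_norm_bound {V E : Type*} [NormedAddCommGroup V] [NormedAddCommGroup E] {D : V → E}
    (hD : HasCompactSupport D) (hc : Continuous D) : ∃ C, 0 ≤ C ∧ ∀ x, ‖D x‖ ≤ C := by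
  obtain ⟨C, hC⟩ := hc.bounded_above_of_compact_support hD
  exact ⟨C, (norm_nonneg _).trans (hC 0), hC⟩

variable {V : Type*} [NormedAddCommGroup V] [NormedSpace ℝ V] [HasContDiffBump V]
  [FiniteDimensional ℝ V] [MeasureSpace V] [BorelSpace V]
  [Measure.IsAddHaarMeasure (volume : Measure V)] (φ : ContDiffBump (0 : V))

theorem normed_eq_zero {x : V} (hx : φ.rOut ≤ ‖x‖) : φ.normed volume x = 0 := by
  by_contra h
  have h' : x ∈ Function.support (φ.normed (volume : Measure V)) := h
  rw [φ.support_normed_eq] at h'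
  exact absurd hx (not_le.2 (by simpa using h'))

theorem abs_integral_kernel_le {κ f : V → ℝ} {c R : ℝ} (hκ : ∀ w, |κ w| ≤ c)
    (h0 : ∀ w, R ≤ ‖w‖ → κ w = 0) (h1 : ∀ z, |f z| ≤ 1) (x : V) :
    |∫ w, κ (w - x) * f w| ≤ c * volume.real (Metric.ball (0 : V) R) := by
  have hz : ∀ w, w ∉ Metric.ball x R → κ (w - x) * f w = 0 := fun w hw => by
    rw [h0 _ (by simpa [dist_eq_norm] using hw), zero_mul]
  rw [← setIntegral_eq_integral_of_forall_compl_eq_zero hz, ← Real.norm_eq_abs]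
  have e : volume.real (Metric.ball (0 : V) R) = volume.real (Metric.ball x R) := by
    rw [measureReal_def, measureReal_def, Measure.addHaar_ball_center volume x]
  rw [e]
  refine norm_setIntegral_le_of_norm_le_const measure_ball_lt_top fun w _ => ?_
  rw [norm_mul]
  exact (mul_le_of_le_one_right (norm_nonneg _) (h1 w)).trans (hκ _)

theorem sdiff2_avg_moll {f : V → ℝ} (hf : Measurable f) (h1 : ∀ z, |f z| ≤ 1) (x y : V) :
    sdiff2 (avg (moll φ) f) x y = ∫ w, sdiff2 (φ.normed volume) (w - x) y * f w := by
  have I := fun x => integrable_mul_of_abs_le_one (integrable_normed_sub φ x) hf h1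
  rw [sdiff2, avg_moll', avg_moll', avg_moll', ← integral_const_mul, ← integral_add (I _) (I _),
    ← integral_sub (f := fun w => φ.normed volume (w - (x + y)) * f w +
        φ.normed volume (w - (x - y)) * f w) (g := fun w => 2 * (φ.normed volume (w - x) * f w))
      ((I (x + y)).add (I (x - y))) ((I x).const_mul 2)]
  refine integral_congr_ae (Eventually.of_forall fun w => ?_)
  simp only [sdiff2]
  rw [show w - (x + y) = w - x - y by abel, show w - (x - y) = w - x + y by abel]
  ring

theorem sdiff2_normed_eq_zero {w y : V} {R : ℝ} (hy : ‖y‖ ≤ R) (hw : φ.rOut + R ≤ ‖w‖) :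
    sdiff2 (φ.normed volume) w y = 0 := by
  have a := norm_sub_norm_le w (-y)
  have b := norm_sub_norm_le w y
  rw [norm_neg, sub_neg_eq_add] at a
  rw [sdiff2, normed_eq_zero φ (by linarith), normed_eq_zero φ (by linarith),
    normed_eq_zero φ (by linarith [norm_nonneg y])]
  simp

theorem hasFDerivAt_normed (x : V) :
    HasFDerivAt (φ.normed volume) (fderiv ℝ (φ.normed volume) x) x :=
  ((φ.contDiff_normed (μ := volume) (n := 1)).differentiable (by simp) x).hasFDerivAt

theorem contDiff_fderiv_normed : ContDiff ℝ 1 (fderiv ℝ (φ.normed (volume : Measure V))) :=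
  (φ.contDiff_normed (μ := volume) (n := 2)).fderiv_right (by norm_num)

theorem hasFDerivAt_fderiv_normed (x : V) :
    HasFDerivAt (fderiv ℝ (φ.normed volume)) (fderiv ℝ (fderiv ℝ (φ.normed volume)) x) x :=
  ((contDiff_fderiv_normed φ).differentiable (by simp) x).hasFDerivAt

theorem continuous_fderiv2_normed :
    Continuous (fderiv ℝ (fderiv ℝ (φ.normed (volume : Measure V)))) :=
  (contDiff_fderiv_normed φ).continuous_fderiv (by simp)

theorem hasCompactSupport_fderiv2_normed :
    HasCompactSupport (fderiv ℝ (fderiv ℝ (φ.normed (volume : Measure V)))) :=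
  (φ.hasCompactSupport_normed.fderiv ℝ).fderiv ℝ

theorem exists_fderiv2_normed_le :
    ∃ C, 0 ≤ C ∧ ∀ x, ‖fderiv ℝ (fderiv ℝ (φ.normed (volume : Measure V))) x‖ ≤ C := by
  have h := hasCompactSupport_fderiv2_normed φ
  have h2 := continuous_fderiv2_normed φ
  set D2 := fderiv ℝ (fderiv ℝ (φ.normed (volume : Measure V)))
  clear_value D2
  exact exists_norm_bound (E := V →L[ℝ] V →L[ℝ] ℝ) h h2

theorem exists_fderiv2_normed_modulus (z : V) {ε : ℝ} (hε : 0 < ε) : ∃ d > 0, ∀ x y, ‖y‖ < d →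
    |fderiv ℝ (fderiv ℝ (φ.normed (volume : Measure V))) (x + y) z z -
      fderiv ℝ (fderiv ℝ (φ.normed (volume : Measure V))) x z z| ≤ ε := by
  refine exists_modulus (E := ℝ)
    (D := fun x => fderiv ℝ (fderiv ℝ (φ.normed (volume : Measure V))) x z z) ?_ ?_ hε
  · exact (hasCompactSupport_fderiv2_normed φ).comp_left
      (g := fun T : V →L[ℝ] V →L[ℝ] ℝ => T z z) (by simp)
  · have := continuous_fderiv2_normed φ
    fun_prop

theorem exists_sdiff2_avg_moll_le : ∃ L : ℝ, 0 ≤ L ∧ ∀ f : V → ℝ, Measurable f →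
    (∀ z, |f z| ≤ 1) → ∀ x y, ‖y‖ ≤ 1 → |sdiff2 (avg (moll φ) f) x y| ≤ L * ‖y‖ ^ 2 := by
  obtain ⟨C, hC0, hC⟩ := exists_fderiv2_normed_le φ
  set v := volume.real (Metric.ball (0 : V) (φ.rOut + 1))
  refine ⟨2 * C * v, by positivity, fun f hf h1 x y hy => ?_⟩
  rw [sdiff2_avg_moll φ hf h1]
  refine (abs_integral_kernel_le (κ := fun w => sdiff2 (φ.normed volume) w y)
    (c := 2 * C * ‖y‖ ^ 2) (fun w => ?_) (fun w => sdiff2_normed_eq_zero φ hy) h1 x).trans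
    (le_of_eq (by ring))
  have := abs_sdiff2_sub_le (f := φ.normed volume) (D := fderiv ℝ (φ.normed volume))
    (D2 := fderiv ℝ (fderiv ℝ (φ.normed volume))) (x := w) (y := y) (c := 0) (ε := C * ‖y‖ ^ 2)
    (h := 1) zero_le_one (fun r _ => hasFDerivAt_normed φ _)
    (fun r _ => hasFDerivAt_fderiv_normed φ _)
    (fun r _ => by
      rw [sub_zero, ← Real.norm_eq_abs, sq, ← mul_assoc]
      exact ContinuousLinearMap.le_of_opNorm₂_le_of_le _ (hC _) le_rfl le_rfl)
  rw [one_smul] at this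
  simpa [mul_assoc] using this

theorem exists_sdiff2_quotient_cauchy (y : V) (hy : ‖y‖ ≤ 1) {ε : ℝ} (hε : 0 < ε) : ∃ h₁ > 0,
    ∀ h h', 0 < h → h < h₁ → 0 < h' → h' < h₁ → ∀ f : V → ℝ, Measurable f → (∀ z, |f z| ≤ 1) →
    ∀ x, |(h ^ 2)⁻¹ * sdiff2 (avg (moll φ) f) x (h • y) -
      (h' ^ 2)⁻¹ * sdiff2 (avg (moll φ) f) x (h' • y)| ≤ ε := by
  set v := volume.real (Metric.ball (0 : V) (φ.rOut + 1))
  set ε' := ε / (4 * (v + 1))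
  have hv : 0 ≤ v := measureReal_nonneg
  have hε' : 0 < ε' := by positivity
  set D2 := fderiv ℝ (fderiv ℝ (φ.normed (volume : Measure V)))
  obtain ⟨d, hd, H⟩ := exists_fderiv2_normed_modulus φ y hε'
  have key : ∀ h, 0 < h → h < min d 1 → ∀ w,
      |(h ^ 2)⁻¹ * sdiff2 (φ.normed volume) w (h • y) - D2 w y y| ≤ 2 * ε' := by
    intro h h0 hd' w
    have := abs_sdiff2_sub_le (f := φ.normed volume) (D := fderiv ℝ (φ.normed volume))
      (D2 := D2) (x := w) (y := y) (c := D2 w y y) (ε := ε') h0.le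
      (fun r _ => hasFDerivAt_normed φ _) (fun r _ => hasFDerivAt_fderiv_normed φ _)
      (fun r hr => by
        refine H w (r • y) ?_
        rw [norm_smul, Real.norm_eq_abs]
        have : |r| ≤ h := abs_le.2 hr
        calc |r| * ‖y‖ ≤ h * 1 := by gcongr
          _ < d := by linarith [min_le_left d 1])
    have h2 : (h ^ 2)⁻¹ * sdiff2 (φ.normed volume) w (h • y) - D2 w y y =
        (h ^ 2)⁻¹ * (sdiff2 (φ.normed volume) w (h • y) - D2 w y y * h ^ 2) := by
      field_simp
    rw [h2, abs_mul, abs_of_pos (by positivity), inv_mul_le_iff₀ (by positivity)]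
    linarith
  refine ⟨min d 1, by positivity, fun h h' a1 a2 a3 a4 f hf h1 x => ?_⟩
  have hz : ∀ h, 0 < h → h < min d 1 → ‖h • y‖ ≤ 1 := fun h h0 hd' => by
    rw [norm_smul, Real.norm_eq_abs, abs_of_pos h0]
    exact mul_le_one₀ (by linarith [min_le_right d 1]) (norm_nonneg _) hy
  have I : ∀ y, Integrable fun w => sdiff2 (φ.normed volume) (w - x) y * f w := fun y => by
    refine integrable_mul_of_abs_le_one ?_ hf h1
    have i := φ.integrable_normed (μ := (volume : Measure V))
    exact (((i.comp_add_right y).add (i.comp_sub_right y)).sub (i.const_mul 2)).comp_sub_right x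
  rw [sdiff2_avg_moll φ hf h1, sdiff2_avg_moll φ hf h1, ← integral_const_mul, ← integral_const_mul,
    ← integral_sub ((I _).const_mul _) ((I _).const_mul _)]
  simp only [← mul_assoc, ← sub_mul]
  refine (abs_integral_kernel_le (κ := fun w => (h ^ 2)⁻¹ * sdiff2 (φ.normed volume) w (h • y) -
    (h' ^ 2)⁻¹ * sdiff2 (φ.normed volume) w (h' • y)) (c := 4 * ε') (R := φ.rOut + 1) (fun w => ?_)
    (fun w hw => ?_) h1 x).trans ?_
  · have e1 := abs_le.1 (key h a1 a2 w)
    have e2 := abs_le.1 (key h' a3 a4 w)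
    exact abs_le.2 ⟨by linarith [e1.1, e2.2], by linarith [e1.2, e2.1]⟩
  · rw [sdiff2_normed_eq_zero φ (hz h a1 a2) hw, sdiff2_normed_eq_zero φ (hz h' a3 a4) hw]
    simp
  · have : 4 * ε' * v = ε * (v / (v + 1)) := by simp only [ε']; field_simp
    rw [this]
    exact mul_le_of_le_one_right hε.le ((div_le_one (by positivity)).2 (by linarith))

end MollifiedDifferences

theorem exists_diff_quotient_cauchy (θ : ContDiffBump (0 : ℝ)) {ε : ℝ} (hε : 0 < ε) : ∃ h₁ > 0,
    ∀ h h', 0 < h → h < h₁ → 0 < h' → h' < h₁ → ∀ f : ℝ → ℝ, Measurable f → (∀ z, |f z| ≤ 1) →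
    ∀ t, |h⁻¹ * (avg (moll θ) f (t + -h) - avg (moll θ) f t) -
      h'⁻¹ * (avg (moll θ) f (t + -h') - avg (moll θ) f t)| ≤ ε := by
  set v := volume.real (Metric.ball (0 : ℝ) (θ.rOut + 1))
  set ε' := ε / (2 * (v + 1))
  have hv : 0 ≤ v := measureReal_nonneg
  have hε' : 0 < ε' := by positivity
  set χ := θ.normed (volume : Measure ℝ)
  have hχ : ContDiff ℝ 1 χ := θ.contDiff_normed (n := 1)
  obtain ⟨d, hd, H⟩ := Metric.uniformContinuous_iff.1
    ((θ.hasCompactSupport_normed (μ := volume)).deriv.uniformContinuous_of_continuous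
      (hχ.continuous_deriv le_rfl)) ε' hε'
  have key : ∀ h, 0 < h → h < min d 1 → ∀ w,
      |h⁻¹ * (χ (w + h) - χ w) - deriv χ w| ≤ ε' := by
    intro h h0 hd' w
    have := abs_diff_sub_le (k := fun r => χ (w - r)) (k' := fun r => - deriv χ (w - r))
      (c := - deriv χ w) (ε := ε') h0.le
      (fun r _ => by
        simpa using ((hχ.differentiable (by simp) (w - r)).hasDerivAt).comp_const_sub w r)
      (fun r hr => by
        have : |r| ≤ h := abs_le.2 hr
        rw [neg_sub_neg, abs_sub_comm, ← Real.dist_eq]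
        refine (H ?_).le
        rw [Real.dist_eq, sub_sub_cancel_left, abs_neg]
        linarith [min_le_left d 1])
    have h2 : h⁻¹ * (χ (w + h) - χ w) - deriv χ w =
        h⁻¹ * (χ (w - -h) - χ (w - 0) + -deriv χ w * h) := by
      rw [sub_neg_eq_add, sub_zero]; field_simp; ring
    rw [h2, abs_mul, abs_of_pos (by positivity), inv_mul_le_iff₀ (by positivity)]
    linarith
  refine ⟨min d 1, by positivity, fun h h' a1 a2 a3 a4 f hf h1 t => ?_⟩
  have I := fun x => integrable_mul_of_abs_le_one (integrable_normed_sub θ x) hf h1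
  have e : ∀ h, h⁻¹ * (avg (moll θ) f (t + -h) - avg (moll θ) f t) =
      ∫ w, h⁻¹ * ((χ (w - t + h) - χ (w - t)) * f w) := by
    intro h
    rw [avg_moll', avg_moll', ← integral_sub (I _) (I _), ← integral_const_mul]
    refine integral_congr_ae (Eventually.of_forall fun w => ?_)
    simp only [χ]
    rw [show w - (t + -h) = w - t + h by ring]
    ring
  have I' : ∀ h, Integrable fun w => h⁻¹ * ((χ (w - t + h) - χ (w - t)) * f w) := by
    intro h
    refine Integrable.const_mul ?_ _
    refine ((I (t + -h)).sub (I t)).congr (Eventually.of_forall fun w => ?_)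
    simp only [Pi.sub_apply, χ]
    rw [show w - (t + -h) = w - t + h by ring]
    ring
  rw [e, e, ← integral_sub (I' _) (I' _)]
  simp only [← mul_assoc, ← sub_mul]
  refine (abs_integral_kernel_le (κ := fun w => h⁻¹ * (χ (w + h) - χ w) -
    h'⁻¹ * (χ (w + h') - χ w)) (c := 2 * ε') (R := θ.rOut + 1) (fun w => ?_)
    (fun w hw => ?_) h1 t).trans ?_
  · have e1 := abs_le.1 (key h a1 a2 w)
    have e2 := abs_le.1 (key h' a3 a4 w)
    exact abs_le.2 ⟨by linarith [e1.1, e2.2], by linarith [e1.2, e2.1]⟩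
  · have hz : ∀ h, 0 ≤ h → h < 1 → χ (w + h) = 0 := fun h h0 hd' => by
      refine normed_eq_zero θ ?_
      have := norm_sub_norm_le w (-h)
      rw [norm_neg, sub_neg_eq_add, Real.norm_of_nonneg h0] at this
      linarith
    have := hz 0 le_rfl one_pos
    rw [add_zero] at this
    rw [this, hz h a1.le (by linarith [min_le_right d 1]),
      hz h' a3.le (by linarith [min_le_right d 1])]
    simp
  · have : 2 * ε' * v = ε * (v / (v + 1)) := by simp only [ε']; field_simp
    rw [this]
    exact mul_le_of_le_one_right hε.le ((div_le_one (by positivity)).2 (by linarith))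

section LevyMeasures

/-- The restriction of `ρ` to jumps of size at least `h`. -/
def trunc {V : Type*} [NormedAddCommGroup V] [MeasurableSpace V] (ρ : Measure V) (h : ℝ) :
    Measure V :=
  ρ.restrict {y | 0 < h ∧ h ≤ ‖y‖}

variable {V : Type*} [NormedAddCommGroup V] [MeasurableSpace V] [BorelSpace V]
  {ρ : Measure V} {p : ℕ}

theorem measurableSet_trunc (h : ℝ) : MeasurableSet {y : V | 0 < h ∧ h ≤ ‖y‖} :=
  (MeasurableSet.const _).inter (measurableSet_le measurable_const measurable_norm)

theorem isFiniteMeasure_trunc (hρ : Integrable (fun y => min 1 (‖y‖ ^ p)) ρ) (h : ℝ) :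
    IsFiniteMeasure (trunc ρ h) := by
  refine ⟨?_⟩
  rw [trunc, Measure.restrict_apply MeasurableSet.univ, univ_inter]
  by_cases h0 : 0 < h
  · refine lt_of_le_of_lt (measure_mono fun y hy => ?_)
      (hρ.measure_norm_ge_lt_top (ε := min 1 (h ^ p)) (by positivity))
    have : 0 ≤ min 1 (‖y‖ ^ p) := by positivity
    simp only [Set.mem_ofPred_eq, Real.norm_of_nonneg this]
    exact min_le_min_left _ (pow_le_pow_left₀ h0.le hy.2 _)
  · simp [h0]

theorem measurableSet_shell (a b : ℝ) : MeasurableSet {y : V | a ≤ ‖y‖ ∧ ‖y‖ < b} :=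
  (measurableSet_le measurable_const measurable_norm).inter
    (measurableSet_lt measurable_norm measurable_const)

theorem trunc_eq_add {a b : ℝ} (ha : 0 < a) (hab : a ≤ b) :
    trunc ρ a = trunc ρ b + ρ.restrict {y | a ≤ ‖y‖ ∧ ‖y‖ < b} := by
  rw [trunc, trunc, ← Measure.restrict_union _ (measurableSet_shell a b)]
  · congr 1
    ext y
    simp only [Set.mem_ofPred_eq, mem_union, ha, ha.trans_le hab, true_and]
    constructor
    · intro h
      by_cases hb : b ≤ ‖y‖
      · exact Or.inl hb
      · exact Or.inr ⟨h, not_le.1 hb⟩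
    · rintro (h | h)
      · exact hab.trans h
      · exact h.1
  · rw [Set.disjoint_left]
    exact fun y h1 h2 => absurd h1.2 (not_le.2 h2.2)

theorem isFiniteMeasure_shell (hρ : Integrable (fun y => min 1 (‖y‖ ^ p)) ρ) {a b : ℝ}
    (ha : 0 < a) : IsFiniteMeasure (ρ.restrict {y | a ≤ ‖y‖ ∧ ‖y‖ < b}) := by
  have := isFiniteMeasure_trunc hρ a
  have h : {y : V | a ≤ ‖y‖ ∧ ‖y‖ < b} ⊆ {y | 0 < a ∧ a ≤ ‖y‖} := fun y hy => ⟨ha, hy.1⟩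
  exact isFiniteMeasure_of_le (trunc ρ a) (Measure.restrict_mono h le_rfl)

theorem tendsto_shell_integral (hρ : Integrable (fun y => min 1 (‖y‖ ^ p)) ρ) :
    Tendsto (fun b : ℝ => ∫ y in {y | 0 < ‖y‖ ∧ ‖y‖ < b}, min 1 (‖y‖ ^ p) ∂ρ)
      (nhdsWithin 0 (Ioi 0)) (nhds 0) := by
  have hm : ∀ b : ℝ, MeasurableSet {y : V | 0 < ‖y‖ ∧ ‖y‖ < b} := fun b =>
    (measurableSet_lt measurable_const measurable_norm).inter
      (measurableSet_lt measurable_norm measurable_const)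
  simp_rw [← integral_indicator (hm _)]
  have e : nhds (0 : ℝ) = nhds (∫ _ : V, (0 : ℝ) ∂ρ) := by rw [integral_zero]
  rw [e]
  refine tendsto_integral_filter_of_dominated_convergence (fun y => min 1 (‖y‖ ^ p))
    (Eventually.of_forall fun b => hρ.aestronglyMeasurable.indicator (hm b))
    (Eventually.of_forall fun b => Eventually.of_forall fun y => ?_) hρ
    (Eventually.of_forall fun y => ?_)
  · refine (norm_indicator_le_norm_self _ _).trans (le_of_eq ?_)
    exact Real.norm_of_nonneg (by positivity)
  · rcases (norm_nonneg y).eq_or_lt with h | h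
    · refine tendsto_const_nhds.congr fun b => ?_
      rw [indicator_of_notMem fun hy => hy.1.ne h]
    · refine tendsto_const_nhds.congr' ?_
      filter_upwards [Ioo_mem_nhdsGT h] with b hb
      rw [indicator_of_notMem fun hy => (hy.2.trans hb.2).false]

theorem setIntegral_shell_le (hρ : Integrable (fun y => min 1 (‖y‖ ^ p)) ρ) {a b : ℝ}
    (ha : 0 < a) (hb : b ≤ 1) : ∫ y in {y | a ≤ ‖y‖ ∧ ‖y‖ < b}, ‖y‖ ^ p ∂ρ ≤
      ∫ y in {y | 0 < ‖y‖ ∧ ‖y‖ < b}, min 1 (‖y‖ ^ p) ∂ρ := by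
  rw [setIntegral_congr_fun (g := fun y => min 1 (‖y‖ ^ p)) (measurableSet_shell a b) fun y hy =>
    (min_eq_right (pow_le_one₀ (norm_nonneg _) (hy.2.le.trans hb))).symm]
  exact setIntegral_mono_set hρ.integrableOn (Eventually.of_forall fun y => by positivity)
    (LE.le.eventuallyLE fun y hy => ⟨ha.trans_le hy.1, hy.2⟩)

/-- Truncations of a Lévy measure are nice if the generators of its restrictions to shells are
controlled by the `p`-th moments. -/
theorem nice_trunc {M : Measure V} [SecondCountableTopology V] [IsFiniteMeasure M]
    (hρ : Integrable (fun y => min 1 (‖y‖ ^ p)) ρ) {L : ℝ}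
    (hL : 0 ≤ L) (H : ∀ f : V → ℝ, Measurable f → (∀ z, |f z| ≤ 1) → ∀ a b, 0 < a → b ≤ 1 → ∀ x,
      |gen (ρ.restrict {y | a ≤ ‖y‖ ∧ ‖y‖ < b}) (avg M f) x| ≤
        L * ∫ y in {y | a ≤ ‖y‖ ∧ ‖y‖ < b}, ‖y‖ ^ p ∂ρ) :
    Nice (trunc ρ) M := by
  intro ε hε
  have hlim := (tendsto_shell_integral hρ).const_mul L
  rw [mul_zero] at hlim
  obtain ⟨u, hu, hu'⟩ := (mem_nhdsGT_iff_exists_Ioo_subset).1 (hlim.eventually_le_const hε)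
  have hu : 0 < u := hu
  have key : ∀ a b, 0 < a → a ≤ b → b < min u 1 → ∀ f : V → ℝ, Measurable f → (∀ z, |f z| ≤ 1) →
      ∀ z, |gen (trunc ρ a) (avg M f) z - gen (trunc ρ b) (avg M f) z| ≤ ε := by
    intro a b ha hab hb f hf h1 z
    have := isFiniteMeasure_trunc hρ b
    have := isFiniteMeasure_shell hρ (b := b) ha
    have hb1 : b ≤ 1 := hb.le.trans (min_le_right _ _)
    have hf' : BM f := ⟨hf, 1, h1⟩
    rw [trunc_eq_add ha hab, gen_measure_add hf'.avg, add_sub_cancel_left]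
    refine (H f hf h1 a b ha hb1 z).trans ?_
    refine (mul_le_mul_of_nonneg_left (setIntegral_shell_le hρ ha hb1) hL).trans ?_
    exact hu' ⟨ha.trans_le hab, hb.trans_le (min_le_left _ _)⟩
  refine ⟨min u 1, by positivity, fun h h' a1 a2 a3 a4 f hf h1 z => ?_⟩
  rcases le_total h h' with hh | hh
  · exact key h h' a1 hh a4 f hf h1 z
  · rw [abs_sub_comm]; exact key h' h a3 hh a2 f hf h1 z

theorem integrableOn_shell_norm_pow (hρ : Integrable (fun y => min 1 (‖y‖ ^ p)) ρ) {a b : ℝ}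
    (hb : b ≤ 1) : IntegrableOn (fun y => ‖y‖ ^ p) {y | a ≤ ‖y‖ ∧ ‖y‖ < b} ρ :=
  hρ.integrableOn.congr_fun (fun y hy =>
    min_eq_right (pow_le_one₀ (norm_nonneg y) (hy.2.le.trans hb))) (measurableSet_shell a b)

theorem gen_eq_half_sdiff2 [NormedSpace ℝ V] [SecondCountableTopology V] {μ : Measure V}
    [IsFiniteMeasure μ] (hμ : μ.map Neg.neg = μ) {f : V → ℝ} (hf : BM f) (x : V) :
    gen μ f x = 2⁻¹ * ∫ y, sdiff2 f x y ∂μ := by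
  have i1 : Integrable (fun y => f (x + y) - f x) μ := ((hf.translate x).sub (.const _)).integrable μ
  have i2 : Integrable (fun y => f (x + -y) - f x) μ :=
    (((hf.translate x).comp measurable_neg).sub (.const _)).integrable μ
  have h1 : gen μ f x = ∫ y, (f (x + -y) - f x) ∂μ := by
    conv_lhs => rw [gen, ← hμ]
    rw [integral_map measurable_neg.aemeasurable]
    exact ((hf.translate x).sub (.const _)).meas.aestronglyMeasurable
  have h2 : ∫ y, sdiff2 f x y ∂μ = gen μ f x + ∫ y, (f (x + -y) - f x) ∂μ := by
    rw [gen, ← integral_add i1 i2]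
    refine integral_congr_ae (Eventually.of_forall fun y => ?_)
    simp only [sdiff2, sub_eq_add_neg]
    ring
  rw [h2, ← h1]
  ring

theorem map_neg_restrict {S : Set V} (hρ : ρ.map Neg.neg = ρ) (hS : MeasurableSet S)
    (hS' : Neg.neg ⁻¹' S = S) : (ρ.restrict S).map Neg.neg = ρ.restrict S := by
  conv_rhs => rw [← hρ, Measure.restrict_map measurable_neg hS, hS']

theorem Nice.add {N N' : ℝ → Measure V} {M : Measure V} [SecondCountableTopology V]
    [∀ h, IsFiniteMeasure (N h)] [∀ h, IsFiniteMeasure (N' h)] [IsFiniteMeasure M]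
    (hN : Nice N M) (hN' : Nice N' M) : Nice (fun h => N h + N' h) M := by
  intro ε hε
  obtain ⟨u, hu, H⟩ := hN (ε / 2) (by positivity)
  obtain ⟨u', hu', H'⟩ := hN' (ε / 2) (by positivity)
  refine ⟨min u u', by positivity, fun h h' a1 a2 a3 a4 f hf h1 z => ?_⟩
  have hf' : BM f := ⟨hf, 1, h1⟩
  rw [gen_measure_add hf'.avg, gen_measure_add hf'.avg]
  have e1 := abs_le.1 (H h h' a1 (a2.trans_le (min_le_left _ _)) a3
    (a4.trans_le (min_le_left _ _)) f hf h1 z)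
  have e2 := abs_le.1 (H' h h' a1 (a2.trans_le (min_le_right _ _)) a3
    (a4.trans_le (min_le_right _ _)) f hf h1 z)
  exact abs_le.2 ⟨by linarith [e1.1, e2.1], by linarith [e1.2, e2.2]⟩

end LevyMeasures

section LevyMollified

variable {V : Type*} [NormedAddCommGroup V] [NormedSpace ℝ V] [HasContDiffBump V]
  [FiniteDimensional ℝ V] [MeasureSpace V] [BorelSpace V]
  [Measure.IsAddHaarMeasure (volume : Measure V)] {ρ : Measure V}

theorem nice_trunc_of_symm (hρ : Integrable (fun y => min 1 (‖y‖ ^ 2)) ρ) (hs : ρ.map Neg.neg = ρ)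
    (φ : ContDiffBump (0 : V)) : Nice (trunc ρ) (moll φ) := by
  obtain ⟨L, hL, H⟩ := exists_sdiff2_avg_moll_le φ
  refine nice_trunc hρ (L := 2⁻¹ * L) (by positivity) fun f hf h1 a b ha hb x => ?_
  have := isFiniteMeasure_shell hρ (b := b) ha
  rw [gen_eq_half_sdiff2 (map_neg_restrict hs (measurableSet_shell a b) (by ext; simp))
    (BM.avg ⟨hf, 1, h1⟩), abs_mul, abs_of_pos (by norm_num), mul_assoc, ← integral_const_mul]
  refine mul_le_mul_of_nonneg_left ?_ (by norm_num)
  rw [← Real.norm_eq_abs]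
  refine norm_integral_le_of_norm_le ((integrableOn_shell_norm_pow hρ hb).const_mul L) ?_
  refine (ae_restrict_mem (measurableSet_shell a b)).mono fun y hy => ?_
  exact H f hf h1 x y (hy.2.le.trans hb)

theorem nice_trunc_of_lipschitz (hρ : Integrable (fun y => min 1 (‖y‖ ^ 1)) ρ)
    (φ : ContDiffBump (0 : V)) : Nice (trunc ρ) (moll φ) := by
  obtain ⟨L, hL, H⟩ := exists_lipschitz_avg_moll φ
  refine nice_trunc hρ hL fun f hf h1 a b ha hb x => ?_
  rw [gen, ← integral_const_mul, ← Real.norm_eq_abs]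
  refine norm_integral_le_of_norm_le ((integrableOn_shell_norm_pow hρ hb).const_mul L) ?_
  refine Eventually.of_forall fun y => ?_
  simpa using H f hf h1 (x + y) x

end LevyMollified

section PowerMeasures

/-- The measure with density `c ‖y‖ ^ (-a)`. -/
def powMeas (V : Type*) [NormedAddCommGroup V] [MeasureSpace V] (c a : ℝ) : Measure V :=
  volume.withDensity fun y => ENNReal.ofReal (c * ‖y‖ ^ (-a))

theorem integrable_min_mul_rpow {V : Type*} [NormedAddCommGroup V] [NormedSpace ℝ V]
    [FiniteDimensional ℝ V] [Nontrivial V] [MeasureSpace V] [BorelSpace V]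
    [Measure.IsAddHaarMeasure (volume : Measure V)] {p : ℕ} {q : ℝ} (hq : 0 < q) (hp : q < p) :
    Integrable fun y : V => min 1 (‖y‖ ^ p) * ‖y‖ ^ (-((Module.finrank ℝ V : ℝ) + q)) := by
  rw [integrable_fun_norm_addHaar (volume : Measure V)
    (f := fun r => min 1 (r ^ p) * r ^ (-((Module.finrank ℝ V : ℝ) + q)))]
  have hd : 1 ≤ Module.finrank ℝ V := Module.finrank_pos
  have e : ∀ r : ℝ, 0 < r → r ^ (Module.finrank ℝ V - 1) •
      (min 1 (r ^ p) * r ^ (-((Module.finrank ℝ V : ℝ) + q))) = min 1 (r ^ p) * r ^ (-1 - q) := by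
    intro r hr
    rw [smul_eq_mul, mul_left_comm, ← Real.rpow_natCast r (_ - 1), ← Real.rpow_add hr,
      Nat.cast_sub hd]
    congr 2
    push_cast
    ring
  rw [← Ioc_union_Ioi_eq_Ioi (zero_le_one (α := ℝ))]
  refine IntegrableOn.union ?_ ?_
  · have h := (intervalIntegrable_iff_integrableOn_Ioc_of_le (zero_le_one (α := ℝ))).1
      (intervalIntegral.intervalIntegrable_rpow' (r := (p : ℝ) + (-1 - q)) (by linarith))
    refine h.congr_fun (fun r hr => ?_) measurableSet_Ioc
    simp only
    rw [e r hr.1, min_eq_right (pow_le_one₀ hr.1.le hr.2), Real.rpow_add hr.1, Real.rpow_natCast]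
  · refine (integrableOn_Ioi_rpow_of_lt (by linarith : -1 - q < -1) one_pos).congr_fun
      (fun r hr => ?_) measurableSet_Ioi
    have hr : (1 : ℝ) < r := hr
    simp only
    rw [e r (by linarith), min_eq_left (one_le_pow₀ hr.le), one_mul]

variable {V : Type*} [NormedAddCommGroup V] [MeasureSpace V] [BorelSpace V] {c a : ℝ}

theorem measurable_powDensity : Measurable fun y : V => ENNReal.ofReal (c * ‖y‖ ^ (-a)) := by
  fun_prop

theorem integrable_powMeas (hc : 0 ≤ c) {f : V → ℝ}
    (hf : Integrable fun y => f y * ‖y‖ ^ (-a)) : Integrable f (powMeas V c a) := by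
  rw [powMeas, integrable_withDensity_iff_integrable_smul' measurable_powDensity
    (Eventually.of_forall fun _ => ENNReal.ofReal_lt_top)]
  refine (hf.const_mul c).congr (Eventually.of_forall fun y => ?_)
  simp only [smul_eq_mul]
  rw [ENNReal.toReal_ofReal (by positivity)]
  ring

theorem setIntegral_powMeas (hc : 0 ≤ c) (f : V → ℝ) {S : Set V} (hS : MeasurableSet S) :
    ∫ y in S, f y ∂powMeas V c a = c * ∫ y in S, f y * ‖y‖ ^ (-a) := by
  rw [powMeas, restrict_withDensity hS, integral_withDensity_eq_integral_toReal_smul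
    measurable_powDensity (Eventually.of_forall fun _ => ENNReal.ofReal_lt_top),
    ← integral_const_mul]
  refine integral_congr_ae (Eventually.of_forall fun y => ?_)
  simp only [smul_eq_mul]
  rw [ENNReal.toReal_ofReal (by positivity)]
  ring

theorem map_neg_powMeas [NormedSpace ℝ V] [FiniteDimensional ℝ V]
    [Measure.IsAddHaarMeasure (volume : Measure V)] :
    (powMeas V c a).map Neg.neg = powMeas V c a := by
  ext s hs
  rw [Measure.map_apply measurable_neg hs, powMeas, withDensity_apply _ (measurable_neg hs),
    withDensity_apply _ hs]
  rw [← (Measure.measurePreserving_neg (volume : Measure V)).setLIntegral_comp_preimage hs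
    measurable_powDensity]
  simp

end PowerMeasures

section AbelPotential

/-- The kernel `τ ^ (α - 1)` on the positive half-line. -/
def abelKer (α τ : ℝ) : ENNReal := if 0 < τ then ENNReal.ofReal (τ ^ (α - 1)) else 0

/-- The Abel kernel cut off to `(0, h]`. -/
def abelNear (α h τ : ℝ) : ENNReal := (Iic h).indicator (abelKer α) τ

variable {α : ℝ}

theorem measurable_abelKer : Measurable (abelKer α) :=
  Measurable.ite measurableSet_Ioi (by fun_prop) measurable_const

theorem measurable_abelNear (h : ℝ) : Measurable (abelNear α h) :=
  measurable_abelKer.indicator measurableSet_Iic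

theorem measurable_abelKer_sub (t : ℝ) : Measurable fun w => abelKer α (t - w) :=
  measurable_abelKer.comp (measurable_const_sub t)

theorem measurable_abelNear_sub (h t : ℝ) : Measurable fun w => abelNear α h (t - w) :=
  (measurable_abelNear h).comp (measurable_const_sub t)

theorem measurable_abelNear_add (h t : ℝ) : Measurable fun w => abelNear α h (t + w) :=
  (measurable_abelNear h).comp (measurable_const_add t)

theorem lintegral_abelNear (hα : 0 < α) {h : ℝ} (hh : 0 < h) :
    ∫⁻ τ, abelNear α h τ = ENNReal.ofReal (h ^ α / α) := by
  have e : abelNear α h = (Ioc 0 h).indicator fun τ => ENNReal.ofReal (τ ^ (α - 1)) := by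
    ext τ
    by_cases h1 : 0 < τ <;> by_cases h2 : τ ≤ h <;> simp [abelNear, abelKer, indicator, h1, h2]
  rw [e, lintegral_indicator measurableSet_Ioc]
  have hi := (intervalIntegrable_iff_integrableOn_Ioc_of_le hh.le).1
    (intervalIntegral.intervalIntegrable_rpow' (a := 0) (b := h) (r := α - 1) (by linarith))
  rw [← ofReal_integral_eq_lintegral_ofReal hi ((ae_restrict_mem measurableSet_Ioc).mono
    fun τ hτ => Real.rpow_nonneg hτ.1.le _), ← intervalIntegral.integral_of_le hh.le,
    integral_rpow (Or.inl (by linarith)), Real.zero_rpow (by linarith)]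
  simp

theorem abelKer_le (hα1 : α ≤ 1) (τ : ℝ) : abelKer α τ ≤ abelNear α 1 τ + 1 := by
  by_cases h : τ ≤ 1
  · rw [abelNear, indicator_of_mem (by exact h)]; exact le_self_add
  · have h' : 1 < τ := not_le.1 h
    refine le_add_left ?_
    rw [abelKer, if_pos (by linarith)]
    exact ENNReal.ofReal_le_one.2 (Real.rpow_le_one_of_one_le_of_nonpos h'.le (by linarith))

variable {A : Set ℝ}

/-- The Abel potential of a set. -/
def abelPot (α : ℝ) (A : Set ℝ) (t : ℝ) : ENNReal := ∫⁻ w in A, abelKer α (t - w)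

theorem measurable_abelPot : Measurable (abelPot α A) :=
  Measurable.lintegral_prod_right' (f := fun p : ℝ × ℝ => abelKer α (p.1 - p.2))
    (measurable_abelKer.comp (measurable_fst.sub measurable_snd))

theorem setLIntegral_abelNear_le (hα : 0 < α) {h : ℝ} (hh : 0 < h) (t : ℝ) :
    ∫⁻ w in A, abelNear α h (t - w) ≤ ENNReal.ofReal (h ^ α / α) := by
  refine (setLIntegral_le_lintegral _ _).trans ?_
  rw [lintegral_sub_left_eq_self (abelNear α h) t, lintegral_abelNear hα hh]

theorem abelPot_le (hα : 0 < α) (hα1 : α ≤ 1) (t : ℝ) :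
    abelPot α A t ≤ ENNReal.ofReal (1 / α) + volume A := by
  calc abelPot α A t ≤ ∫⁻ w in A, (abelNear α 1 (t - w) + 1) :=
        lintegral_mono fun w => abelKer_le hα1 _
    _ = (∫⁻ w in A, abelNear α 1 (t - w)) + volume A := by
        rw [lintegral_add_right _ measurable_const]; simp
    _ ≤ _ := by
        gcongr
        simpa using setLIntegral_abelNear_le (A := A) hα one_pos t

theorem abelPot_ne_top (hα : 0 < α) (hα1 : α ≤ 1) (hA : volume A ≠ ⊤) (t : ℝ) :
    abelPot α A t ≠ ⊤ :=
  ((abelPot_le hα hα1 t).trans_lt (ENNReal.add_lt_top.2 ⟨ENNReal.ofReal_lt_top, hA.lt_top⟩)).ne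

theorem bm_abelPot (hα : 0 < α) (hα1 : α ≤ 1) (hA : volume A ≠ ⊤) :
    BM fun t => (abelPot α A t).toReal := by
  refine ⟨measurable_abelPot.ennreal_toReal, (ENNReal.ofReal (1 / α) + volume A).toReal,
    fun t => ?_⟩
  rw [abs_of_nonneg ENNReal.toReal_nonneg]
  exact ENNReal.toReal_mono (ENNReal.add_ne_top.2 ⟨ENNReal.ofReal_ne_top, hA⟩)
    (abelPot_le hα hα1 t)

theorem continuous_abelFar (hα1 : α ≤ 1) {h : ℝ} (hh : 0 < h) (hA : volume A ≠ ⊤) :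
    Continuous fun t => ∫ w in A, (Ioi h).indicator (fun τ => τ ^ (α - 1)) (t - w) := by
  have hm : Measurable ((Ioi h).indicator fun τ : ℝ => τ ^ (α - 1)) :=
    Measurable.indicator (by fun_prop) measurableSet_Ioi
  have : IsFiniteMeasure (volume.restrict A) := ⟨by simpa using hA.lt_top⟩
  refine continuous_iff_continuousAt.2 fun t => ?_
  refine continuousAt_of_dominated (bound := fun _ => h ^ (α - 1))
    (Eventually.of_forall fun t =>
      (hm.comp (measurable_const.sub measurable_id)).aestronglyMeasurable)
    (Eventually.of_forall fun t => Eventually.of_forall fun w => ?_) (integrable_const _) ?_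
  · by_cases hw : t - w ∈ Ioi h
    · rw [indicator_of_mem hw, Real.norm_of_nonneg (Real.rpow_nonneg (hh.le.trans hw.le) _)]
      exact Real.rpow_le_rpow_of_nonpos hh hw.le (by linarith)
    · rw [indicator_of_notMem hw, norm_zero]
      exact Real.rpow_nonneg hh.le _
  · have hne : ∀ᵐ w ∂volume.restrict A, w ≠ t - h :=
      ae_restrict_of_ae (by simp [ae_iff])
    filter_upwards [hne] with w hw
    have hc : ContinuousAt (fun t' => t' - w) t := by fun_prop
    refine ContinuousAt.comp (g := (Ioi h).indicator fun τ : ℝ => τ ^ (α - 1)) ?_ hc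
    rcases lt_or_gt_of_ne (fun e => hw (by linarith) : t - w ≠ h) with h1 | h1
    · refine (continuousAt_const (y := (0 : ℝ))).congr ?_
      filter_upwards [Iio_mem_nhds h1] with τ hτ
      rw [indicator_of_notMem (fun h => absurd (mem_Ioi.1 h) (not_lt.2 (le_of_lt hτ)))]
    · refine ContinuousAt.congr (f := fun τ : ℝ => τ ^ (α - 1)) ?_ ?_
      · exact Real.continuousAt_rpow_const _ _ (Or.inl (by linarith))
      · filter_upwards [Ioi_mem_nhds h1] with τ hτ
        rw [indicator_of_mem hτ]

theorem abs_abelPot_sub_far_le (hα : 0 < α) (hα1 : α ≤ 1) {h : ℝ} (hh : 0 < h)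
    (hA : volume A ≠ ⊤) (t : ℝ) :
    |(abelPot α A t).toReal - ∫ w in A, (Ioi h).indicator (fun τ => τ ^ (α - 1)) (t - w)| ≤
      h ^ α / α := by
  have hm : Measurable ((Ioi h).indicator fun τ : ℝ => τ ^ (α - 1)) :=
    Measurable.indicator (by fun_prop) measurableSet_Ioi
  have h0 : ∀ τ, 0 ≤ (Ioi h).indicator (fun τ : ℝ => τ ^ (α - 1)) τ := fun τ =>
    indicator_nonneg (fun τ hτ => Real.rpow_nonneg (hh.le.trans (le_of_lt hτ)) _) τ
  have hmt : Measurable fun w => (Ioi h).indicator (fun τ : ℝ => τ ^ (α - 1)) (t - w) :=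
    hm.comp (measurable_const_sub t)
  rw [integral_eq_lintegral_of_nonneg_ae (Eventually.of_forall fun w => h0 _)
    hmt.aestronglyMeasurable]
  have e : abelPot α A t = (∫⁻ w in A, abelNear α h (t - w)) + ∫⁻ w in A, ENNReal.ofReal
      ((Ioi h).indicator (fun τ => τ ^ (α - 1)) (t - w)) := by
    rw [← lintegral_add_left (measurable_abelNear_sub h t)]
    refine lintegral_congr fun w => ?_
    by_cases h1 : t - w ≤ h
    · rw [abelNear, indicator_of_mem (by exact h1),
        indicator_of_notMem (by simpa using h1)]
      simp
    · have h2 : h < t - w := not_le.1 h1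
      rw [abelNear, indicator_of_notMem (by exact h1), indicator_of_mem (by exact h2), abelKer,
        if_pos (hh.trans h2), zero_add]
  have hfin := abelPot_ne_top hα hα1 hA t
  rw [e] at hfin ⊢
  rw [ENNReal.add_ne_top] at hfin
  rw [ENNReal.toReal_add hfin.1 hfin.2, add_sub_cancel_right, abs_of_nonneg ENNReal.toReal_nonneg]
  exact ENNReal.toReal_le_of_le_ofReal (by positivity) (setLIntegral_abelNear_le hα hh t)

theorem continuous_abelPot (hα : 0 < α) (hα1 : α ≤ 1) (hA : volume A ≠ ⊤) :
    Continuous fun t => (abelPot α A t).toReal := by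
  refine continuous_of_uniform_approx_of_continuous fun u hu => ?_
  obtain ⟨ε, hε, hu⟩ := Metric.mem_uniformity_dist.1 hu
  have hlim : Tendsto (fun h : ℝ => h ^ α / α) (nhdsWithin 0 (Ioi 0)) (nhds 0) := by
    have := ((Real.continuousAt_rpow_const 0 α (Or.inr hα.le)).tendsto.div_const α).mono_left
      (nhdsWithin_le_nhds (s := Ioi 0))
    simpa [Real.zero_rpow hα.ne'] using this
  obtain ⟨h, hh, hlt⟩ := (eventually_mem_nhdsWithin.and (hlim.eventually_lt_const hε)).exists
  refine ⟨_, continuous_abelFar (A := A) hα1 hh hA, fun t => hu ?_⟩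
  rw [Real.dist_eq]
  exact (abs_abelPot_sub_far_le hα hα1 hh hA t).trans_lt hlt

theorem avg_abelPot_eq (hα : 0 < α) (hα1 : α ≤ 1) (hA : volume A ≠ ⊤) (N : Measure ℝ)
    [SFinite N] (t : ℝ) : avg N (fun t => (abelPot α A t).toReal) t =
      (∫⁻ w in A, ∫⁻ σ, abelKer α (t - w + σ) ∂N).toReal := by
  have hmt : Measurable fun σ => abelPot α A (t + σ) :=
    measurable_abelPot.comp (measurable_const_add t)
  rw [avg, integral_toReal hmt.aemeasurable
    (Eventually.of_forall fun σ => (abelPot_ne_top hα hα1 hA _).lt_top)]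
  simp only [abelPot]
  rw [lintegral_lintegral_swap]
  · simp only [add_sub_right_comm]
  · exact (measurable_abelKer.comp (by fun_prop :
      Measurable fun p : ℝ × ℝ => t + p.1 - p.2)).aemeasurable

theorem exists_avg_moll_abelPot_le (hα : 0 < α) (hα1 : α ≤ 1) (θ : ContDiffBump (0 : ℝ)) :
    ∃ C, 0 ≤ C ∧ ∀ A : Set ℝ, volume A ≠ ⊤ → ∀ t,
      avg (moll θ) (fun t => (abelPot α A t).toReal) t ≤ C * volume.real A := by
  obtain ⟨K, hK0, hK⟩ := exists_norm_bound (D := θ.normed (volume : Measure ℝ))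
    θ.hasCompactSupport_normed θ.continuous_normed
  refine ⟨K * (1 / α) + 1, by positivity, fun A hA t => ?_⟩
  rw [avg_abelPot_eq hα hα1 hA]
  have key : ∀ x, ∫⁻ σ, abelKer α (x + σ) ∂moll θ ≤ ENNReal.ofReal (K * (1 / α) + 1) := by
    intro x
    calc ∫⁻ σ, abelKer α (x + σ) ∂moll θ ≤ ∫⁻ σ, (abelNear α 1 (x + σ) + 1) ∂moll θ :=
          lintegral_mono fun σ => abelKer_le hα1 _
      _ = (∫⁻ σ, abelNear α 1 (x + σ) ∂moll θ) + 1 := by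
          rw [lintegral_add_right _ measurable_const]; simp
      _ ≤ ENNReal.ofReal K * ENNReal.ofReal (1 / α) + 1 := by
          gcongr
          rw [moll, lintegral_withDensity_eq_lintegral_mul _ (measurable_normed θ).ennreal_ofReal
            (measurable_abelNear_add 1 x)]
          calc _ ≤ ∫⁻ σ, ENNReal.ofReal K * abelNear α 1 (x + σ) := by
                refine lintegral_mono fun σ => ?_
                simp only [Pi.mul_apply]
                gcongr
                exact (le_abs_self _).trans (hK σ)
            _ = _ := by
                rw [lintegral_const_mul _ (measurable_abelNear_add 1 x),
                  lintegral_add_left_eq_self (abelNear α 1) x, lintegral_abelNear hα one_pos]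
                simp
      _ = _ := by
          rw [← ENNReal.ofReal_mul hK0, ← ENNReal.ofReal_one, ← ENNReal.ofReal_add (by positivity)
            zero_le_one]
  refine ENNReal.toReal_le_of_le_ofReal (by positivity) ?_
  rw [ENNReal.ofReal_mul (by positivity), measureReal_def, ENNReal.ofReal_toReal hA]
  refine (lintegral_mono fun w => key _).trans ?_
  simp

/-- The reflected cut-off Abel kernel as a measure. -/
def abelMeas (α h : ℝ) : Measure ℝ := volume.withDensity fun τ => abelNear α h (-τ)

theorem abelMeas_univ (hα : 0 < α) {h : ℝ} (hh : 0 < h) :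
    abelMeas α h univ = ENNReal.ofReal (h ^ α / α) := by
  rw [abelMeas, withDensity_apply _ MeasurableSet.univ, Measure.restrict_univ,
    lintegral_neg_eq_self (μ := volume) (abelNear α h), lintegral_abelNear hα hh]

theorem ae_abelMeas (h : ℝ) : ∀ᵐ τ ∂abelMeas α h, |τ| ≤ h := by
  have hm : Measurable fun τ => abelNear α h (-τ) := (measurable_abelNear h).comp measurable_neg
  rw [abelMeas, ae_withDensity_iff hm]
  refine Eventually.of_forall fun τ hτ => ?_
  have h1 : -τ ≤ h := by
    by_contra h'
    exact hτ (indicator_of_notMem (by exact h') _)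
  have h2 : 0 < -τ := by
    by_contra h'
    refine hτ ?_
    rw [abelNear, indicator_of_mem (by exact h1), abelKer, if_neg h']
  rw [abs_of_neg (by linarith)]
  exact h1

theorem avg_abelMeas (hA : MeasurableSet A) (h t : ℝ) :
    avg (abelMeas α h) (A.indicator fun _ => 1) t =
      (∫⁻ w in A, abelNear α h (t - w)).toReal := by
  have hA' : MeasurableSet ((fun τ => t + τ) ⁻¹' A) := measurable_const_add t hA
  rw [avg, show (fun τ => A.indicator (fun _ => (1 : ℝ)) (t + τ)) =
    ((fun τ => t + τ) ⁻¹' A).indicator 1 from rfl, integral_indicator_one hA', measureReal_def,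
    abelMeas, withDensity_apply _ hA', ← lintegral_indicator hA', ← lintegral_indicator hA,
    ← lintegral_add_left_eq_self (A.indicator fun w => abelNear α h (t - w)) t]
  refine congrArg ENNReal.toReal (lintegral_congr fun τ => ?_)
  simp only [indicator, sub_add_cancel_left]
  rfl

theorem gen_abelPot_le (hα : 0 < α) (hα1 : α ≤ 1) (hA : MeasurableSet A) (hfin : volume A ≠ ⊤)
    {ν : Measure ℝ} [IsFiniteMeasure ν] {h : ℝ}
    (hkey : ∀ τ, (∫⁻ σ, abelKer α (τ + σ) ∂ν) + ν univ * abelNear α h τ ≤ ν univ * abelKer α τ)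
    (t : ℝ) : gen ν (fun t => (abelPot α A t).toReal) t ≤
      -(ν.real univ * avg (abelMeas α h) (A.indicator fun _ => 1) t) := by
  rw [gen_eq (bm_abelPot hα hα1 hfin), avg_abelPot_eq hα hα1 hfin, avg_abelMeas hA]
  have mk : Measurable fun w => ∫⁻ σ, abelKer α (t - w + σ) ∂ν :=
    Measurable.lintegral_prod_right' (f := fun p : ℝ × ℝ => abelKer α (t - p.1 + p.2))
      (measurable_abelKer.comp (by fun_prop : Measurable fun p : ℝ × ℝ => t - p.1 + p.2))
  have h1 : (∫⁻ w in A, ∫⁻ σ, abelKer α (t - w + σ) ∂ν) +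
      ν univ * ∫⁻ w in A, abelNear α h (t - w) ≤ ν univ * abelPot α A t := by
    rw [abelPot, ← lintegral_const_mul _ (measurable_abelNear_sub h t), ← lintegral_const_mul _ (measurable_abelKer_sub t), ← lintegral_add_left mk]
    exact lintegral_mono fun w => hkey _
  have hR : ν univ * abelPot α A t ≠ ⊤ :=
    ENNReal.mul_ne_top (measure_ne_top _ _) (abelPot_ne_top hα hα1 hfin t)
  have hL := ENNReal.add_ne_top.1 (ne_top_of_le_ne_top hR h1)
  have h2 := ENNReal.toReal_mono hR h1
  rw [ENNReal.toReal_add hL.1 hL.2, ENNReal.toReal_mul, ENNReal.toReal_mul] at h2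
  simp only [measureReal_def]
  linarith

theorem exists_abel_potential (hα : 0 < α) (hα1 : α ≤ 1) {ν : ℝ → Measure ℝ}
    [∀ h, IsFiniteMeasure (ν h)] {m : ℝ} (hm : 0 < m)
    (hν : ∀ h, 0 < h → h < 1 → (ν h).real univ * (h ^ α / α) = m)
    (hkey : ∀ h, 0 < h → h < 1 → ∀ τ, (∫⁻ σ, abelKer α (τ + σ) ∂ν h) +
      ν h univ * abelNear α h τ ≤ ν h univ * abelKer α τ) (M : ℝ) (θ₀ : ContDiffBump (0 : ℝ)) :
    ∃ C, 0 ≤ C ∧ ∀ A ⊆ Icc (-M) M, MeasurableSet A →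
    ∃ g : ℝ → ℝ, Continuous g ∧ BM g ∧ (∀ t, 0 ≤ g t) ∧
      (∀ t, avg (moll θ₀) g t ≤ C * volume.real A) ∧
      (∀ h, 0 < h → h < 1 → ∀ t, gen (ν h) g t ≤ 0) ∧
      ∀ θ : ContDiffBump (0 : ℝ), ∃ L, ∀ h, 0 < h → h < 1 → ∀ t,
        gen (ν h) (avg (moll θ) g) t ≤ -avg (moll θ) (A.indicator fun _ => 1) t + L * h := by
  obtain ⟨C, hC0, hC⟩ := exists_avg_moll_abelPot_le hα hα1 θ₀
  refine ⟨m⁻¹ * C, by positivity, fun A hAM hA => ?_⟩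
  have hfin : volume A ≠ ⊤ := (measure_mono hAM |>.trans_lt measure_Icc_lt_top).ne
  have hg := bm_abelPot hα hα1 hfin
  have hA0 : ∀ t, 0 ≤ A.indicator (fun _ => (1 : ℝ)) t := fun t =>
    indicator_nonneg (fun _ _ => zero_le_one) t
  have hgen := fun h (h0 : 0 < h) h1 => gen_abelPot_le hα hα1 hA hfin (hkey h h0 h1)
  refine ⟨fun t => m⁻¹ * (abelPot α A t).toReal, (continuous_abelPot hα hα1 hfin).const_mul _,
    hg.const_mul _, fun t => by positivity, fun t => ?_, fun h h0 h1 t => ?_, fun θ => ?_⟩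
  · rw [avg_const_mul, mul_assoc]
    exact mul_le_mul_of_nonneg_left (hC A hfin t) (by positivity)
  · rw [gen_const_mul]
    refine mul_nonpos_of_nonneg_of_nonpos (by positivity) ((hgen h h0 h1 t).trans ?_)
    exact neg_nonpos.2 (mul_nonneg measureReal_nonneg (avg_nonneg hA0 t))
  · obtain ⟨L, hL0, hL⟩ := exists_lipschitz_avg_moll θ
    refine ⟨L, fun h h0 h1 t => ?_⟩
    have hA1 : BM (A.indicator fun _ => (1 : ℝ)) := .indicator_one hA
    have hab : ∀ z, |A.indicator (fun _ => (1 : ℝ)) z| ≤ 1 := fun z => by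
      by_cases hz : z ∈ A <;> simp [hz]
    have : IsFiniteMeasure (abelMeas α h) := ⟨by rw [abelMeas_univ hα h0]; simp⟩
    rw [show avg (moll θ) (fun t => m⁻¹ * (abelPot α A t).toReal) = fun t => m⁻¹ *
      avg (moll θ) (fun t => (abelPot α A t).toReal) t from funext fun t => avg_const_mul _ _,
      gen_const_mul, gen_avg hg]
    have e1 : avg (moll θ) (gen (ν h) fun t => (abelPot α A t).toReal) t ≤
        -(ν h).real univ * avg (abelMeas α h) (avg (moll θ) (A.indicator fun _ => 1)) t := by
      rw [avg_comm hA1, ← avg_const_mul]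
      refine avg_mono hg.gen (hA1.avg.const_mul _) (Eventually.of_forall fun y => ?_)
      rw [neg_mul]
      exact hgen h h0 h1 _
    have e2 : (abelMeas α h).real univ * (avg (moll θ) (A.indicator fun _ => 1) t - L * h) ≤
        avg (abelMeas α h) (avg (moll θ) (A.indicator fun _ => 1)) t := by
      rw [← avg_const (N := abelMeas α h) _ t]
      refine avg_mono (.const _) hA1.avg ?_
      filter_upwards [ae_abelMeas h] with τ hτ
      have := (abs_le.1 (hL _ hA1.meas hab (t + τ) t)).1
      rw [add_sub_cancel_left, Real.norm_eq_abs] at this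
      nlinarith
    have e3 : (ν h).real univ * (abelMeas α h).real univ = m := by
      rw [measureReal_def (abelMeas α h), abelMeas_univ hα h0,
        ENNReal.toReal_ofReal (by positivity), hν h h0 h1]
    have e4 := mul_le_mul_of_nonneg_left e2 (measureReal_nonneg (μ := ν h) (s := univ))
    rw [← mul_assoc, e3] at e4
    rw [inv_mul_le_iff₀ hm]
    linarith

end AbelPotential

section SpatialJumps

/-- Nearest-neighbour jumps on a lattice of spacing `h`, at rate `h⁻²`. -/
def latt (n : ℕ) (h : ℝ) : Measure (En n) :=
  ENNReal.ofReal (h ^ 2)⁻¹ • ∑ i : Fin n, (Measure.dirac (h • eDir i) + Measure.dirac (-(h • eDir i)))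

variable {n : ℕ} {s Cns : ℝ}

theorem norm_eDir (i : Fin n) : ‖eDir i‖ = 1 := by simp [eDir]

instance isFiniteMeasure_latt (h : ℝ) : IsFiniteMeasure (latt n h) := by
  refine ⟨?_⟩
  rw [latt, Measure.smul_apply, Measure.finsetSum_apply]
  refine ENNReal.mul_lt_top ENNReal.ofReal_lt_top (ENNReal.sum_lt_top.2 fun i _ => ?_)
  simp

theorem integrable_latt (f : En n → ℝ) (h : ℝ) : Integrable f (latt n h) := by
  refine Integrable.smul_measure ?_ ENNReal.ofReal_ne_top
  refine integrable_finsetSum_measure.2 fun i _ => ?_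
  exact (integrable_dirac (by simp)).add_measure (integrable_dirac (by simp))

theorem gen_latt (f : En n → ℝ) (h : ℝ) (x : En n) :
    gen (latt n h) f x = ∑ i, (h ^ 2)⁻¹ * sdiff2 f x (h • eDir i) := by
  have hi : ∀ (g : En n → ℝ) y, Integrable g (Measure.dirac y) := fun g y =>
    integrable_dirac (by simp)
  rw [gen, latt, integral_smul_measure, integral_finsetSum_measure fun i _ =>
    (hi _ _).add_measure (hi _ _), ENNReal.toReal_ofReal (by positivity), smul_eq_mul,
    Finset.mul_sum]
  refine Finset.sum_congr rfl fun i _ => ?_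
  rw [integral_add_measure (hi _ _) (hi _ _), integral_dirac, integral_dirac, sdiff2,
    ← sub_eq_add_neg x]
  ring

theorem nice_latt (φ : ContDiffBump (0 : En n)) : Nice (latt n) (moll φ) := by
  intro ε hε
  choose u hu H using fun i : Fin n => exists_sdiff2_quotient_cauchy φ (eDir i) (norm_eDir i).le
    (ε := ε / (n + 1)) (by positivity)
  obtain ⟨d, hd, hd'⟩ : ∃ d > 0, ∀ i, d ≤ u i := by
    have : ∀ᶠ d in nhdsWithin (0 : ℝ) (Ioi 0), ∀ i, d ≤ u i :=
      eventually_all.2 fun i => nhdsWithin_le_nhds (eventually_le_nhds (hu i))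
    obtain ⟨d, hd, hd'⟩ := (eventually_mem_nhdsWithin.and this).exists
    exact ⟨d, hd, hd'⟩
  refine ⟨d, hd, fun h h' a1 a2 a3 a4 f hf h1 x => ?_⟩
  rw [gen_latt, gen_latt, ← Finset.sum_sub_distrib]
  refine (Finset.abs_sum_le_sum_abs _ _).trans ((Finset.sum_le_sum fun i _ => H i h h' a1
    (a2.trans_le (hd' i)) a3 (a4.trans_le (hd' i)) f hf h1 x).trans ?_)
  rw [Finset.sum_const, Finset.card_univ, Fintype.card_fin, nsmul_eq_mul, mul_div_assoc',
    div_le_iff₀ (by positivity)]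
  nlinarith

/-- The Lévy measure of the fractional Laplacian. -/
abbrev fracMeas (n : ℕ) (s Cns : ℝ) : Measure (En n) := powMeas (En n) Cns ((n : ℝ) + 2 * s)

theorem integrable_min_fracMeas (hn : 1 ≤ n) (hs : s ∈ Ioo (0 : ℝ) 1) (hC : 0 ≤ Cns) :
    Integrable (fun y => min 1 (‖y‖ ^ 2)) (fracMeas n s Cns) := by
  have : Nonempty (Fin n) := ⟨⟨0, hn⟩⟩
  have h := integrable_min_mul_rpow (V := En n) (p := 2) (q := 2 * s) (by linarith [hs.1])
    (by push_cast; linarith [hs.2])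
  rw [finrank_euclideanSpace_fin] at h
  exact integrable_powMeas hC h

/-- The spatial jump measure of `Δ - (-Δ)ˢ` at scale `h`. -/
def jumpX (n : ℕ) (s Cns h : ℝ) : Measure (En n) := latt n h + trunc (fracMeas n s Cns) h

theorem isFiniteMeasure_jumpX (hn : 1 ≤ n) (hs : s ∈ Ioo (0 : ℝ) 1) (hC : 0 ≤ Cns) (h : ℝ) :
    IsFiniteMeasure (jumpX n s Cns h) := by
  have := isFiniteMeasure_trunc (integrable_min_fracMeas hn hs hC) h
  exact inferInstanceAs (IsFiniteMeasure (latt n h + trunc (fracMeas n s Cns) h))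

theorem nice_jumpX (hn : 1 ≤ n) (hs : s ∈ Ioo (0 : ℝ) 1) (hC : 0 ≤ Cns)
    (φ : ContDiffBump (0 : En n)) : Nice (jumpX n s Cns) (moll φ) := by
  have h := integrable_min_fracMeas hn hs hC
  have := isFiniteMeasure_trunc h
  exact (nice_latt φ).add (nice_trunc_of_symm h map_neg_powMeas φ)

/-- The rate of jumps leaving a slab of width comparable to `l`. -/
theorem le_jumpX_real (hn : 1 ≤ n) (hs : s ∈ Ioo (0 : ℝ) 1) (hC : 0 ≤ Cns) (i : Fin n) {l h : ℝ}
    (hl : 0 < l) (hh : 0 < h) (hhl : h ≤ l) :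
    Cns * (3 ^ (-((n : ℝ) + 2 * s)) * volume.real (Metric.ball (0 : En n) 1)) * l ^ (-(2 * s)) ≤
      (jumpX n s Cns h).real {y | l ≤ |y i|} := by
  have := isFiniteMeasure_jumpX hn hs hC h
  have := isFiniteMeasure_trunc (integrable_min_fracMeas hn hs hC) h
  have : Nonempty (Fin n) := ⟨⟨0, hn⟩⟩
  set b := Metric.ball ((2 * l) • eDir i) l
  have hb : ∀ y ∈ b, l ≤ |y i| ∧ l ≤ ‖y‖ ∧ ‖y‖ ≤ 3 * l := by
    intro y hy
    have h1 : ‖y - (2 * l) • eDir i‖ < l := by rwa [mem_ball_iff_norm] at hy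
    have h2 : ‖(2 * l) • (eDir i : En n)‖ = 2 * l := by
      rw [norm_smul, norm_eDir, mul_one, Real.norm_of_nonneg (by positivity)]
    have h3 : |y i - 2 * l| < l := by
      refine lt_of_le_of_lt ?_ h1
      have := PiLp.norm_apply_le (y - (2 * l) • (eDir i : En n)) i
      simpa [eDir] using this
    have h4 := norm_sub_norm_le y ((2 * l) • eDir i)
    have h5 := PiLp.norm_apply_le y i
    rw [Real.norm_eq_abs] at h5
    have h6 : l ≤ |y i| := by
      rw [abs_lt] at h3; exact (by linarith : l ≤ y i).trans (le_abs_self _)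
    exact ⟨h6, h6.trans h5, by linarith⟩
  have e : (jumpX n s Cns h).real b = (latt n h).real b + ∫ y in b, 1 ∂trunc (fracMeas n s Cns) h := by
    rw [jumpX, measureReal_add_apply]; simp
  have hbm : MeasurableSet b := measurableSet_ball
  have e2 : ∫ y in b, 1 ∂trunc (fracMeas n s Cns) h =
      Cns * ∫ y in b, 1 * ‖y‖ ^ (-((n : ℝ) + 2 * s)) := by
    rw [trunc, Measure.restrict_restrict hbm, inter_eq_left.2, setIntegral_powMeas hC _ hbm]
    exact fun y hy => ⟨hh, hhl.trans (hb y hy).2.1⟩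
  have hvol : volume.real b = l ^ n * volume.real (Metric.ball (0 : En n) 1) := by
    rw [measureReal_def, Measure.addHaar_ball _ _ hl.le, ENNReal.toReal_mul,
      finrank_euclideanSpace_fin, ENNReal.toReal_ofReal (by positivity), measureReal_def]
  have e3 : volume.real b * (3 * l) ^ (-((n : ℝ) + 2 * s)) ≤
      ∫ y in b, 1 * ‖y‖ ^ (-((n : ℝ) + 2 * s)) := by
    rw [← smul_eq_mul, ← setIntegral_const]
    refine setIntegral_mono_on (integrableOn_const (measure_ball_lt_top.ne)) ?_ hbm fun y hy => ?_
    · refine Measure.integrableOn_of_bounded (M := l ^ (-((n : ℝ) + 2 * s)))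
        measure_ball_lt_top.ne
        (by fun_prop : Measurable fun y : En n => 1 * ‖y‖ ^ (-((n : ℝ) + 2 * s))).aestronglyMeasurable ?_
      refine (ae_restrict_mem hbm).mono fun y hy => ?_
      rw [one_mul, Real.norm_of_nonneg (by positivity)]
      exact Real.rpow_le_rpow_of_nonpos hl (hb y hy).2.1 (by linarith [hs.1, n.cast_nonneg (α := ℝ)])
    · rw [one_mul]
      exact Real.rpow_le_rpow_of_nonpos (hl.trans_le (hb y hy).2.1) (hb y hy).2.2
        (by linarith [hs.1, n.cast_nonneg (α := ℝ)])
  have e4 : (jumpX n s Cns h).real b ≤ (jumpX n s Cns h).real {y | l ≤ |y i|} :=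
    measureReal_mono fun y hy => (hb y hy).1
  refine le_trans ?_ e4
  rw [e, e2]
  have e5 : l ^ n * (3 * l) ^ (-((n : ℝ) + 2 * s)) = 3 ^ (-((n : ℝ) + 2 * s)) * l ^ (-(2 * s)) := by
    rw [Real.mul_rpow (by norm_num) hl.le, mul_left_comm, ← Real.rpow_natCast, ← Real.rpow_add hl]
    congr 2
    ring
  rw [hvol] at e3
  have e6 := mul_le_mul_of_nonneg_left e3 hC
  have e7 : 0 ≤ (latt n h).real b := measureReal_nonneg
  calc _ = Cns * (l ^ n * (3 * l) ^ (-((n : ℝ) + 2 * s)) *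
        volume.real (Metric.ball (0 : En n) 1)) := by rw [e5]; ring
    _ ≤ _ := by nlinarith

end SpatialJumps

section TailIntegrability

theorem one_add_norm_rpow_le {V : Type*} [NormedAddCommGroup V] {p h : ℝ} (hp : 0 ≤ p) (hh : 0 < h)
    {x ζ : V} (hζ : h ≤ ‖ζ‖) :
    1 + ‖x + ζ‖ ^ p ≤ (h⁻¹ ^ p + (‖x‖ / h + 1) ^ p) * ‖ζ‖ ^ p := by
  have h0 : 0 < ‖ζ‖ := hh.trans_le hζ
  have h1 : 1 ≤ h⁻¹ * ‖ζ‖ := by rw [← div_eq_inv_mul, one_le_div hh]; exact hζ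
  have h2 : ‖x + ζ‖ ≤ (‖x‖ / h + 1) * ‖ζ‖ := by
    have : ‖x‖ ≤ ‖x‖ / h * ‖ζ‖ := by
      rw [div_eq_mul_inv, mul_assoc]
      exact le_mul_of_one_le_right (norm_nonneg _) h1
    linarith [norm_add_le x ζ]
  rw [add_mul, ← Real.mul_rpow (by positivity) h0.le, ← Real.mul_rpow (by positivity) h0.le]
  exact add_le_add (Real.one_le_rpow h1 hp) (Real.rpow_le_rpow (norm_nonneg _) h2 hp)

theorem integrableOn_shift_mul_rpow {V : Type*} [NormedAddCommGroup V] [MeasureSpace V]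
    [BorelSpace V] [SecondCountableTopology V] [(volume : Measure V).IsAddLeftInvariant]
    {u : V → ℝ} {S : Set V} {p h : ℝ} (hp : 0 ≤ p)
    (hh : 0 < h) (hS : MeasurableSet S) (hu : AEStronglyMeasurable u volume)
    (hi : IntegrableOn (fun y => u y / (1 + ‖y‖ ^ p)) S) (x : V) :
    IntegrableOn (fun ζ => u (x + ζ) * ‖ζ‖ ^ (-p)) ({ζ | x + ζ ∈ S} ∩ {ζ | h ≤ ‖ζ‖}) := by
  have h1 := ((integrable_indicator_iff hS).2 hi).comp_add_left x
  have hT : MeasurableSet {ζ | x + ζ ∈ S} := measurable_const_add x hS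
  have hR : MeasurableSet {ζ : V | h ≤ ‖ζ‖} := measurableSet_le measurable_const measurable_norm
  have hm : AEStronglyMeasurable (fun ζ => u (x + ζ)) volume :=
    hu.comp_measurePreserving (measurePreserving_add_left volume x)
  have hn : Measurable fun ζ : V => ‖ζ‖ ^ (-p) := by fun_prop
  refine (h1.norm.const_mul (h⁻¹ ^ p + (‖x‖ / h + 1) ^ p)).integrableOn.mono'
    (hm.mul hn.aestronglyMeasurable).restrict ?_
  refine (ae_restrict_mem (hT.inter hR)).mono fun ζ hζ => ?_
  have h0 : 0 < ‖ζ‖ := hh.trans_le hζ.2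
  have h2 : 0 < 1 + ‖x + ζ‖ ^ p := by positivity
  rw [indicator_of_mem (show x + ζ ∈ S from hζ.1), norm_mul, norm_div,
    Real.norm_of_nonneg h2.le, Real.norm_of_nonneg (by positivity : 0 ≤ ‖ζ‖ ^ (-p)),
    Real.rpow_neg h0.le, ← div_eq_mul_inv, mul_div_assoc', div_le_div_iff₀ (by positivity) h2]
  calc ‖u (x + ζ)‖ * (1 + ‖x + ζ‖ ^ p)
      ≤ ‖u (x + ζ)‖ * ((h⁻¹ ^ p + (‖x‖ / h + 1) ^ p) * ‖ζ‖ ^ p) :=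
        mul_le_mul_of_nonneg_left (one_add_norm_rpow_le hp hh hζ.2) (norm_nonneg _)
    _ = _ := by ring

theorem tendsto_integral_trunc {V : Type*} [NormedAddCommGroup V] [MeasurableSpace V]
    [BorelSpace V] {ρ : Measure V} {f : V → ℝ} (hf : Integrable f ρ) (h0 : ∀ᵐ y ∂ρ, y ≠ 0) :
    Tendsto (fun h => ∫ y, f y ∂trunc ρ h) (nhdsWithin 0 (Ioi 0)) (nhds (∫ y, f y ∂ρ)) := by
  simp_rw [trunc, ← integral_indicator (measurableSet_trunc _)]
  refine tendsto_integral_filter_of_dominated_convergence (fun y => ‖f y‖)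
    (Eventually.of_forall fun b => hf.aestronglyMeasurable.indicator (measurableSet_trunc b))
    (Eventually.of_forall fun b => Eventually.of_forall fun y => norm_indicator_le_norm_self _ _)
    hf.norm (h0.mono fun y hy => ?_)
  refine tendsto_const_nhds.congr' ?_
  filter_upwards [Ioc_mem_nhdsGT (norm_pos_iff.2 hy)] with b hb
  rw [indicator_of_mem (show y ∈ {y | 0 < b ∧ b ≤ ‖y‖} from hb)]

end TailIntegrability

section ClassicalTime

/-- Backward jumps by `h`, at rate `h⁻¹`. -/
def backJump (h : ℝ) : Measure ℝ := ENNReal.ofReal h⁻¹ • Measure.dirac (-h)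

instance isFiniteMeasure_backJump (h : ℝ) : IsFiniteMeasure (backJump h) := by
  refine ⟨?_⟩
  rw [backJump, Measure.smul_apply]
  exact ENNReal.mul_lt_top ENNReal.ofReal_lt_top (measure_lt_top _ _)

theorem integrable_backJump (f : ℝ → ℝ) (h : ℝ) : Integrable f (backJump h) :=
  (integrable_dirac (by simp)).smul_measure ENNReal.ofReal_ne_top

theorem integral_backJump (f : ℝ → ℝ) {h : ℝ} (hh : 0 < h) :
    ∫ τ, f τ ∂backJump h = h⁻¹ * f (-h) := by
  rw [backJump, integral_smul_measure, integral_dirac, ENNReal.toReal_ofReal (by positivity),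
    smul_eq_mul]

theorem backJump_univ (h : ℝ) : backJump h univ = ENNReal.ofReal h⁻¹ := by
  simp [backJump]

theorem ae_backJump_neg (h : ℝ) : ∀ᵐ τ ∂backJump h, τ < 0 := by
  by_cases hh : 0 < h
  · exact Measure.ae_smul_measure
      ((ae_dirac_iff measurableSet_Iio).2 (by simpa using hh : -h < 0)) _
  · rw [backJump, ENNReal.ofReal_of_nonpos (inv_nonpos.2 (not_lt.1 hh)), zero_smul]
    simp

theorem nice_backJump (θ : ContDiffBump (0 : ℝ)) : Nice backJump (moll θ) := by
  intro ε hε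
  obtain ⟨u, hu, H⟩ := exists_diff_quotient_cauchy θ hε
  refine ⟨u, hu, fun h h' a1 a2 a3 a4 f hf h1 t => ?_⟩
  rw [gen, gen, integral_backJump _ a1, integral_backJump _ a3]
  exact H h h' a1 a2 a3 a4 f hf h1 t

theorem backJump_potential {h : ℝ} (hh : 0 < h) (τ : ℝ) :
    (∫⁻ σ, abelKer 1 (τ + σ) ∂backJump h) + backJump h univ * abelNear 1 h τ ≤
      backJump h univ * abelKer 1 τ := by
  rw [backJump_univ, backJump, lintegral_smul_measure, lintegral_dirac, smul_eq_mul, ← mul_add]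
  gcongr
  by_cases h1 : τ ≤ h
  · rw [abelNear, indicator_of_mem (by exact h1), abelKer, if_neg (by linarith), zero_add]
  · have h2 := not_le.1 h1
    rw [abelNear, indicator_of_notMem (by exact h1), add_zero, abelKer, abelKer,
      if_pos (by linarith), if_pos (by linarith)]
    simp

theorem tendsto_gen_backJump {v : ℝ → ℝ} (hv : ContDiff ℝ 1 v) (t : ℝ) :
    Tendsto (fun h => gen (backJump h) v t) (nhdsWithin 0 (Ioi 0)) (nhds (-deriv v t)) := by
  have hd := (hv.differentiable one_ne_zero t).hasDerivAt
  have h1 : HasDerivAt (fun h => v (t + -h)) (-deriv v t) 0 := by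
    have h2 : HasDerivAt (fun h : ℝ => t + -h) (-1) 0 := (hasDerivAt_neg 0).const_add t
    have h3 : HasDerivAt v (deriv v t) (t + -0) := by simpa using hd
    have h4 := h3.comp (0 : ℝ) h2
    rw [mul_neg_one] at h4
    exact h4
  have h4 := (hasDerivAt_iff_tendsto_slope.1 h1).mono_left
    (nhdsWithin_mono 0 (fun x (hx : 0 < x) => hx.ne') : nhdsWithin (0 : ℝ) (Ioi 0) ≤ _)
  refine h4.congr' ?_
  filter_upwards [self_mem_nhdsWithin] with h hh
  rw [gen, integral_backJump _ hh, slope_def_field]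
  simp [div_eq_inv_mul]

end ClassicalTime

section MarchaudTime

variable {α : ℝ}

/-- The Lévy measure of the Marchaud derivative. -/
def marchMeas (α : ℝ) : Measure ℝ :=
  (powMeas ℝ (α / Real.Gamma (1 - α)) (1 + α)).restrict (Iio 0)

theorem marchaud_const_pos (hα : 0 < α) (hα1 : α < 1) : 0 < α / Real.Gamma (1 - α) :=
  div_pos hα (Real.Gamma_pos_of_pos (by linarith))

theorem integrable_min_marchMeas (hα : 0 < α) (hα1 : α < 1) :
    Integrable (fun τ : ℝ => min 1 (‖τ‖ ^ 1)) (marchMeas α) := by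
  have h := integrable_min_mul_rpow (V := ℝ) (p := 1) (q := α) hα (by simpa using hα1)
  rw [Module.finrank_self, Nat.cast_one] at h
  exact (integrable_powMeas (marchaud_const_pos hα hα1).le h).restrict

theorem ae_marchMeas_neg : ∀ᵐ τ ∂marchMeas α, τ < 0 := ae_restrict_mem measurableSet_Iio

theorem trunc_marchMeas {h : ℝ} (hh : 0 < h) : trunc (marchMeas α) h =
    (powMeas ℝ (α / Real.Gamma (1 - α)) (1 + α)).restrict (Iic (-h)) := by
  rw [trunc, marchMeas, Measure.restrict_restrict (measurableSet_trunc h)]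
  congr 1
  ext τ
  simp only [mem_inter_iff, Set.mem_ofPred_eq, mem_Iio, mem_Iic, hh, true_and, Real.norm_eq_abs]
  constructor
  · rintro ⟨h1, h2⟩
    rw [abs_of_neg h2] at h1
    linarith
  · intro h1
    have h2 : τ < 0 := by linarith
    rw [abs_of_neg h2]
    exact ⟨by linarith, h2⟩

theorem integral_trunc_marchMeas (hα : 0 < α) (hα1 : α < 1) {h : ℝ} (hh : 0 < h) (f : ℝ → ℝ) :
    ∫ τ, f τ ∂trunc (marchMeas α) h =
      α / Real.Gamma (1 - α) * ∫ τ in Iic (-h), f τ * ‖τ‖ ^ (-(1 + α)) := by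
  rw [trunc_marchMeas hh, setIntegral_powMeas (marchaud_const_pos hα hα1).le _ measurableSet_Iic]

theorem lintegral_trunc_marchMeas {h : ℝ} (hh : 0 < h) {f : ℝ → ENNReal} (hf : Measurable f) :
    ∫⁻ τ, f τ ∂trunc (marchMeas α) h = ∫⁻ w in Ici h,
      ENNReal.ofReal (α / Real.Gamma (1 - α) * w ^ (-(1 + α))) * f (-w) := by
  have hm : Measurable fun τ : ℝ => ENNReal.ofReal (α / Real.Gamma (1 - α) * ‖τ‖ ^ (-(1 + α))) :=
    measurable_powDensity
  rw [trunc_marchMeas hh, powMeas, restrict_withDensity measurableSet_Iic,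
    lintegral_withDensity_eq_lintegral_mul _ hm hf, ← lintegral_indicator measurableSet_Iic,
    ← lintegral_neg_eq_self, ← lintegral_indicator measurableSet_Ici]
  refine lintegral_congr fun w => ?_
  by_cases hw : h ≤ w
  · rw [indicator_of_mem (show -w ∈ Iic (-h) from neg_le_neg hw), indicator_of_mem (by exact hw),
      Pi.mul_apply, norm_neg, Real.norm_of_nonneg (hh.le.trans hw)]
  · rw [indicator_of_notMem (show -w ∉ Iic (-h) from fun h' => hw (neg_le_neg_iff.1 h')),
      indicator_of_notMem (by exact hw)]

theorem trunc_marchMeas_univ (hα : 0 < α) (hα1 : α < 1) {h : ℝ} (hh : 0 < h) :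
    trunc (marchMeas α) h univ = ENNReal.ofReal (α / Real.Gamma (1 - α) * (h ^ (-α) / α)) := by
  have hc := marchaud_const_pos hα hα1
  have h1 := lintegral_trunc_marchMeas (α := α) hh (f := fun _ => 1) measurable_const
  rw [lintegral_one] at h1
  simp only [mul_one] at h1
  have hi := (integrableOn_Ioi_rpow_of_lt (by linarith : -(1 + α) < -1) hh).const_mul
    (α / Real.Gamma (1 - α))
  rw [h1, setLIntegral_congr Ioi_ae_eq_Ici.symm, ← ofReal_integral_eq_lintegral_ofReal hi
    ((ae_restrict_mem measurableSet_Ioi).mono fun w hw =>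
      mul_nonneg hc.le (Real.rpow_nonneg (hh.le.trans (le_of_lt hw)) _)),
    integral_const_mul, integral_Ioi_rpow_of_lt (by linarith) hh,
    show -(1 + α) + 1 = -α by ring, neg_div_neg_eq]

theorem integrableOn_beta (hα : 0 < α) {h τ : ℝ} (hh : 0 < h) (hτ : h < τ) :
    IntegrableOn (fun w => (τ - w) ^ (α - 1) * w ^ (-(1 + α))) (Ioc h τ) ∧
    ∫ w in Ioc h τ, (τ - w) ^ (α - 1) * w ^ (-(1 + α)) ≤ τ ^ (α - 1) * (h ^ (-α) / α) := by
  have hτ0 : 0 < τ := hh.trans hτ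
  set F : ℝ → ℝ := fun w => -(1 / (α * τ)) * ((τ - w) / w) ^ α
  have hc : ContinuousOn F (Icc h τ) := by
    refine continuousOn_const.mul (ContinuousOn.rpow_const ?_ fun w _ => Or.inr hα.le)
    exact ((continuousOn_const.sub continuousOn_id).div continuousOn_id) fun w hw =>
      (hh.trans_le hw.1).ne'
  have hd : ∀ w ∈ Ioo h τ, HasDerivAt F ((τ - w) ^ (α - 1) * w ^ (-(1 + α))) w := by
    intro w hw
    have hw0 : 0 < w := hh.trans hw.1
    have hw1 : 0 < τ - w := sub_pos.2 hw.2
    have h1 : HasDerivAt (fun w => (τ - w) / w) ((-1 * w - (τ - w) * 1) / w ^ 2) w :=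
      ((hasDerivAt_id w).const_sub τ).div (hasDerivAt_id w) hw0.ne'
    have h2 := (h1.rpow_const (p := α) (Or.inl (div_pos hw1 hw0).ne')).const_mul (-(1 / (α * τ)))
    refine h2.congr_deriv ?_
    rw [Real.div_rpow hw1.le hw0.le, Real.rpow_neg hw0.le, Real.rpow_add hw0, Real.rpow_one,
      Real.rpow_sub hw0, Real.rpow_one]
    have := Real.rpow_pos_of_pos hw0 α
    field_simp
    ring
  have h0 : ∀ w ∈ Ioo h τ, 0 ≤ (τ - w) ^ (α - 1) * w ^ (-(1 + α)) := fun w hw =>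
    mul_nonneg (Real.rpow_nonneg (sub_nonneg.2 hw.2.le) _)
      (Real.rpow_nonneg (hh.le.trans hw.1.le) _)
  have hi := intervalIntegral.integrableOn_deriv_of_nonneg hc hd h0
  refine ⟨hi, ?_⟩
  rw [← intervalIntegral.integral_of_le hτ.le, intervalIntegral.integral_eq_sub_of_hasDerivAt_of_le
    hτ.le hc hd ((intervalIntegrable_iff_integrableOn_Ioc_of_le hτ.le).2 hi)]
  simp only [F, sub_self, zero_div, Real.zero_rpow hα.ne', mul_zero, zero_sub]
  rw [Real.div_rpow (sub_nonneg.2 hτ.le) hh.le, Real.rpow_neg hh.le, Real.rpow_sub hτ0,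
    Real.rpow_one]
  have h1 : (τ - h) ^ α ≤ τ ^ α := Real.rpow_le_rpow (sub_nonneg.2 hτ.le) (by linarith) hα.le
  have h2 := Real.rpow_pos_of_pos hh α
  calc -(-(1 / (α * τ)) * ((τ - h) ^ α / h ^ α)) = (τ - h) ^ α * (1 / (α * τ * h ^ α)) := by
        field_simp
    _ ≤ τ ^ α * (1 / (α * τ * h ^ α)) := by gcongr
    _ = _ := by field_simp

theorem marchMeas_potential (hα : 0 < α) (hα1 : α < 1) {h : ℝ} (hh : 0 < h) (τ : ℝ) :
    (∫⁻ σ, abelKer α (τ + σ) ∂trunc (marchMeas α) h) +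
      trunc (marchMeas α) h univ * abelNear α h τ ≤ trunc (marchMeas α) h univ * abelKer α τ := by
  have hc := marchaud_const_pos hα hα1
  have hm : Measurable fun σ => abelKer α (τ + σ) :=
    measurable_abelKer.comp (measurable_const_add τ)
  rw [lintegral_trunc_marchMeas hh hm]
  by_cases h1 : τ ≤ h
  · rw [abelNear, indicator_of_mem (by exact h1), setLIntegral_congr_fun (g := fun _ => 0)
      measurableSet_Ici fun w (hw : h ≤ w) => ?_]
    · simp
    · simp only
      rw [abelKer, if_neg (by linarith), mul_zero]
  · have h2 := not_le.1 h1
    obtain ⟨hi, hle⟩ := integrableOn_beta hα hh h2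
    rw [abelNear, indicator_of_notMem (by exact h1), mul_zero, add_zero,
      trunc_marchMeas_univ hα hα1 hh, abelKer, if_pos (by linarith), ← ENNReal.ofReal_mul
      (by positivity)]
    have e : ∫⁻ w in Ici h, ENNReal.ofReal (α / Real.Gamma (1 - α) * w ^ (-(1 + α))) *
        abelKer α (τ + -w) = ∫⁻ w in Ioc h τ, ENNReal.ofReal (α / Real.Gamma (1 - α) *
          ((τ - w) ^ (α - 1) * w ^ (-(1 + α)))) := by
      rw [setLIntegral_congr Ioi_ae_eq_Ici.symm, setLIntegral_congr Ioo_ae_eq_Ioc.symm,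
        ← lintegral_indicator measurableSet_Ioi, ← lintegral_indicator measurableSet_Ioo]
      refine lintegral_congr fun w => ?_
      by_cases hw : h < w
      · rw [indicator_of_mem (by exact hw)]
        have hw0 : 0 < w := hh.trans hw
        by_cases hw' : w < τ
        · rw [indicator_of_mem (by exact ⟨hw, hw'⟩), abelKer, if_pos (by linarith),
            ← ENNReal.ofReal_mul (by positivity), ← sub_eq_add_neg]
          congr 1
          ring
        · rw [indicator_of_notMem (fun h' => hw' h'.2), abelKer, if_neg (by linarith), mul_zero]
      · rw [indicator_of_notMem (by exact hw), indicator_of_notMem (fun h' => hw h'.1)]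
    rw [e, ← ofReal_integral_eq_lintegral_ofReal (hi.const_mul _)
      ((ae_restrict_mem measurableSet_Ioc).mono fun w hw => ?_), integral_const_mul]
    · refine ENNReal.ofReal_le_ofReal ?_
      calc _ ≤ α / Real.Gamma (1 - α) * (τ ^ (α - 1) * (h ^ (-α) / α)) := by gcongr
        _ = _ := by ring
    · exact mul_nonneg hc.le (mul_nonneg (Real.rpow_nonneg (sub_nonneg.2 hw.2) _)
        (Real.rpow_nonneg (hh.le.trans hw.1.le) _))

/-- Averages against an integrable density that is monotone on a half-line and zero beyond it are
Lipschitz. -/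
theorem abs_integral_mul_sub_le {K : ℝ → ℝ} {a M : ℝ} (hK : Integrable K)
    (hmono : MonotoneOn K (Iic a)) (hzero : ∀ u, a < u → K u = 0) (hK0 : ∀ u, 0 ≤ K u)
    (hKM : ∀ u, K u ≤ M) {f : ℝ → ℝ} (hf : Measurable f) (hb : ∀ t, |f t| ≤ 1) (t t' : ℝ) :
    |(∫ ζ, f (t + ζ) * K ζ) - ∫ ζ, f (t' + ζ) * K ζ| ≤ 2 * M * |t - t'| := by
  wlog htt : t' ≤ t generalizing t t'
  · rw [abs_sub_comm, abs_sub_comm t]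
    exact this t' t (not_le.1 htt).le
  set δ := t - t'
  have hδ : 0 ≤ δ := sub_nonneg.2 htt
  have e1 : ∫ ζ, f (t + ζ) * K ζ = ∫ u, f (t' + u) * K (u - δ) := by
    rw [← integral_sub_right_eq_self (fun ζ => f (t + ζ) * K ζ) δ]
    refine integral_congr_ae (Eventually.of_forall fun u => ?_)
    simp only [δ]
    congr 2
    ring
  have hKδ : Integrable fun u => K (u - δ) := hK.comp_sub_right δ
  have hfm : AEStronglyMeasurable (fun u => f (t' + u)) volume :=
    (hf.comp (measurable_const_add t')).aestronglyMeasurable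
  have hfb : ∀ᵐ u, ‖f (t' + u)‖ ≤ 1 := Eventually.of_forall fun u => hb _
  rw [e1, ← integral_sub (hKδ.bdd_mul hfm hfb) (hK.bdd_mul hfm hfb)]
  have hI : Integrable ((Ioc a (a + δ)).indicator fun _ => 2 * M) :=
    (integrable_indicator_iff measurableSet_Ioc).2 (integrableOn_const measure_Ioc_lt_top.ne)
  rw [← Real.norm_eq_abs]
  have hM : 0 ≤ M := (hK0 0).trans (hKM 0)
  refine (norm_integral_le_of_norm_le ((hK.sub hKδ).add hI)
    (Eventually.of_forall fun u => ?_)).trans (le_of_eq ?_)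
  · rw [← mul_sub, norm_mul]
    refine (mul_le_of_le_one_left (norm_nonneg _) (hb _)).trans ?_
    rw [Real.norm_eq_abs, Pi.add_apply, Pi.sub_apply]
    rcases le_or_gt u a with hu | hu
    · have := hmono (show u - δ ∈ Iic a by simp only [mem_Iic]; linarith) hu (by linarith)
      rw [abs_sub_comm, abs_of_nonneg (by linarith)]
      exact le_add_of_nonneg_right (indicator_nonneg (fun _ _ => by positivity) _)
    · rw [hzero u hu, sub_zero, abs_of_nonneg (hK0 _), zero_sub]
      by_cases hu' : u ≤ a + δ
      · rw [indicator_of_mem (by exact ⟨hu, hu'⟩)]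
        linarith [hKM (u - δ)]
      · rw [hzero _ (by linarith [not_le.1 hu']), indicator_of_notMem (fun h => hu' h.2)]
        simp
  · rw [integral_add' (hK.sub hKδ) hI, integral_sub' hK hKδ, integral_sub_right_eq_self K δ, sub_self,
      zero_add, integral_indicator measurableSet_Ioc, setIntegral_const]
    simp [measureReal_def, abs_of_nonneg hδ, hδ]
    ring

theorem exists_lipschitz_avg_trunc_marchMeas (hα : 0 < α) (hα1 : α < 1) {r : ℝ} (hr : 0 < r) :
    ∃ L, 0 ≤ L ∧ ∀ f : ℝ → ℝ, Measurable f → (∀ t, |f t| ≤ 1) →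
      ∀ t t', |avg (trunc (marchMeas α) r) f t - avg (trunc (marchMeas α) r) f t'| ≤
        L * |t - t'| := by
  have hc := marchaud_const_pos hα hα1
  set K : ℝ → ℝ := (Iic (-r)).indicator fun τ =>
    α / Real.Gamma (1 - α) * (-τ) ^ (-(1 + α))
  have hmem : ∀ {u}, u ≤ -r → K u = α / Real.Gamma (1 - α) * (-u) ^ (-(1 + α)) := fun hu =>
    indicator_of_mem (by exact hu) _
  have hout : ∀ {u}, -r < u → K u = 0 := fun hu => indicator_of_notMem (by simpa using hu) _
  have hle : ∀ {u}, u ≤ -r → ∀ {w}, u ≤ w → w ≤ -r →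
      α / Real.Gamma (1 - α) * (-u) ^ (-(1 + α)) ≤ α / Real.Gamma (1 - α) * (-w) ^ (-(1 + α)) :=
    fun hu w hw hwr => mul_le_mul_of_nonneg_left
      (Real.rpow_le_rpow_of_nonpos (by linarith) (by linarith) (by linarith)) hc.le
  have hK : Integrable K := by
    have := (integrableOn_Ioi_rpow_of_lt (by linarith : -(1 + α) < -1) hr).const_mul
      (α / Real.Gamma (1 - α))
    refine ((integrable_indicator_iff measurableSet_Ioi).2 this).comp_neg.congr ?_
    have hne : ∀ᵐ u : ℝ, u ≠ -r := by simp [ae_iff]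
    filter_upwards [hne] with u hu
    rcases lt_or_gt_of_ne hu with h1 | h1
    · rw [indicator_of_mem (show -u ∈ Ioi r from lt_neg.1 h1), hmem h1.le]
    · rw [indicator_of_notMem (show -u ∉ Ioi r from fun h2 => absurd (lt_neg.1 h2) (not_lt.2 h1.le)),
        hout h1]
  refine ⟨2 * (α / Real.Gamma (1 - α) * r ^ (-(1 + α))), by positivity, fun f hf hb t t' => ?_⟩
  have e : ∀ t, avg (trunc (marchMeas α) r) f t = ∫ ζ, f (t + ζ) * K ζ := by
    intro t
    rw [avg, integral_trunc_marchMeas hα hα1 hr, ← integral_indicator measurableSet_Iic,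
      ← integral_const_mul]
    refine integral_congr_ae (Eventually.of_forall fun ζ => ?_)
    simp only
    rcases le_or_gt ζ (-r) with h1 | h1
    · rw [indicator_of_mem (by exact h1), hmem h1, Real.norm_of_nonpos (by linarith)]
      ring
    · rw [indicator_of_notMem (by simpa using h1), hout h1]
      simp
  rw [e, e]
  refine abs_integral_mul_sub_le hK (a := -r) ?_ (fun u hu => hout hu) (fun u => ?_) (fun u => ?_)
    hf hb t t'
  · intro u hu w hw huw
    rw [hmem hu, hmem hw]
    exact hle hu huw hw
  · exact indicator_nonneg (fun τ (hτ : τ ≤ -r) =>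
      mul_nonneg hc.le (Real.rpow_nonneg (by linarith) _)) _
  · rcases le_or_gt u (-r) with hu | hu
    · rw [hmem hu]
      simpa using hle hu hu le_rfl
    · rw [hout hu]
      positivity

end MarchaudTime

section JumpFamilies

variable {α : ℝ}

theorem integrableOn_powMeas {V : Type*} [NormedAddCommGroup V] [MeasureSpace V] [BorelSpace V]
    {c a : ℝ} (hc : 0 ≤ c) {f : V → ℝ} {S : Set V} (hS : MeasurableSet S)
    (hf : IntegrableOn (fun y => f y * ‖y‖ ^ (-a)) S) : IntegrableOn f S (powMeas V c a) := by
  rw [← integrable_indicator_iff hS] at hf ⊢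
  refine integrable_powMeas hc (hf.congr (Eventually.of_forall fun y => ?_))
  by_cases hy : y ∈ S <;> simp [hy]

theorem exists_increment_bound {v : ℝ → ℝ} (hv : ContDiff ℝ 1 v) (t : ℝ) :
    ∃ L, 0 ≤ L ∧ ∀ ζ ∈ Icc (-1 : ℝ) 0, |v (t + ζ) - v t| ≤ L * |ζ| := by
  obtain ⟨L, hL⟩ := (isCompact_Icc (a := t - 1) (b := t)).exists_bound_of_continuousOn
    (hv.continuous_deriv le_rfl).continuousOn
  refine ⟨|L|, abs_nonneg _, fun ζ hζ => ?_⟩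
  have := (convex_Icc (t - 1) t).norm_image_sub_le_of_norm_deriv_le (f := v) (C := |L|)
    (x := t) (y := t + ζ) (fun x _ => hv.differentiable one_ne_zero x)
    (fun x hx => (hL x hx).trans (le_abs_self L)) ⟨by linarith, le_rfl⟩
    ⟨by linarith [hζ.1], by linarith [hζ.2]⟩
  simpa using this

theorem integrable_increment_marchMeas (hα : 0 < α) (hα1 : α < 1) {v : ℝ → ℝ}
    (hv : ContDiff ℝ 1 v) (hl : MemLminus α v) (t : ℝ) :
    Integrable (fun ζ => v (t + ζ) - v t) (marchMeas α) := by
  have hc := marchaud_const_pos hα hα1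
  have hbase := integrable_min_mul_rpow (V := ℝ) (p := 1) (q := α) hα (by simpa using hα1)
  rw [Module.finrank_self, Nat.cast_one] at hbase
  refine integrableOn_powMeas hc.le measurableSet_Iio ?_
  have hm : Measurable fun ζ => v (t + ζ) - v t := by
    have := hv.continuous
    fun_prop
  have hn : Measurable fun ζ : ℝ => ‖ζ‖ ^ (-(1 + α)) := by fun_prop
  rw [← Iio_union_Ico_eq_Iio (show (-1 : ℝ) ≤ 0 by norm_num)]
  refine IntegrableOn.union ?_ ?_
  · have h1 := integrableOn_shift_mul_rpow (S := Iio t) (p := 1 + α) (h := 1) (by linarith) one_pos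
      measurableSet_Iio hv.continuous.aestronglyMeasurable (hl.2 t) t
    have hsub : Iio (-1 : ℝ) ⊆ {ζ | t + ζ ∈ Iio t} ∩ {ζ | 1 ≤ ‖ζ‖} := fun ζ (hζ : ζ < -1) => by
      refine ⟨by simp only [Set.mem_ofPred_eq, mem_Iio]; linarith, ?_⟩
      simp only [Set.mem_ofPred_eq, Real.norm_eq_abs]
      rw [abs_of_neg (by linarith)]
      linarith
    refine ((h1.mono_set hsub).sub (hbase.const_mul (v t)).integrableOn).congr_fun (fun ζ hζ => ?_)
      measurableSet_Iio
    have h2 : 1 ≤ ‖ζ‖ := (hsub hζ).2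
    simp only [Pi.sub_apply, pow_one]
    rw [min_eq_left h2]
    ring
  · obtain ⟨L, hL0, hL⟩ := exists_increment_bound hv t
    refine (hbase.const_mul L).integrableOn.mono' (hm.mul hn).aestronglyMeasurable
      ((ae_restrict_mem measurableSet_Ico).mono fun ζ hζ => ?_)
    have h2 : ‖ζ‖ ≤ 1 := by
      rw [Real.norm_eq_abs, abs_le]
      exact ⟨hζ.1, by linarith [hζ.2]⟩
    rw [pow_one, min_eq_right h2, norm_mul, Real.norm_of_nonneg 
      (by positivity : 0 ≤ ‖ζ‖ ^ (-(1 + α))),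
      ← mul_assoc]
    exact mul_le_mul_of_nonneg_right (hL ζ ⟨hζ.1, hζ.2.le⟩) (by positivity)

theorem tendsto_gen_marchMeas (hα : 0 < α) (hα1 : α < 1) {v : ℝ → ℝ}
    (hv : ContDiff ℝ 1 v) (hl : MemLminus α v) (t : ℝ) :
    Tendsto (fun h => gen (trunc (marchMeas α) h) v t) (nhdsWithin 0 (Ioi 0))
      (nhds (-marchaud α v t)) := by
  have hc := marchaud_const_pos hα hα1
  have h := tendsto_integral_trunc (integrable_increment_marchMeas hα hα1 hv hl t)
    (ae_marchMeas_neg.mono fun y hy => hy.ne)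
  have e : ∫ ζ, (v (t + ζ) - v t) ∂marchMeas α = -marchaud α v t := by
    rw [marchMeas, setIntegral_powMeas hc.le _ measurableSet_Iio, marchaud, if_neg hα1.ne,
      ← mul_neg, ← integral_neg, ← integral_indicator measurableSet_Iio,
      ← integral_indicator measurableSet_Iio, ← integral_add_left_eq_self
      ((Iio t).indicator fun a => -((v t - v a) / (t - a) ^ (1 + α))) t]
    congr 1
    refine integral_congr_ae (Eventually.of_forall fun ζ => ?_)
    simp only
    by_cases hζ : ζ < 0
    · rw [indicator_of_mem (by exact hζ), indicator_of_mem (show t + ζ ∈ Iio t by simpa using hζ),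
        Real.norm_of_nonpos hζ.le, Real.rpow_neg (by linarith), ← div_eq_mul_inv, ← neg_div, neg_sub,
        sub_add_cancel_left]
    · rw [indicator_of_notMem (by exact hζ),
        indicator_of_notMem (show t + ζ ∉ Iio t by simpa using hζ)]
  rw [e] at h
  exact h

/-- The mixed operator `Δ - (-Δ)ˢ - ∂ₜᵅ` is approximated by a jump family. -/
theorem exists_jumpFamily {n : ℕ} (hn : 1 ≤ n) {s Cns : ℝ} (hs : s ∈ Ioo (0 : ℝ) 1) (hC : 0 ≤ Cns)
    (hα : 0 < α) (hα1 : α ≤ 1) : ∃ J : JumpFamily n, J.σ = jumpX n s Cns ∧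
      ∀ v : ℝ → ℝ, ContDiff ℝ 1 v → MemLminus α v → ∀ t,
        (∀ h, Integrable (fun τ => v (t + τ)) (J.ν h)) ∧
        Tendsto (fun h => gen (J.ν h) v t) (nhdsWithin 0 (Ioi 0)) (nhds (-marchaud α v t)) := by
  rcases hα1.eq_or_lt with rfl | hα1
  · refine ⟨{ σ := jumpX n s Cns, ν := backJump, far := fun _ => 0,
              finσ := isFiniteMeasure_jumpX hn hs hC, finν := inferInstance
              finfar := fun _ => inferInstance
              causal := ae_backJump_neg, moment := ?_
              niceX := nice_jumpX hn hs hC, niceT := nice_backJump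
              far_eq := ?_, far_lip := ?_, pot := ?_ }, rfl, fun v hv hl t =>
      ⟨fun h => integrable_backJump _ h, ?_⟩⟩
    · refine ⟨1, zero_le_one, fun h h0 h1 => ?_⟩
      rw [integral_backJump _ h0, abs_neg, abs_of_pos h0, min_eq_right h1.le,
        inv_mul_cancel₀ h0.ne']
    · intro h r h0 hr
      rw [Measure.restrict_eq_zero, backJump, Measure.smul_apply,
        Measure.dirac_apply' _ measurableSet_Iic, indicator_of_notMem (by simpa using hr)]
      simp
    · exact fun r _ => ⟨0, le_rfl, fun f _ _ t t' => by simp [avg]⟩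
    · refine exists_abel_potential hα le_rfl (m := 1) one_pos (fun h h0 _ => ?_)
        fun h h0 _ => backJump_potential h0
      rw [measureReal_def, backJump_univ, ENNReal.toReal_ofReal (by positivity), Real.rpow_one,
        div_one, inv_mul_cancel₀ h0.ne']
    · rw [marchaud, if_pos rfl]
      exact tendsto_gen_backJump hv t
  · have hc := marchaud_const_pos hα hα1
    have hmin := integrable_min_marchMeas hα hα1
    have hfin := isFiniteMeasure_trunc hmin
    refine ⟨{ σ := jumpX n s Cns, ν := trunc (marchMeas α), far := trunc (marchMeas α),
              finσ := isFiniteMeasure_jumpX hn hs hC, finν := hfin, finfar := hfin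
              causal := fun h => ae_restrict_of_ae ae_marchMeas_neg, moment := ?_
              niceX := nice_jumpX hn hs hC, niceT := nice_trunc_of_lipschitz hmin
              far_eq := ?_, far_lip := fun r hr => exists_lipschitz_avg_trunc_marchMeas hα hα1 hr
              pot := ?_ }, rfl, fun v hv hl t => ⟨fun h => ?_, tendsto_gen_marchMeas hα hα1 hv hl t⟩⟩
    · refine ⟨∫ τ, min 1 |τ| ∂marchMeas α, integral_nonneg fun τ => by positivity,
        fun h h0 h1 => ?_⟩
      simp only [pow_one, Real.norm_eq_abs] at hmin
      exact setIntegral_le_integral hmin (Eventually.of_forall fun τ => by positivity)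
    · intro h r h0 hr
      rw [trunc_marchMeas h0, trunc_marchMeas (h0.trans hr),
        Measure.restrict_restrict measurableSet_Iic, inter_eq_left.2 (Iic_subset_Iic.2 (by linarith))]
    · refine exists_abel_potential hα hα1.le (m := α / Real.Gamma (1 - α) / α ^ 2) (by positivity)
        (fun h h0 _ => ?_) fun h h0 _ => marchMeas_potential hα hα1 h0
      rw [measureReal_def, trunc_marchMeas_univ hα hα1 h0, ENNReal.toReal_ofReal (by positivity),
        Real.rpow_neg h0.le]
      have := Real.rpow_pos_of_pos h0 α
      field_simp
    · have h1 := (integrable_increment_marchMeas hα hα1 hv hl t).restrict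
        (s := {y : ℝ | 0 < h ∧ h ≤ ‖y‖})
      refine (h1.add (integrable_const (μ := trunc (marchMeas α) h) (v t))).congr
        (Eventually.of_forall fun τ => ?_)
      simp

end JumpFamilies

section SpatialConsistency

theorem eventually_forall_Icc_line {V : Type*} [NormedAddCommGroup V] [NormedSpace ℝ V] {x y : V}
    {p : V → Prop} (hp : ∀ᶠ z in nhds x, p z) :
    ∀ᶠ h in nhdsWithin (0 : ℝ) (Ioi 0), ∀ r ∈ Icc (-h) h, p (x + r • y) := by
  have hc : Tendsto (fun r : ℝ => x + r • y) (nhds 0) (nhds x) := by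
    have : Continuous fun r : ℝ => x + r • y := by fun_prop
    simpa using this.tendsto 0
  obtain ⟨d, hd, H⟩ := Metric.eventually_nhds_iff.1 (hc.eventually hp)
  filter_upwards [Ioo_mem_nhdsGT hd] with h hh r hr
  refine H ?_
  rw [Real.dist_eq, sub_zero]
  exact (abs_le.2 hr).trans_lt hh.2

theorem tendsto_sdiff2_quotient {V : Type*} [NormedAddCommGroup V] [NormedSpace ℝ V] {u : V → ℝ}
    {x : V} (hu : ContDiffAt ℝ 2 u x) (y : V) :
    Tendsto (fun h : ℝ => (h ^ 2)⁻¹ * sdiff2 u x (h • y)) (nhdsWithin 0 (Ioi 0))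
      (nhds (iteratedFDeriv ℝ 2 u x fun _ => y)) := by
  rw [iteratedFDeriv_two_apply]
  have h1 : ContDiffAt ℝ 1 (fderiv ℝ u) x := hu.fderiv_right (by norm_num)
  have h2 : ContDiffAt ℝ 0 (fderiv ℝ (fderiv ℝ u)) x := h1.fderiv_right (by norm_num)
  have d1 : ∀ᶠ z in nhds x, HasFDerivAt u (fderiv ℝ u z) z :=
    (hu.eventually (by simp)).mono fun z hz => (hz.differentiableAt (by norm_num)).hasFDerivAt
  have d2 : ∀ᶠ z in nhds x, HasFDerivAt (fderiv ℝ u) (fderiv ℝ (fderiv ℝ u) z) z :=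
    (h1.eventually (by simp)).mono fun z hz => (hz.differentiableAt (by norm_num)).hasFDerivAt
  have hcont : ContinuousAt (fun z => fderiv ℝ (fderiv ℝ u) z y y) x := by
    have := h2.continuousAt
    fun_prop
  rw [Metric.tendsto_nhds]
  intro ε hε
  have d3 : ∀ᶠ z in nhds x, |fderiv ℝ (fderiv ℝ u) z y y - fderiv ℝ (fderiv ℝ u) x y y| ≤ ε / 3 :=
    (Metric.tendsto_nhds.1 hcont (ε / 3) (by positivity)).mono fun z hz => by
      rw [Real.dist_eq] at hz; exact hz.le
  filter_upwards [eventually_forall_Icc_line d1, eventually_forall_Icc_line d2,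
    eventually_forall_Icc_line d3, self_mem_nhdsWithin] with h e1 e2 e3 (hh : 0 < h)
  have key := abs_sdiff2_sub_le hh.le e1 e2 e3
  have hh2 : 0 < h ^ 2 := by positivity
  rw [Real.dist_eq]
  have e : (h ^ 2)⁻¹ * sdiff2 u x (h • y) - fderiv ℝ (fderiv ℝ u) x y y =
      (h ^ 2)⁻¹ * (sdiff2 u x (h • y) - fderiv ℝ (fderiv ℝ u) x y y * h ^ 2) := by
    field_simp
  rw [e, abs_mul, abs_of_pos (by positivity), inv_mul_lt_iff₀ hh2]
  nlinarith

variable {n : ℕ} {s Cns : ℝ}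

theorem integrable_jumpX (hn : 1 ≤ n) (hs : s ∈ Ioo (0 : ℝ) 1) (hC : 0 ≤ Cns) {u : En n → ℝ}
    (hu : MemL2s n s u) (x : En n) {h : ℝ} (hh : 0 < h) :
    Integrable (fun y => u (x + y)) (latt n h) ∧
    Integrable (fun y => u (x + y)) (trunc (fracMeas n s Cns) h) := by
  refine ⟨integrable_latt _ h, integrableOn_powMeas hC (measurableSet_trunc h) ?_⟩
  have := integrableOn_shift_mul_rpow (S := univ) (by have := hs.1; positivity) hh MeasurableSet.univ
    hu.1.aestronglyMeasurable (integrableOn_univ.2 hu.2) x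
  exact this.mono_set fun y hy => ⟨mem_univ _, hy.2⟩

theorem gen_trunc_fracMeas (hC : 0 ≤ Cns) (u : En n → ℝ) (x : En n) {h : ℝ} (hh : 0 < h) :
    gen (trunc (fracMeas n s Cns) h) u x = -(Cns * ∫ y in {y : En n | h ≤ ‖x - y‖},
      (u x - u y) / ‖x - y‖ ^ ((n : ℝ) + 2 * s)) := by
  have hm : MeasurableSet {y : En n | h ≤ ‖x - y‖} :=
    measurableSet_le measurable_const (by fun_prop)
  rw [gen, trunc, setIntegral_powMeas hC _ (measurableSet_trunc h), ← mul_neg, ← integral_neg,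
    ← integral_indicator (measurableSet_trunc h), ← integral_indicator hm,
    ← integral_add_left_eq_self (indicator {y : En n | h ≤ ‖x - y‖} _) x]
  congr 1
  refine integral_congr_ae (Eventually.of_forall fun y => ?_)
  simp only
  by_cases hy : h ≤ ‖y‖
  · rw [indicator_of_mem (by exact ⟨hh, hy⟩),
      indicator_of_mem (show x + y ∈ {y : En n | h ≤ ‖x - y‖} by simpa using hy),
      Real.rpow_neg (norm_nonneg _), ← div_eq_mul_inv, ← neg_div, neg_sub, sub_add_cancel_left,
      norm_neg]
  · rw [indicator_of_notMem (fun h' => hy h'.2),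
      indicator_of_notMem (show x + y ∉ {y : En n | h ≤ ‖x - y‖} by simpa using hy)]

theorem tendsto_gen_jumpX (hn : 1 ≤ n) (hs : s ∈ Ioo (0 : ℝ) 1) (hC : 0 ≤ Cns) {u : En n → ℝ}
    (hu : MemL2s n s u) {x : En n} (hx : ContDiffAt ℝ 2 u x) {L : ℝ}
    (hL : HasFracLap n s Cns u x L) :
    Tendsto (fun h => gen (jumpX n s Cns h) u x) (nhdsWithin 0 (Ioi 0)) (nhds (lap u x - L)) := by
  have h1 : Tendsto (fun h => gen (latt n h) u x) (nhdsWithin 0 (Ioi 0)) (nhds (lap u x)) := by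
    simp_rw [gen_latt]
    exact tendsto_finsetSum _ fun i _ => tendsto_sdiff2_quotient hx (eDir i)
  refine (h1.sub hL).congr' ?_
  filter_upwards [self_mem_nhdsWithin] with h (hh : 0 < h)
  obtain ⟨i1, i2⟩ := integrable_jumpX hn hs hC hu x hh
  have := isFiniteMeasure_trunc (integrable_min_fracMeas hn hs hC) h
  have j1 : Integrable (fun y => u (x + y) - u x) (latt n h) := i1.sub (integrable_const _)
  have j2 : Integrable (fun y => u (x + y) - u x) (trunc (fracMeas n s Cns) h) :=
    i2.sub (integrable_const _)
  rw [sub_eq_add_neg, ← gen_trunc_fracMeas hC u x hh, gen, gen, gen, jumpX,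
    integral_add_measure j1 j2]

end SpatialConsistency

section Deficit

variable {n : ℕ}

theorem exists_lipschitz_of_locally {w : En n → ℝ} {R : ℝ}
    (hloc : ∀ x, ∃ K, ∃ t ∈ nhds x, LipschitzOnWith K w t) (hR : ∀ x, R < ‖x‖ → w x = 0) :
    ∃ k, ∀ x y, |w x - w y| ≤ k * ‖x - y‖ := by
  have hcpt := isCompact_closedBall (0 : En n) (R + 1)
  have hlo : LocallyLipschitzOn (Metric.closedBall (0 : En n) (R + 1)) w := fun x _ => by
    obtain ⟨K, t, ht, h⟩ := hloc x
    exact ⟨K, t, mem_nhdsWithin_of_mem_nhds ht, h⟩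
  obtain ⟨K, hK⟩ := hlo.exists_lipschitzOnWith_of_compact hcpt
  obtain ⟨M, hM⟩ := hcpt.exists_bound_of_continuousOn hK.continuousOn
  have hfar : ∀ x y : En n, ‖y‖ ≤ R → R + 1 < ‖x‖ → |w y - w x| ≤ max (K : ℝ) M * ‖y - x‖ := by
    intro x y hy hx
    have h1 : 1 ≤ ‖y - x‖ := by
      have := norm_sub_norm_le x y
      rw [norm_sub_rev] at this
      linarith
    have h2 := hM y (by rw [mem_closedBall_zero_iff]; linarith)
    rw [hR x (by linarith), sub_zero, ← Real.norm_eq_abs]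
    have h3 : 0 ≤ max (K : ℝ) M := K.2.trans (le_max_left _ _)
    calc ‖w y‖ ≤ max (K : ℝ) M * 1 := by rw [mul_one]; exact h2.trans (le_max_right _ _)
      _ ≤ _ := mul_le_mul_of_nonneg_left h1 h3
  have hpos : 0 ≤ max (K : ℝ) M := K.2.trans (le_max_left _ _)
  refine ⟨max K M, fun x y => ?_⟩
  by_cases hx : R < ‖x‖
  · by_cases hy : R < ‖y‖
    · rw [hR x hx, hR y hy, sub_self, abs_zero]
      positivity
    · push Not at hy
      by_cases hx' : R + 1 < ‖x‖
      · rw [abs_sub_comm, norm_sub_rev]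
        exact hfar x y hy hx'
      · have := hK.dist_le_mul x (by simpa using hx') y (by rw [mem_closedBall_zero_iff]; linarith)
        rw [Real.dist_eq, dist_eq_norm] at this
        exact this.trans (mul_le_mul_of_nonneg_right (le_max_left _ _) (norm_nonneg _))
  · push Not at hx
    by_cases hy' : R + 1 < ‖y‖
    · exact hfar y x hx hy'
    · have := hK.dist_le_mul x (by rw [mem_closedBall_zero_iff]; linarith) y (by simpa using hy')
      rw [Real.dist_eq, dist_eq_norm] at this
      exact this.trans (mul_le_mul_of_nonneg_right (le_max_left _ _) (norm_nonneg _))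

/-- The negative part of `u + ε`. -/
def deficit (ε u : ℝ) : ℝ := max (-u - ε) 0

theorem deficit_nonneg (ε u : ℝ) : 0 ≤ deficit ε u := le_max_right _ _

theorem le_deficit (ε u : ℝ) : -u - ε ≤ deficit ε u := le_max_left _ _

theorem deficit_eq_zero {ε u : ℝ} (h : -ε ≤ u) : deficit ε u = 0 := max_eq_right (by linarith)

theorem deficit_of_ne_zero {ε u : ℝ} (h : deficit ε u ≠ 0) : deficit ε u = -u - ε :=
  (max_choice _ _).resolve_right h

theorem abs_deficit_sub_le (ε u v : ℝ) : |deficit ε u - deficit ε v| ≤ |u - v| := by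
  have := abs_max_sub_max_le_abs (-u - ε) (-v - ε) 0
  rwa [show -u - ε - (-v - ε) = -(u - v) by ring, abs_neg] at this

theorem deficit_le {ε u m : ℝ} (hε : 0 ≤ ε) (h : m ≤ u) : deficit ε u ≤ |m| :=
  max_le (by linarith [neg_abs_le m]) (abs_nonneg m)

theorem exists_lipschitz_deficit {Ω : Set (En n)} (hΩ : IsOpen Ω) {u : En n → ℝ}
    (hu : ContDiffOn ℝ 2 u Ω) (hlsc : LowerSemicontinuousOn u (closure Ω))
    (hext : ∀ x ∈ Ωᶜ, 0 ≤ u x) {ε : ℝ} (hε : 0 < ε) {R : ℝ} (hR : ∀ x ∈ Ω, ‖x‖ ≤ R) :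
    ∃ k, ∀ x y, |deficit ε (u x) - deficit ε (u y)| ≤ k * ‖x - y‖ := by
  refine exists_lipschitz_of_locally (w := fun x => deficit ε (u x)) (R := R) (fun x => ?_)
    fun x hx => deficit_eq_zero ?_
  · by_cases hx : x ∈ Ω
    · obtain ⟨K, t, ht, h⟩ := ((hu.contDiffAt (hΩ.mem_nhds hx)).of_le
        (by norm_num : (1 : WithTop ℕ∞) ≤ 2)).exists_lipschitzOnWith
      refine ⟨K, t, ht, LipschitzOnWith.of_dist_le_mul fun a ha b hb => ?_⟩
      refine le_trans ?_ (h.dist_le_mul a ha b hb)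
      simpa only [Real.dist_eq] using abs_deficit_sub_le ε (u a) (u b)
    · have h0 : ∀ᶠ y in nhds x, -ε < u y := by
        by_cases hxc : x ∈ closure Ω
        · have := hlsc x hxc (-ε) (by linarith [hext x hx])
          rw [eventually_nhdsWithin_iff] at this
          filter_upwards [this] with y hy
          by_cases hyc : y ∈ closure Ω
          · exact hy hyc
          · linarith [hext y fun h => hyc (subset_closure h)]
        · filter_upwards [isClosed_closure.isOpen_compl.mem_nhds hxc] with y hy
          linarith [hext y fun h => hy (subset_closure h)]
      refine ⟨0, _, h0, LipschitzOnWith.of_dist_le_mul fun a ha b hb => ?_⟩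
      have ha' : -ε < u a := ha
      have hb' : -ε < u b := hb
      rw [deficit_eq_zero ha'.le, deficit_eq_zero hb'.le, dist_self]
      positivity
  · linarith [hext x fun h => (hR x h).not_gt hx]

theorem neg_gen_le_gen_deficit {V : Type*} [AddCommGroup V] [MeasurableSpace V] {N : Measure V}
    [IsFiniteMeasure N] {ε : ℝ} {v : V → ℝ} (hb : BM fun y => deficit ε (v y)) {z : V}
    (hm : Measurable fun ζ : V => z + ζ)
    (hi : Integrable (fun ζ => v (z + ζ)) N) (hz : deficit ε (v z) ≠ 0) :
    -gen N v z ≤ gen N (fun y => deficit ε (v y)) z := by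
  rw [gen, gen, ← integral_neg]
  refine integral_mono (hi.sub (integrable_const _)).neg
    (((hb.comp hm).integrable N).sub (integrable_const _)) fun ζ => ?_
  have h1 := le_deficit ε (v (z + ζ))
  have h2 := deficit_of_ne_zero hz
  simp only
  linarith

end Deficit

section Width

variable {n : ℕ} {Ω : Set (En n)}

theorem abs_coord_le_norm (x : En n) (i : Fin n) : |x i| ≤ ‖x‖ := by
  simpa using PiLp.norm_apply_le x i

theorem isBounded_image_coord (hb : Bornology.IsBounded Ω) (i : Fin n) :
    BddAbove ((fun x : En n => x i) '' Ω) ∧ BddBelow ((fun x : En n => x i) '' Ω) := by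
  obtain ⟨R, hR⟩ := hb.exists_norm_le
  constructor
  · refine ⟨R, ?_⟩
    rintro _ ⟨x, hx, rfl⟩
    exact (le_abs_self _).trans ((abs_coord_le_norm x i).trans (hR x hx))
  · refine ⟨-R, ?_⟩
    rintro _ ⟨x, hx, rfl⟩
    exact (neg_le_neg ((abs_coord_le_norm x i).trans (hR x hx))).trans (neg_abs_le _)

theorem sub_le_widthLast (hb : Bornology.IsBounded Ω) (i : Fin n) {x y : En n} (hx : x ∈ Ω)
    (hy : y ∈ Ω) : x i - y i ≤ widthLast i Ω := by
  obtain ⟨h1, h2⟩ := isBounded_image_coord hb i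
  exact sub_le_sub (le_csSup h1 ⟨x, hx, rfl⟩) (csInf_le h2 ⟨y, hy, rfl⟩)

theorem abs_sub_le_widthLast (hb : Bornology.IsBounded Ω) (i : Fin n) {x y : En n} (hx : x ∈ Ω)
    (hy : y ∈ Ω) : |x i - y i| ≤ widthLast i Ω :=
  abs_sub_le_iff.2 ⟨sub_le_widthLast hb i hx hy, sub_le_widthLast hb i hy hx⟩

theorem widthLast_pos (hΩ : IsOpen Ω) (hne : Ω.Nonempty) (hb : Bornology.IsBounded Ω)
    (i : Fin n) : 0 < widthLast i Ω := by
  obtain ⟨x, hx⟩ := hne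
  obtain ⟨r, hr, hball⟩ := Metric.isOpen_iff.1 hΩ x hx
  have hy : x + (r / 2) • eDir i ∈ Ω := hball (by
    rw [mem_ball_iff_norm, add_sub_cancel_left, norm_smul, norm_eDir, mul_one, Real.norm_eq_abs,
      abs_of_pos (by linarith)]
    linarith)
  have := sub_le_widthLast hb i hy hx
  simp [eDir] at this
  linarith

end Width

section NarrowRegion

theorem lt_of_width_mul_rpow_le {s c l K : ℝ} (hs : 0 < s) (hc : 0 < c) (hl : 0 < l) (hK : 0 ≤ K)
    (h : l * K ^ (1 / (2 * s)) ≤ c ^ (1 / (2 * s)) / 4) : K < c * (2 * l) ^ (-(2 * s)) := by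
  have h2s : 0 < 2 * s := by linarith
  have h0 : K ^ (1 / (2 * s)) < c ^ (1 / (2 * s)) / (2 * l) := by
    rw [lt_div_iff₀ (by linarith)]
    have := Real.rpow_pos_of_pos hc (1 / (2 * s))
    linarith
  have h1 := Real.rpow_lt_rpow (Real.rpow_nonneg hK _) h0 h2s
  rwa [← Real.rpow_mul hK, Real.div_rpow (Real.rpow_nonneg hc.le _) (by linarith),
    ← Real.rpow_mul hc.le, one_div_mul_cancel h2s.ne', Real.rpow_one, Real.rpow_one,
    div_eq_mul_inv, ← Real.rpow_neg (by linarith)] at h1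

end NarrowRegion

section NarrowRegion

variable {n : ℕ} {s α Cns : ℝ} {Ω : Set (En n)} {U : En n → ℝ → ℝ} {ε : ℝ}

theorem bm_deficit (hWx : ∀ t, ∃ k, ∀ x y, |deficit ε (U x t) - deficit ε (U y t)| ≤ k * ‖x - y‖)
    (hUt : ∀ x, Continuous (U x)) (hε : 0 ≤ ε) {m : ℝ} (hm : ∀ x ∈ Ω, ∀ t, m ≤ U x t)
    (hext : ∀ x ∈ Ωᶜ, ∀ t, 0 ≤ U x t) :
    BM fun z : En n × ℝ => deficit ε (U z.1 z.2) := by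
  constructor
  · have := measurable_uncurry_of_continuous_of_measurable
      (u := fun (t : ℝ) (x : En n) => deficit ε (U x t))
      (fun x => (((hUt x).neg.sub continuous_const).max continuous_const)) fun t => by
        obtain ⟨k, hk⟩ := hWx t
        exact (LipschitzWith.of_dist_le' (K := k) fun x y => by
          rw [Real.dist_eq, dist_eq_norm]; exact hk x y).continuous.measurable
    exact this.comp measurable_swap
  · refine ⟨|m|, fun z => ?_⟩
    rw [abs_of_nonneg (deficit_nonneg _ _)]
    by_cases hz : z.1 ∈ Ω
    · exact deficit_le hε (hm _ hz _)
    · rw [deficit_eq_zero (by linarith [hext _ hz z.2])]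
      positivity

theorem eventually_le_gen_deficit (hn : 1 ≤ n) (hs : s ∈ Ioo (0 : ℝ) 1) (hC : 0 ≤ Cns)
    {J : JumpFamily n} (hJσ : J.σ = jumpX n s Cns)
    (hJν : ∀ v, ContDiff ℝ 1 v → MemLminus α v → ∀ t,
      (∀ h, Integrable (fun τ => v (t + τ)) (J.ν h)) ∧
        Tendsto (fun h => gen (J.ν h) v t) (nhdsWithin 0 (Ioi 0)) (nhds (-marchaud α v t)))
    (hb : BM fun z : En n × ℝ => deficit ε (U z.1 z.2)) {z : En n × ℝ}
    (hx : ContDiffAt ℝ 2 (fun x => U x z.2) z.1) (hu : MemL2s n s fun x => U x z.2)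
    (hv : ContDiff ℝ 1 (U z.1)) (hvm : MemLminus α (U z.1)) {L : ℝ}
    (hL : HasFracLap n s Cns (fun x => U x z.2) z.1 L) (hz : deficit ε (U z.1 z.2) ≠ 0)
    {a : ℝ} (ha : a < marchaud α (U z.1) z.2 + L - lap (fun x => U x z.2) z.1) :
    ∀ᶠ h in nhdsWithin 0 (Ioi 0), a ≤ gen (J.full h) (fun z => deficit ε (U z.1 z.2)) z := by
  have h1 := tendsto_gen_jumpX hn hs hC hu hx hL
  obtain ⟨hi, h2⟩ := hJν _ hv hvm z.2
  have h3 := (h1.neg.add h2.neg).eventually (lt_mem_nhds (show a < _ by linarith))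
  filter_upwards [h3, self_mem_nhdsWithin] with h h4 (hh : 0 < h)
  have := isFiniteMeasure_jumpX hn hs hC h
  obtain ⟨i1, i2⟩ := integrable_jumpX hn hs hC hu z.1 hh
  rw [JumpFamily.gen_full hb, hJσ]
  refine h4.le.trans (add_le_add ?_ ?_)
  · exact neg_gen_le_gen_deficit (hb.slice z.2) (measurable_const_add _) (i1.add_measure i2) hz
  · exact neg_gen_le_gen_deficit (hb.slice' z.1) (measurable_const_add _) (hi h) hz

theorem deficit_le_of_narrow (hn : 1 ≤ n) (i₀ : Fin n) (hs : s ∈ Ioo (0 : ℝ) 1) (hα : 0 < α)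
    (hα1 : α ≤ 1) (hC : 0 ≤ Cns) (hΩ : IsOpen Ω) (hne : Ω.Nonempty)
    (hbd : Bornology.IsBounded Ω)
    (hUx : ∀ t, ContDiffOn ℝ 2 (fun x => U x t) Ω ∧ MemL2s n s fun x => U x t)
    (hUt : ∀ x, ContDiff ℝ 1 (U x) ∧ MemLminus α (U x)) {m : ℝ}
    (hm : ∀ x ∈ Ω, ∀ t, m ≤ U x t)
    (hlsc : ∀ t, LowerSemicontinuousOn (fun x => U x t) (closure Ω))
    {LU : En n → ℝ → ℝ} (hLU : ∀ x ∈ Ω, ∀ t, HasFracLap n s Cns (fun y => U y t) x (LU x t))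
    {K : ℝ} (hK : 0 ≤ K)
    (hsup : ∀ x ∈ Ω, ∀ t, U x t ≤ 0 →
      K * U x t ≤ marchaud α (U x) t + LU x t - lap (fun y => U y t) x)
    (hext : ∀ x ∈ Ωᶜ, ∀ t, 0 ≤ U x t) {Λ : ℝ}
    (hΛ : Λ ≤ Cns * (3 ^ (-((n : ℝ) + 2 * s)) * volume.real (Metric.ball (0 : En n) 1)) *
      (2 * widthLast i₀ Ω) ^ (-(2 * s))) (hKΛ : K < Λ) (hε : 0 < ε) (x : En n) (t : ℝ) :
    deficit ε (U x t) ≤ K * ε / (Λ - K) := by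
  obtain ⟨J, hJσ, hJν⟩ := exists_jumpFamily (n := n) hn hs hC hα hα1
  obtain ⟨R, hR⟩ := hbd.exists_norm_le
  have hl := widthLast_pos hΩ hne hbd i₀
  have hmem : ∀ {x t}, deficit ε (U x t) ≠ 0 → x ∈ Ω := fun {x t} h => by
    by_contra hx
    exact h (deficit_eq_zero (by linarith [hext x hx t]))
  have hlip := fun t => exists_lipschitz_deficit hΩ (hUx t).1 (hlsc t) (fun x hx => hext x hx t)
    hε hR
  have hb := bm_deficit hlip (fun x => (hUt x).1.continuous) hε.le hm hext
  refine JumpFamily.le_of_subsolution (J := J) (W := fun z => deficit ε (U z.1 z.2)) (R := R)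
    (ε₀ := ε) (B := {y : En n | 2 * widthLast i₀ Ω ≤ |y i₀|}) (δ := widthLast i₀ Ω)
    hb (fun z => deficit_nonneg _ _) (fun z hz => ?_)
    (fun x => ((hUt x).1.continuous.neg.sub continuous_const).max continuous_const)
    hlip hK hε.le (fun z η hη => ?_) (measurableSet_le measurable_const (by fun_prop)) hKΛ hl ?_
    (fun x t x' t' y hy hW hd => ?_) (x, t)
  · by_contra h
    exact (hR _ (hmem h)).not_gt hz
  · by_cases hz : deficit ε (U z.1 z.2) = 0
    · refine Eventually.of_forall fun h => ?_
      have hg : 0 ≤ gen (J.full h) (fun z => deficit ε (U z.1 z.2)) z := by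
        refine integral_nonneg fun ζ => ?_
        simp only [hz, sub_zero]
        exact deficit_nonneg _ _
      simp only [hz, zero_add]
      nlinarith
    · have hzΩ := hmem hz
      have heq := deficit_of_ne_zero hz
      have hU : U z.1 z.2 = -(deficit ε (U z.1 z.2) + ε) := by linarith
      have h0 := deficit_nonneg ε (U z.1 z.2)
      have hs' := hsup z.1 hzΩ z.2 (by linarith)
      rw [hU, mul_neg] at hs'
      refine eventually_le_gen_deficit hn hs hC hJσ hJν hb
        ((hUx z.2).1.contDiffAt (hΩ.mem_nhds hzΩ)) (hUx z.2).2 (hUt z.1).1 (hUt z.1).2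
        (hLU z.1 hzΩ z.2) hz ?_
      linarith
  · rw [hJσ]
    filter_upwards [Ioc_mem_nhdsGT (show (0 : ℝ) < 2 * widthLast i₀ Ω by linarith)] with h hh
    exact hΛ.trans (le_jumpX_real hn hs hC i₀ (by linarith) hh.1 hh.2)
  · by_contra hW'
    have h1 := abs_sub_le_widthLast hbd i₀ (hmem hW') (hmem hW)
    have h2 := abs_coord_le_norm (x' - x - y) i₀
    have h3 : 2 * widthLast i₀ Ω ≤ |y i₀| := hy
    have h4 : |y i₀| ≤ |x' i₀ - x i₀| + |(x' - x - y) i₀| := by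
      have := abs_sub (x' i₀ - x i₀) ((x' - x - y) i₀)
      simpa using this
    linarith

end NarrowRegion

/-- narrow region principle for the mixed operator (parabolic case). -/
theorem narrow_region_principle_parabolic
    (n : ℕ) (hn : 1 ≤ n) (i₀ : Fin n) (hi₀ : (i₀ : ℕ) = n - 1)
    (s : ℝ) (hs : s ∈ Set.Ioo (0 : ℝ) 1)
    (α : ℝ) (hα : 0 < α) (hα1 : α ≤ 1) (Cns : ℝ) (hCns : 0 < Cns) :
    ∃ C : ℝ, 0 < C ∧
      ∀ (Ω : Set (En n)), IsOpen Ω → IsConnected Ω → Bornology.IsBounded Ω →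
      ∀ (U : En n → ℝ → ℝ),
        (∀ t : ℝ, ContDiffOn ℝ 2 (fun x => U x t) Ω ∧ MemL2s n s fun x => U x t) →
        (∀ x : En n, ContDiff ℝ 1 (U x) ∧ MemLminus α (U x)) →
        (∃ m : ℝ, ∀ x ∈ closure Ω, ∀ t : ℝ, m ≤ U x t) →
        (∀ t : ℝ, LowerSemicontinuousOn (fun x => U x t) (closure Ω)) →
      ∀ (Cc : En n → ℝ → ℝ), BddBelow {r : ℝ | ∃ x ∈ Ω, ∃ t : ℝ, Cc x t = r} →
      ∀ (LU : En n → ℝ → ℝ),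
        (∀ x ∈ Ω, ∀ t : ℝ, HasFracLap n s Cns (fun y => U y t) x (LU x t)) →
      (∀ x ∈ Ω, ∀ t : ℝ,
        0 ≤ marchaud α (U x) t + LU x t - lap (fun y => U y t) x + Cc x t * U x t) →
      (∀ x ∈ Ωᶜ, ∀ t : ℝ, 0 ≤ U x t) →
      widthLast i₀ Ω * |sInf {r : ℝ | ∃ x ∈ Ω, ∃ t : ℝ, Cc x t = r}| ^ (1 / (2 * s)) ≤ C →
      ∀ x ∈ Ω, ∀ t : ℝ, 0 ≤ U x t := by
  set c : ℝ := Cns * (3 ^ (-((n : ℝ) + 2 * s)) * volume.real (Metric.ball (0 : En n) 1)) with hc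
  have hc0 : 0 < c := by
    have : 0 < volume.real (Metric.ball (0 : En n) 1) := ENNReal.toReal_pos
      (Metric.measure_ball_pos volume _ one_pos).ne' measure_ball_lt_top.ne
    positivity
  refine ⟨c ^ (1 / (2 * s)) / 4, by positivity, fun Ω hΩ hconn hbd U hUx hUt hm hlsc Cc hCc LU hLU
    hsup hext hwidth x hx t => ?_⟩
  obtain ⟨m, hm⟩ := hm
  set K := |sInf {r : ℝ | ∃ x ∈ Ω, ∃ t : ℝ, Cc x t = r}| with hK
  have hKΛ := lt_of_width_mul_rpow_le hs.1 hc0 (widthLast_pos hΩ hconn.nonempty hbd i₀)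
    (abs_nonneg _) hwidth
  rw [← hK] at hKΛ
  set Λ := c * (2 * widthLast i₀ Ω) ^ (-(2 * s)) with hΛ
  have hCK : ∀ x ∈ Ω, ∀ t, -K ≤ Cc x t := fun x hx t =>
    (neg_abs_le _).trans (csInf_le hCc ⟨x, hx, t, rfl⟩)
  have hsup' : ∀ x ∈ Ω, ∀ t, U x t ≤ 0 →
      K * U x t ≤ marchaud α (U x) t + LU x t - lap (fun y => U y t) x := fun x hx t hU => by
    have h1 := hsup x hx t
    have h2 := mul_le_mul_of_nonpos_right (hCK x hx t) hU
    linarith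
  have hD : 0 < Λ - K := sub_pos.2 hKΛ
  have key : ∀ ε > 0, -U x t ≤ (1 + K / (Λ - K)) * ε := fun ε hε => by
    have h1 := deficit_le_of_narrow hn i₀ hs hα hα1 hCns.le hΩ hconn.nonempty hbd hUx hUt
      (fun x hx => hm x (subset_closure hx)) hlsc hLU (abs_nonneg _) hsup' hext le_rfl hKΛ hε x t
    have h2 := le_deficit ε (U x t)
    have h3 : K * ε / (Λ - K) = K / (Λ - K) * ε := by ring
    linarith
  have hp : 0 < 1 + K / (Λ - K) := by positivity
  refine neg_nonpos.1 (le_of_forall_pos_le_add fun η hη => ?_)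
  have h := key (η / (1 + K / (Λ - K))) (by positivity)
  rwa [mul_div_cancel₀ _ hp.ne', ← zero_add η] at h
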